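/- Let n > 5 and let B be a saturated blocker of size n−1 of the convex n-gon. Then, after a cyclic rotation of the vertex labels (replacing each edge {i,j} of B by {i+r, j+r} mod n for some fixed r), B has one of the following three forms. Type 1 (seagull): there are integers ℓ, m with 2 < ℓ < m and 4 ≤ m ≤ n−3, and integers i_1,…,i_{n−3−m} ∈ {1,…,m+1} ∖ {ℓ}, such that B = B_Sea ∪ B_1 ∪ B_2, where B_Sea = {{ℓ−2,ℓ},{ℓ−2,ℓ+1},{ℓ−1,ℓ+2},{ℓ,ℓ+2}}, B_1 = {{j,j+2} : 0 ≤ j ≤ ℓ−3} ∪ {{j,j+2} : ℓ+1 ≤ j ≤ m}, B_2 = {{m+2+j, i_j} : 1 ≤ j ≤ n−3−m}, and whenever |i_{j₁} − i_{j₂}| ≥ 2 the edges {m+2+j₁, i_{j₁}} and {m+2+j₂, i_{j₂}} do not cross. Type 2 (butterfly): there are integers ℓ, m with 2 < ℓ < m−1 and 5 ≤ m ≤ n−3, and integers i_1,…,i_{n−3−m} ∈ {1,…,m+1} ∖ {ℓ, ℓ+1}, such that B = B_Buf ∪ B_1 ∪ B_2, where B_Buf = {{ℓ−2,ℓ},{ℓ−2,ℓ+1},{ℓ−1,ℓ+2},{ℓ,ℓ+3},{ℓ+1,ℓ+3}},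 B_1 = {{j,j+2} : 0 ≤ j ≤ ℓ−3} ∪ {{j,j+2} : ℓ+2 ≤ j ≤ m}, B_2 = {{m+2+j, i_j} : 1 ≤ j ≤ n−3−m}, with the same non-crossing condition on the i_j as in Type 1. Type 3 (bouquet): there are integers ℓ, m, k, t with 0 < ℓ < m+2 < k, t ≥ 2, k+t ≤ n−1, and integers i_j, defined for j ∈ {1,…,k−m−3} ∪ {k+t−m−1,…,n−3−m}, with i_j ∈ {ℓ,…,m+1} for 1 ≤ j ≤ k−m−3 and i_j ∈ {1,…,ℓ} for k+t−m−1 ≤ j ≤ n−3−m, such that B = B_Bouq ∪ B_{1,L} ∪ B_{1,R} ∪ B_{2,L} ∪ B_{2,R}, where B_Bouq = {{ℓ−1,ℓ+1},{k,ℓ−1},{k+t,ℓ+1},{k,k+t}} ∪ {{k+s,ℓ} : 1 ≤ s ≤ t−1}, B_{1,L} = {{j,j+2} : ℓ ≤ j ≤ m} (empty exactly when ℓ = m+1), B_{1,R} = {{j,j+2} : 0 ≤ j ≤ ℓ−2} (empty exactly when ℓ = 1), B_{2,L} = {{m+2+j, i_j} : 1 ≤ j ≤ k−m−3} (empty exactly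 when k = m+3), B_{2,R} = {{m+2+j, i_j} : k+t−m−1 ≤ j ≤ n−3−m} (empty exactly when k+t = n−1), and whenever |i_{j₁} − i_{j₂}| ≥ 2 the edges {m+2+j₁, i_{j₁}} and {m+2+j₂, i_{j₂}} do not cross. -/

import Mathlib

open Finset

namespace ConvexBlocker

/-- `c` lies strictly inside the (positively oriented) open arc from `a` to `b`. -/
def Btw (n : ℕ) (a c b : ZMod n) : Prop :=
  0 < (c - a).val ∧ (c - a).val < (b - a).val

/-- Two edges of the convex `n`-gon cross: their endpoints are four pairwise distinct
vertices which interleave in the cyclic order. -/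
def Cross (n : ℕ) (e f : Sym2 (ZMod n)) : Prop :=
  ∃ a b c d : ZMod n, e = s(a, b) ∧ f = s(c, d) ∧
    0 < (c - a).val ∧ (c - a).val < (b - a).val ∧ (b - a).val < (d - a).val

/-- `e` is an edge (an unordered pair of distinct vertices) of the `n`-gon. -/
def IsEdge (n : ℕ) (e : Sym2 (ZMod n)) : Prop :=
  ∃ a b : ZMod n, e = s(a, b) ∧ a ≠ b

/-- `e` is a diagonal of the convex `n`-gon: an edge of order at least 2, i.e. both open
arcs between its endpoints are nonempty. -/
def IsDiagonal (n : ℕ) (e : Sym2 (ZMod n)) : Prop :=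
  ∃ a b : ZMod n, e = s(a, b) ∧ a ≠ b ∧ (∃ c, Btw n a c b) ∧ (∃ d, Btw n b d a)

/-- A triangulation of the convex `n`-gon: an inclusion-maximal set of pairwise
non-crossing diagonals. -/
def IsTriangulation (n : ℕ) (T : Finset (Sym2 (ZMod n))) : Prop :=
  (∀ e ∈ T, IsDiagonal n e) ∧
  (∀ e ∈ T, ∀ f ∈ T, ¬ Cross n e f) ∧
  (∀ e, IsDiagonal n e → e ∉ T → ∃ f ∈ T, Cross n e f)

/-- A blocker of the convex `n`-gon: a set of edges meeting every triangulation. -/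
def IsBlocker (n : ℕ) (B : Finset (Sym2 (ZMod n))) : Prop :=
  (∀ e ∈ B, IsEdge n e) ∧
  ∀ T : Finset (Sym2 (ZMod n)), IsTriangulation n T → (B ∩ T).Nonempty

/-- A saturated blocker of the convex `n`-gon. -/
def IsSaturatedBlocker (n : ℕ) (B : Finset (Sym2 (ZMod n))) : Prop :=
  IsBlocker n B ∧ ∀ e ∈ B, ¬ IsBlocker n (B.erase e)

/-- `e` is an edge of the sub-polygon on the vertex set `S`. -/
def IsEdgeOn (n : ℕ) (S : Finset (ZMod n)) (e : Sym2 (ZMod n)) : Prop :=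
  ∃ a b : ZMod n, e = s(a, b) ∧ a ∈ S ∧ b ∈ S ∧ a ≠ b

/-- `e` is a diagonal of the sub-polygon on `S` (with the inherited cyclic order):
its endpoints are distinct members of `S` which are not cyclically consecutive in `S`. -/
def IsDiagonalOn (n : ℕ) (S : Finset (ZMod n)) (e : Sym2 (ZMod n)) : Prop :=
  ∃ a b : ZMod n, e = s(a, b) ∧ a ∈ S ∧ b ∈ S ∧ a ≠ b ∧
    (∃ c ∈ S, Btw n a c b) ∧ (∃ d ∈ S, Btw n b d a)

/-- A triangulation of the sub-polygon on `S`. -/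
def IsTriangulationOn (n : ℕ) (S : Finset (ZMod n)) (T : Finset (Sym2 (ZMod n))) : Prop :=
  (∀ e ∈ T, IsDiagonalOn n S e) ∧
  (∀ e ∈ T, ∀ f ∈ T, ¬ Cross n e f) ∧
  (∀ e, IsDiagonalOn n S e → e ∉ T → ∃ f ∈ T, Cross n e f)

/-- A blocker of the sub-polygon on `S`. -/
def IsBlockerOn (n : ℕ) (S : Finset (ZMod n)) (B : Finset (Sym2 (ZMod n))) : Prop :=
  (∀ e ∈ B, IsEdgeOn n S e) ∧
  ∀ T : Finset (Sym2 (ZMod n)), IsTriangulationOn n S T → (B ∩ T).Nonempty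

/-- A saturated blocker of the sub-polygon on `S`. -/
def IsSaturatedBlockerOn (n : ℕ) (S : Finset (ZMod n)) (B : Finset (Sym2 (ZMod n))) : Prop :=
  IsBlockerOn n S B ∧ ∀ e ∈ B, ¬ IsBlockerOn n S (B.erase e)

/-- The degree of the vertex `v` in the set of edges `B`. -/
noncomputable def degB (n : ℕ) (B : Finset (Sym2 (ZMod n))) (v : ZMod n) : ℕ :=
  (B.filter (fun e => v ∈ e)).card

end ConvexBlocker

namespace ConvexBlocker

/-- Type 1 ("seagull") saturated blockers of size `n-1`. -/
def SeagullType (n : ℕ) (B : Finset (Sym2 (ZMod n))) : Prop :=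
  ∃ l m : ℕ, 2 < l ∧ l < m ∧ 4 ≤ m ∧ m ≤ n - 3 ∧
    ∃ idx : ℕ → ℕ,
      (∀ j ∈ Finset.Icc 1 (n - 3 - m), 1 ≤ idx j ∧ idx j ≤ m + 1 ∧ idx j ≠ l) ∧
      B = ({s(((l - 2 : ℕ) : ZMod n), ((l : ℕ) : ZMod n)),
            s(((l - 2 : ℕ) : ZMod n), ((l + 1 : ℕ) : ZMod n)),
            s(((l - 1 : ℕ) : ZMod n), ((l + 2 : ℕ) : ZMod n)),
            s(((l : ℕ) : ZMod n), ((l + 2 : ℕ) : ZMod n))} : Finset (Sym2 (ZMod n))) ∪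
          ((Finset.range (l - 2)).image
            (fun j : ℕ => s((j : ZMod n), ((j + 2 : ℕ) : ZMod n)))) ∪
          ((Finset.Icc (l + 1) m).image
            (fun j : ℕ => s((j : ZMod n), ((j + 2 : ℕ) : ZMod n)))) ∪
          ((Finset.Icc 1 (n - 3 - m)).image
            (fun j => s(((m + 2 + j : ℕ) : ZMod n), ((idx j : ℕ) : ZMod n)))) ∧
      (∀ j₁ ∈ Finset.Icc 1 (n - 3 - m), ∀ j₂ ∈ Finset.Icc 1 (n - 3 - m),
        (idx j₁ + 2 ≤ idx j₂ ∨ idx j₂ + 2 ≤ idx j₁) →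
        ¬ Cross n (s(((m + 2 + j₁ : ℕ) : ZMod n), ((idx j₁ : ℕ) : ZMod n)))
                  (s(((m + 2 + j₂ : ℕ) : ZMod n), ((idx j₂ : ℕ) : ZMod n))))

/-- Type 2 ("butterfly") saturated blockers of size `n-1`. -/
def ButterflyType (n : ℕ) (B : Finset (Sym2 (ZMod n))) : Prop :=
  ∃ l m : ℕ, 2 < l ∧ l + 1 < m ∧ 5 ≤ m ∧ m ≤ n - 3 ∧
    ∃ idx : ℕ → ℕ,
      (∀ j ∈ Finset.Icc 1 (n - 3 - m),
        1 ≤ idx j ∧ idx j ≤ m + 1 ∧ idx j ≠ l ∧ idx j ≠ l + 1) ∧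
      B = ({s(((l - 2 : ℕ) : ZMod n), ((l : ℕ) : ZMod n)),
            s(((l - 2 : ℕ) : ZMod n), ((l + 1 : ℕ) : ZMod n)),
            s(((l - 1 : ℕ) : ZMod n), ((l + 2 : ℕ) : ZMod n)),
            s(((l : ℕ) : ZMod n), ((l + 3 : ℕ) : ZMod n)),
            s(((l + 1 : ℕ) : ZMod n), ((l + 3 : ℕ) : ZMod n))} : Finset (Sym2 (ZMod n))) ∪
          ((Finset.range (l - 2)).image
            (fun j : ℕ => s((j : ZMod n), ((j + 2 : ℕ) : ZMod n)))) ∪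
          ((Finset.Icc (l + 2) m).image
            (fun j : ℕ => s((j : ZMod n), ((j + 2 : ℕ) : ZMod n)))) ∪
          ((Finset.Icc 1 (n - 3 - m)).image
            (fun j => s(((m + 2 + j : ℕ) : ZMod n), ((idx j : ℕ) : ZMod n)))) ∧
      (∀ j₁ ∈ Finset.Icc 1 (n - 3 - m), ∀ j₂ ∈ Finset.Icc 1 (n - 3 - m),
        (idx j₁ + 2 ≤ idx j₂ ∨ idx j₂ + 2 ≤ idx j₁) →
        ¬ Cross n (s(((m + 2 + j₁ : ℕ) : ZMod n), ((idx j₁ : ℕ) : ZMod n)))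
                  (s(((m + 2 + j₂ : ℕ) : ZMod n), ((idx j₂ : ℕ) : ZMod n))))

/-- Type 3 ("bouquet") saturated blockers of size `n-1`. -/
def BouquetType (n : ℕ) (B : Finset (Sym2 (ZMod n))) : Prop :=
  ∃ l m k t : ℕ, 0 < l ∧ l < m + 2 ∧ m + 2 < k ∧ 2 ≤ t ∧ k + t ≤ n - 1 ∧
    ∃ idx : ℕ → ℕ,
      (∀ j ∈ Finset.Icc 1 (k - m - 3), l ≤ idx j ∧ idx j ≤ m + 1) ∧
      (∀ j ∈ Finset.Icc (k + t - m - 1) (n - 3 - m), 1 ≤ idx j ∧ idx j ≤ l) ∧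
      B = ({s(((l - 1 : ℕ) : ZMod n), ((l + 1 : ℕ) : ZMod n)),
            s(((k : ℕ) : ZMod n), ((l - 1 : ℕ) : ZMod n)),
            s(((k + t : ℕ) : ZMod n), ((l + 1 : ℕ) : ZMod n)),
            s(((k : ℕ) : ZMod n), ((k + t : ℕ) : ZMod n))} : Finset (Sym2 (ZMod n))) ∪
          ((Finset.Icc 1 (t - 1)).image
            (fun u => s(((k + u : ℕ) : ZMod n), ((l : ℕ) : ZMod n)))) ∪
          ((Finset.Icc l m).image
            (fun j : ℕ => s((j : ZMod n), ((j + 2 : ℕ) : ZMod n)))) ∪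
          ((Finset.range (l - 1)).image
            (fun j : ℕ => s((j : ZMod n), ((j + 2 : ℕ) : ZMod n)))) ∪
          ((Finset.Icc 1 (k - m - 3)).image
            (fun j => s(((m + 2 + j : ℕ) : ZMod n), ((idx j : ℕ) : ZMod n)))) ∪
          ((Finset.Icc (k + t - m - 1) (n - 3 - m)).image
            (fun j => s(((m + 2 + j : ℕ) : ZMod n), ((idx j : ℕ) : ZMod n)))) ∧
      (∀ j₁ ∈ Finset.Icc 1 (k - m - 3) ∪ Finset.Icc (k + t - m - 1) (n - 3 - m),
        ∀ j₂ ∈ Finset.Icc 1 (k - m - 3) ∪ Finset.Icc (k + t - m - 1) (n - 3 - m),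
        (idx j₁ + 2 ≤ idx j₂ ∨ idx j₂ + 2 ≤ idx j₁) →
        ¬ Cross n (s(((m + 2 + j₁ : ℕ) : ZMod n), ((idx j₁ : ℕ) : ZMod n)))
                  (s(((m + 2 + j₂ : ℕ) : ZMod n), ((idx j₂ : ℕ) : ZMod n))))

end ConvexBlocker

namespace ConvexBlocker

/-- A triangulation of the polygon on the integer interval `[a, b]` (with base `{a, b}`) none of
whose edges, except possibly the base, satisfies `R`. -/
inductive Tri (R : ℤ → ℤ → Prop) : ℤ → ℤ → Prop
  | leaf (a : ℤ) : Tri R a (a + 1)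
  | node {a c b : ℤ} : a < c → c < b → ¬ R a c → ¬ R c b → Tri R a c → Tri R c b → Tri R a b

namespace Tri

variable {R : ℤ → ℤ → Prop} {a b c : ℤ}

lemma lt (h : Tri R a b) : a < b := by
  induction h with
  | leaf a => omega
  | node => omega

lemma leaf' (h : b = a + 1) : Tri R a b := h ▸ leaf a

lemma shift (h : Tri R a b) (s : ℤ) : Tri (fun x y => R (x + s) (y + s)) (a - s) (b - s) := by
  induction h with
  | leaf a => exact leaf' (by ring)
  | @node a c b h1 h2 h3 h4 _ _ ih1 ih2 =>
    exact node (c := c - s) (by omega) (by omega) (by simpa using h3) (by simpa using h4) ih1 ih2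

lemma reflect (hs : ∀ x y, R x y → R y x) (h : Tri R a b) :
    Tri (fun x y => R (-x) (-y)) (-b) (-a) := by
  induction h with
  | leaf a => exact leaf' (by ring)
  | @node a c b h1 h2 h3 h4 _ _ ih1 ih2 =>
    refine node (c := -c) (by omega) (by omega) ?_ ?_ ih2 ih1
    · simpa using fun h => h4 (hs _ _ h)
    · simpa using fun h => h3 (hs _ _ h)

/-- Extend a triangulation by a fan at the left end. -/
lemma fanL (hadj : ∀ x, ¬ R x (x + 1)) (h : Tri R a c) (hcb : c ≤ b)
    (hk : ∀ k, c ≤ k → k < b → ¬ R a k) : Tri R a b := by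
  obtain ⟨d, rfl⟩ : ∃ d : ℕ, b = c + d := ⟨(b - c).toNat, by omega⟩
  induction d with
  | zero => simpa using h
  | succ d ih =>
    have h1 := ih (by omega) (fun k h1 h2 => hk k h1 (by push_cast; omega))
    have := h.lt
    refine node (c := c + d) (by omega) (by push_cast; omega) (hk _ (by omega) (by push_cast; omega))
      ?_ h1 (leaf' (by push_cast; ring))
    have := hadj (c + d)
    push_cast
    rwa [← add_assoc]

/-- Extend a triangulation by a fan at the right end. -/
lemma fanR (hadj : ∀ x, ¬ R x (x + 1)) (h : Tri R c b) (hac : a ≤ c)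
    (hk : ∀ k, a < k → k ≤ c → ¬ R k b) : Tri R a b := by
  obtain ⟨d, rfl⟩ : ∃ d : ℕ, a = c - d := ⟨(c - a).toNat, by omega⟩
  induction d with
  | zero => simpa using h
  | succ d ih =>
    have h1 := ih (by omega) (fun k h1 h2 => hk k (by push_cast; omega) h2)
    have := h.lt
    refine node (c := c - d) (by push_cast; omega) (by omega) ?_
      (hk _ (by push_cast; omega) (by omega)) (leaf' (by push_cast; ring)) h1
    have := hadj (c - d - 1)
    push_cast
    rwa [sub_add_cancel, sub_sub] at this

/-- The whole fan at the left end. -/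
lemma fan_left (hadj : ∀ x, ¬ R x (x + 1)) (hab : a < b) (hk : ∀ k, a < k → k < b → ¬ R a k) :
    Tri R a b :=
  fanL hadj (leaf a) (by omega) fun k _ _ => hk k (by omega) (by omega)

/-- The whole fan at the right end. -/
lemma fan_right (hadj : ∀ x, ¬ R x (x + 1)) (hab : a < b) (hk : ∀ k, a < k → k < b → ¬ R k b) :
    Tri R a b :=
  fanR hadj (leaf' (a := b - 1) (by ring)) (by omega) fun k _ _ => hk k (by omega) (by omega)

lemma ear (hadj : ∀ x, ¬ R x (x + 1)) (h : b = a + 2) : Tri R a b :=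
  fan_left hadj (by omega) fun k _ _ => by
    obtain rfl : k = a + 1 := by omega
    exact hadj a

end Tri

/-- The order embedding of `ℤ` into itself that omits the value `i`. -/
def skip (i x : ℤ) : ℤ := if x < i then x else x + 1

lemma Tri.of_skip {Q : ℤ → ℤ → Prop} (hadj : ∀ x, ¬ Q x (x + 1)) {i a b : ℤ}
    (h : Tri (fun x y => Q (skip i x) (skip i y)) a b) :
    Tri Q (skip i a) (skip i b) := by
  induction h with
  | leaf a =>
    by_cases h1 : a + 1 < i
    · simpa [skip, h1, show a < i by omega] using Tri.leaf a
    by_cases h2 : a < i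
    · simp only [skip, h1, h2, if_true, if_false]
      exact Tri.ear hadj (by ring)
    · simp only [skip, h1, h2, if_false]
      exact Tri.leaf _
  | @node a c b h1 h2 h3 h4 _ _ ih1 ih2 =>
    refine Tri.node ?_ ?_ h3 h4 ih1 ih2 <;> · unfold skip; split_ifs <;> omega

/-- A blocker of the polygon on `[a, a + N + 1]` has at least `N` edges. -/
lemma exists_edges_of_not_tri (N : ℕ) : ∀ (Q : ℤ → ℤ → Prop) (a b : ℤ), b = a + N + 1 →
    (∀ x, ¬ Q x (x + 1)) → ¬ Tri Q a b →
    ∃ S : Finset (ℤ × ℤ), S.card = N ∧ ∀ p ∈ S, a ≤ p.1 ∧ p.1 < p.2 ∧ p.2 ≤ b ∧ Q p.1 p.2 := by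
  induction N with
  | zero => exact fun Q a b _ _ _ => ⟨∅, by simp⟩
  | succ N ih =>
    intro Q a b hb hadj hT
    push_cast at hb
    by_cases hall : ∀ i, a < i → i < b → Q (i - 1) (i + 1)
    · refine ⟨(Finset.Ioo a b).image (fun i => (i - 1, i + 1)), ?_, ?_⟩
      · rw [Finset.card_image_of_injective _ (fun x y h => by simpa using h)]
        simp; omega
      · intro p hp
        simp only [Finset.mem_image, Finset.mem_Ioo] at hp
        obtain ⟨i, hi, rfl⟩ := hp
        exact ⟨by dsimp only; omega, by dsimp only; omega, by dsimp only; omega, hall i hi.1 hi.2⟩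
    · push Not at hall
      obtain ⟨i, hai, hib, hi⟩ := hall
      have hedge : ∃ p : ℤ × ℤ, (p.1 = i ∨ p.2 = i) ∧ a ≤ p.1 ∧ p.1 < p.2 ∧ p.2 ≤ b ∧ Q p.1 p.2 := by
        by_contra hno
        push Not at hno
        exact hT (Tri.node hai hib (hno (a, i) (.inr rfl) le_rfl hai hib.le)
          (hno (i, b) (.inl rfl) hai.le hib le_rfl)
          (Tri.fan_right hadj hai fun k h1 h2 => hno (k, i) (.inr rfl) h1.le h2 hib.le)
          (Tri.fan_left hadj hib fun k h1 h2 => hno (i, k) (.inl rfl) hai.le h1 h2.le))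
      obtain ⟨p, hpi, hp⟩ := hedge
      obtain ⟨S, hS, hS'⟩ := ih (fun x y => Q (skip i x) (skip i y)) a (b - 1) (by omega)
        (fun x => by
          unfold skip
          split_ifs with h1 h2 h2
          · exact hadj x
          · obtain rfl : i = x + 1 := by omega
            simpa [add_assoc] using hi
          · omega
          · exact hadj _)
        (fun h => hT (by
          have := Tri.of_skip hadj h
          rwa [skip, if_pos hai, skip, if_neg (by omega), sub_add_cancel] at this))
      have hsk : Function.Injective (skip i) := fun x y h => by
        unfold skip at h; split_ifs at h <;> omega
      refine ⟨insert p (S.image (Prod.map (skip i) (skip i))), ?_, ?_⟩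
      · rw [Finset.card_insert_of_notMem, Finset.card_image_of_injective _ (hsk.prodMap hsk), hS]
        intro hmem
        simp only [Finset.mem_image, Prod.map] at hmem
        obtain ⟨q, _, rfl⟩ := hmem
        simp only [skip] at hpi
        split_ifs at hpi <;> omega
      · intro q hq
        rcases Finset.mem_insert.1 hq with rfl | hq
        · exact hp
        obtain ⟨r, hr, rfl⟩ := Finset.mem_image.1 hq
        have := hS' r hr
        refine ⟨?_, ?_, ?_, this.2.2.2⟩ <;> simp only [Prod.map, skip] <;> split_ifs <;> omega

/-- The sufficient condition for being a blocker that all minimum-size blockers satisfy: an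
interval of consecutive covered vertices, while the remaining vertices send edges to it without
essential crossings. -/
def MinStruct (n : ℤ) (R : ℤ → ℤ → Prop) : Prop :=
  ∃ (m : ℤ) (x : ℤ → ℤ), 0 ≤ m ∧ m + 3 ≤ n ∧ (∀ j, 1 ≤ j → j ≤ m + 1 → R (j - 1) (j + 1)) ∧
    (∀ w, m + 3 ≤ w → w < n → 1 ≤ x w ∧ x w ≤ m + 1 ∧ R w (x w)) ∧
    ∀ w w', m + 3 ≤ w → w < w' → w' < n → x w' ≤ x w + 1

/-- The edge relation (lifted to `ℤ`) of a blocker with at most `n - 1` edges, all of them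
diagonals, that does not contain a blocker of the minimum-size shape. -/
structure Cfg (n : ℤ) (R : ℤ → ℤ → Prop) : Prop where
  six_le : 6 ≤ n
  symm : ∀ x y, R x y → R y x
  per : ∀ x y, R x (y + n) ↔ R x y
  irr : ∀ x, ¬ R x x
  adj : ∀ x, ¬ R x (x + 1)
  blk : ∀ a, ¬ Tri R a (a + n)
  card_le : ∀ (a : ℤ) (S : Finset (ℤ × ℤ)),
    (∀ p ∈ S, a ≤ p.1 ∧ p.1 < p.2 ∧ p.2 < a + n ∧ R p.1 p.2) → (S.card : ℤ) ≤ n - 1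
  noMin : ∀ s, ¬ MinStruct n (fun x y => R (x + s) (y + s))

/-- The vertex `v` is covered. -/
def Cov (R : ℤ → ℤ → Prop) (v : ℤ) : Prop := R (v - 1) (v + 1)

/-- Modulo `n`, `x` is the only neighbour of `v`. -/
def D1 (n : ℤ) (R : ℤ → ℤ → Prop) (v x : ℤ) : Prop := R v x ∧ ∀ y, R v y → n ∣ y - x

/-- `v` has at least two neighbours modulo `n`. -/
def Two (n : ℤ) (R : ℤ → ℤ → Prop) (v : ℤ) : Prop := ∃ x y, R v x ∧ R v y ∧ ¬ n ∣ y - x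

lemma MinStruct.reflect {n : ℤ} {R : ℤ → ℤ → Prop} (hs : ∀ x y, R x y → R y x)
    (hp : ∀ x y, R x (y + n) ↔ R x y) (h : MinStruct n R) :
    ∃ s, MinStruct n (fun x y => R (-(x + s)) (-(y + s))) := by
  obtain ⟨m, x, h1, h2, h3, h4, h5⟩ := h
  have hp' : ∀ x y, R (x + n) y ↔ R x y := fun x y =>
    ⟨fun h => hs _ _ ((hp _ _).1 (hs _ _ h)), fun h => hs _ _ ((hp _ _).2 (hs _ _ h))⟩
  refine ⟨-(m + 2), m, fun w => m + 2 - x (n + m + 2 - w), h1, h2, ?_, ?_, ?_⟩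
  · intro j hj1 hj2
    have := hs _ _ (h3 (m + 2 - j) (by omega) (by omega))
    convert this using 1 <;> omega
  · intro w hw1 hw2
    obtain ⟨h6, h7, h8⟩ := h4 (n + m + 2 - w) (by omega) (by omega)
    refine ⟨by dsimp only; omega, by dsimp only; omega, (hp' _ _).1 ?_⟩
    rw [show -(w + -(m + 2)) + n = n + m + 2 - w by ring]
    dsimp only
    rwa [show -(m + 2 - x (n + m + 2 - w) + -(m + 2)) = x (n + m + 2 - w) by ring]
  · intro w w' hw1 hw2 hw3
    have := h5 (n + m + 2 - w') (n + m + 2 - w) (by omega) (by omega) (by omega)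
    dsimp only; omega

namespace Cfg

variable {n : ℤ} {R : ℤ → ℤ → Prop}

lemma per' (h : Cfg n R) (x y : ℤ) : R (x + n) y ↔ R x y :=
  ⟨fun h' => h.symm _ _ ((h.per _ _).1 (h.symm _ _ h')),
    fun h' => h.symm _ _ ((h.per _ _).2 (h.symm _ _ h'))⟩

lemma shift (h : Cfg n R) (s : ℤ) : Cfg n (fun x y => R (x + s) (y + s)) where
  six_le := h.six_le
  symm x y := h.symm _ _
  per x y := by rw [add_right_comm, h.per]
  irr x := h.irr _
  adj x := by have := h.adj (x + s); rwa [add_right_comm] at this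
  blk a ht := h.blk (a + s) (by
    have := ht.shift (-s)
    simp only [neg_add_cancel_right, sub_neg_eq_add] at this
    rwa [add_right_comm] at this)
  card_le a S hS := by
    have := h.card_le (a + s) (S.image (fun p => (p.1 + s, p.2 + s))) (by
      intro p hp
      obtain ⟨q, hq, rfl⟩ := Finset.mem_image.1 hp
      have := hS q hq
      exact ⟨by dsimp; omega, by dsimp; omega, by dsimp; omega, this.2.2.2⟩)
    rwa [Finset.card_image_of_injective _ (fun p q hpq => by
      simpa [Prod.ext_iff] using hpq)] at this
  noMin t ht := h.noMin (t + s) (by simpa only [add_assoc] using ht)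

lemma reflect (h : Cfg n R) : Cfg n (fun x y => R (-x) (-y)) where
  six_le := h.six_le
  symm x y := h.symm _ _
  per x y := by rw [← h.per]; ring_nf
  irr x := h.irr _
  adj x h' := h.adj (-x - 1) (by
    have := h.symm _ _ h'
    convert this using 1 <;> ring)
  blk a ht := h.blk (-(a + n)) (by
    have := ht.reflect (fun x y => h.symm _ _)
    simp only [neg_neg] at this
    convert this using 1; ring)
  card_le a S hS := by
    have := h.card_le (-a - n + 1) (S.image (fun p => (-p.2, -p.1))) (by
      intro p hp
      obtain ⟨q, hq, rfl⟩ := Finset.mem_image.1 hp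
      have := hS q hq
      exact ⟨by dsimp; omega, by dsimp; omega, by dsimp; omega, h.symm _ _ this.2.2.2⟩)
    rwa [Finset.card_image_of_injective _ (fun p q hpq => by
      simp only [Prod.mk.injEq, neg_inj] at hpq
      exact Prod.ext hpq.2 hpq.1)] at this
  noMin t ht := by
    obtain ⟨s, hs⟩ := ht.reflect (fun x y => h.symm _ _) (fun x y => by rw [← h.per]; ring_nf)
    refine h.noMin (s - t) ?_
    have e : ∀ x, -(-(x + s) + t) = x + (s - t) := fun x => by ring
    simpa only [e] using hs

lemma per_dvd (h : Cfg n R) {x y y' : ℤ} (hd : n ∣ y' - y) (hR : R x y) : R x y' := by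
  obtain ⟨k, hk⟩ := hd
  obtain rfl : y' = y + n * k := by omega
  clear hk
  induction k using Int.induction_on with
  | zero => simpa
  | succ k ih => rw [show y + n * (k + 1) = y + n * k + n by ring, h.per]; exact ih
  | pred k ih => rw [← h.per, show y + n * (-k - 1) + n = y + n * -k by ring]; exact ih

lemma per_dvd_left (h : Cfg n R) {x x' y : ℤ} (hd : n ∣ x' - x) (hR : R x y) : R x' y :=
  h.symm _ _ (h.per_dvd hd (h.symm _ _ hR))

end Cfg

lemma eq_of_dvd_of_small {n d : ℤ} (h : n ∣ d) (h1 : -(2 * n) < d) (h2 : d < 2 * n) :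
    d = 0 ∨ d = n ∨ d = -n := by
  obtain ⟨k, rfl⟩ := h
  have hn : 0 < n := by linarith
  have h3 : k < 2 := by nlinarith
  have h4 : -2 < k := by nlinarith
  have : k = 0 ∨ k = 1 ∨ k = -1 := by omega
  rcases this with rfl | rfl | rfl <;> simp

lemma D1.not {n : ℤ} {R : ℤ → ℤ → Prop} {v x z : ℤ} (h : D1 n R v x)
    (hz : x - 2 * n < z ∧ z < x + 2 * n ∧ z ≠ x ∧ z ≠ x + n ∧ z ≠ x - n) : ¬ R v z := fun hR => by
  have := eq_of_dvd_of_small (h.2 z hR) (by omega) (by omega)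
  omega

/-- Modulo `n`, the neighbours of `v` are exactly `x` and `y`. -/
def D2 (n : ℤ) (R : ℤ → ℤ → Prop) (v x y : ℤ) : Prop :=
  x < y ∧ y < x + n ∧ R v x ∧ R v y ∧ ∀ z, R v z → n ∣ z - x ∨ n ∣ z - y

lemma D2.not {n : ℤ} {R : ℤ → ℤ → Prop} {v x y z : ℤ} (h : D2 n R v x y)
    (hz : y - 2 * n < z ∧ z < x + 2 * n ∧ z ≠ x ∧ z ≠ y ∧ z ≠ x + n ∧ z ≠ y - n ∧ z ≠ x - n ∧
      z ≠ y + n) : ¬ R v z := fun hR => by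
  obtain ⟨h1, h2, -, -, h3⟩ := h
  rcases h3 z hR with h4 | h4 <;>
  · have := eq_of_dvd_of_small h4 (by omega) (by omega)
    omega

namespace Cfg

variable {n : ℤ} {R : ℤ → ℤ → Prop}

lemma sep (h : Cfg n R) {i j : ℤ} (hij : i < j) (hj : j < i + n) (hR : ¬ R i j) (h1 : Tri R i j)
    (h2 : Tri R j (i + n)) : False :=
  h.blk i (Tri.node hij hj hR (fun h' => hR (h.symm _ _ ((h.per _ _).1 h'))) h1 h2)

lemma two (h : Cfg n R) {i j z : ℤ} (hjz : j < z) (hz : z < i + n) (hR : ¬ R i j) (h1 : Tri R i j)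
    (h2 : ∀ k, j < k → k ≤ z → ¬ R j k) (h3 : ∀ k, z ≤ k → k < i + n → ¬ R i k) : False := by
  have h3' : ∀ k, z ≤ k → k < i + n → ¬ R k (i + n) := fun k h4 h5 h6 =>
    h3 k h4 h5 (h.symm _ _ ((h.per _ _).1 h6))
  exact h.sep h1.lt (by omega) hR h1 (Tri.node hjz hz (h2 z hjz le_rfl) (h3' z le_rfl hz)
    (Tri.fan_left h.adj hjz fun k h4 h5 => h2 k h4 h5.le)
    (Tri.fan_right h.adj hz fun k h4 h5 => h3' k h4.le h5))

lemma three (h : Cfg n R) {w i v a b : ℤ} (hva : v < a) (hab : a ≤ b)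
    (hb : b < w + n) (hwi : ¬ R w i) (hTwi : Tri R w i) (hiv : ¬ R i v) (hTiv : Tri R i v)
    (hv : ∀ k, v < k → k ≤ a → ¬ R v k) (hi : ∀ k, a ≤ k → k ≤ b → ¬ R i k)
    (hw : ∀ k, b ≤ k → k < w + n → ¬ R w k) : False := by
  have hw' : ∀ k, b ≤ k → k < w + n → ¬ R k (w + n) := fun k h4 h5 h6 =>
    hw k h4 h5 (h.symm _ _ ((h.per _ _).1 h6))
  have h1 := hTwi.lt
  have h2 := hTiv.lt
  have hTib : Tri R i b := Tri.fanL h.adj (Tri.node h2 hva hiv (hv a hva le_rfl) hTiv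
    (Tri.fan_left h.adj hva fun k h4 h5 => hv k h4 h5.le)) hab fun k h4 h5 => hi k h4 h5.le
  exact h.sep h1 (by omega) hwi hTwi (Tri.node hTib.lt hb (hi b hab le_rfl) (hw' b le_rfl hb) hTib
    (Tri.fan_right h.adj hb fun k h4 h5 => hw' k h4.le h5))

/-- Distinctness as unordered pairs. -/
def DistinctEdges (p q : ℤ × ℤ) : Prop :=
  ¬ (p.1 = q.1 ∧ p.2 = q.2) ∧ ¬ (p.1 = q.2 ∧ p.2 = q.1)

lemma length_add_card_le (h : Cfg n R) (a : ℤ) (S : Finset (ℤ × ℤ))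
    (hS : ∀ p ∈ S, a ≤ p.1 ∧ p.1 < p.2 ∧ p.2 < a + n ∧ R p.1 p.2)
    (L : List (ℤ × ℤ)) (hp : L.Pairwise DistinctEdges)
    (hL : ∀ p ∈ L, a ≤ p.1 ∧ p.1 < a + n ∧ a ≤ p.2 ∧ p.2 < a + n ∧ R p.1 p.2 ∧
      ∀ q ∈ S, DistinctEdges p q) : (L.length + S.card : ℤ) ≤ n - 1 := by
  classical
  let f : ℤ × ℤ → ℤ × ℤ := fun p => (min p.1 p.2, max p.1 p.2)
  have hf : ∀ p q, DistinctEdges p q → f p ≠ f q := by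
    rintro ⟨a, b⟩ ⟨c, d⟩ hpq heq
    simp only [DistinctEdges, f, Prod.mk.injEq] at *
    omega
  have hnd : (L.map f).Nodup := by
    rw [List.Nodup, List.pairwise_map]
    exact hp.imp fun {p q} h => hf p q h
  have hdisj : Disjoint (L.map f).toFinset S := by
    rw [Finset.disjoint_left]
    intro p hp hpS
    simp only [List.mem_toFinset, List.mem_map] at hp
    obtain ⟨q, hq, rfl⟩ := hp
    have h1 := (hL q hq).2.2.2.2.2 _ hpS
    simp only [DistinctEdges, f] at h1
    omega
  have hcard := h.card_le a ((L.map f).toFinset ∪ S) (by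
    intro p hp
    rcases Finset.mem_union.1 hp with hp | hp
    · simp only [List.mem_toFinset, List.mem_map] at hp
      obtain ⟨⟨x, y⟩, hq, rfl⟩ := hp
      obtain ⟨h1, h2, h3, h4, h5, -⟩ := hL _ hq
      dsimp only at h1 h2 h3 h4 h5
      rcases lt_trichotomy x y with hxy | rfl | hxy
      · simp only [f, min_eq_left hxy.le, max_eq_right hxy.le]
        exact ⟨h1, hxy, h4, h5⟩
      · exact absurd h5 (h.irr x)
      · simp only [f, min_eq_right hxy.le, max_eq_left hxy.le]
        exact ⟨h3, hxy, h2, h.symm _ _ h5⟩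
    · exact hS p hp)
  rw [Finset.card_union_of_disjoint hdisj, List.toFinset_card_of_nodup hnd] at hcard
  simpa using hcard

/-- After cutting off the vertices strictly between `a` and `b` the remaining polygon is blocked,
so few edges touch the vertices cut off. -/
lemma length_le_of_cut (h : Cfg n R) {a b : ℤ} (hT : Tri R a b) (hb : b < a + n) (hg : ¬ R a b)
    (L : List (ℤ × ℤ)) (hp : L.Pairwise DistinctEdges)
    (hL : ∀ p ∈ L, b - n ≤ p.1 ∧ p.1 < b ∧ b - n ≤ p.2 ∧ p.2 < b ∧ R p.1 p.2 ∧
      (a < p.1 ∨ a < p.2)) : (L.length : ℤ) ≤ b - a := by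
  have hlt := hT.lt
  obtain ⟨S, hS, hS'⟩ := exists_edges_of_not_tri (a + n - b - 1).toNat R (b - n) a (by omega) h.adj
    (fun h1 => h.blk (b - n) (Tri.node h1.lt (by omega)
      (fun h' => hg (h.symm _ _ (by have := (h.per' _ _).2 h'; rwa [sub_add_cancel] at this)))
      (by rwa [sub_add_cancel]) h1 (by rwa [sub_add_cancel])))
  have := h.length_add_card_le (b - n) S
    (fun p hp => ⟨by have := hS' p hp; omega, by have := hS' p hp; omega,
      by have := hS' p hp; omega, (hS' p hp).2.2.2⟩) L hp
    (fun p hp => by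
      obtain ⟨h1, h2, h3, h4, h5, h6⟩ := hL p hp
      refine ⟨h1, by omega, h3, by omega, h5, fun q hq => ?_⟩
      have := hS' q hq
      unfold DistinctEdges
      omega)
  omega

/-- The same as `length_le_of_cut`, where additionally an uncovered vertex `w` is cut off. -/
lemma length_le_of_cut_ear (h : Cfg n R) {a b w : ℤ} (hT : Tri R a b) (hg : ¬ R a b)
    (hw1 : b - n < w) (hw2 : w < a) (hw : ¬ Cov R w)
    (L : List (ℤ × ℤ)) (hp : L.Pairwise DistinctEdges)
    (hL : ∀ p ∈ L, b - n ≤ p.1 ∧ p.1 < b ∧ b - n ≤ p.2 ∧ p.2 < b ∧ R p.1 p.2 ∧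
      (a < p.1 ∨ a < p.2 ∨ p.1 = w ∨ p.2 = w)) : (L.length : ℤ) ≤ b - a + 1 := by
  have hlt := hT.lt
  obtain ⟨S, hS, hS'⟩ := exists_edges_of_not_tri (a + n - b - 2).toNat
    (fun x y => R (skip w x) (skip w y)) (b - n) (a - 1) (by omega)
    (fun x => by
      unfold skip
      split_ifs with h1 h2 h2
      · exact h.adj x
      · obtain rfl : w = x + 1 := by omega
        simpa [add_assoc, Cov] using hw
      · omega
      · exact h.adj _)
    (fun h0 => by
      have h1 := Tri.of_skip h.adj h0
      rw [skip, if_pos hw1, skip, if_neg (by omega), sub_add_cancel] at h1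
      exact h.blk (b - n) (Tri.node h1.lt (by omega)
        (fun h' => hg (h.symm _ _ (by have := (h.per' _ _).2 h'; rwa [sub_add_cancel] at this)))
        (by rwa [sub_add_cancel]) h1 (by rwa [sub_add_cancel])))
  have hsk : Function.Injective (skip w) := fun x y h => by
    unfold skip at h; split_ifs at h <;> omega
  have hS2 : ∀ q ∈ S.image (Prod.map (skip w) (skip w)), b - n ≤ q.1 ∧ q.1 < q.2 ∧ q.2 ≤ a ∧
      R q.1 q.2 ∧ q.1 ≠ w ∧ q.2 ≠ w := by
    intro q hq
    obtain ⟨r, hr, rfl⟩ := Finset.mem_image.1 hq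
    obtain ⟨h1, h2, h3, h4⟩ := hS' r hr
    refine ⟨?_, ?_, ?_, h4, ?_, ?_⟩ <;> simp only [Prod.map, skip] <;> split_ifs <;> omega
  have := h.length_add_card_le (b - n) (S.image (Prod.map (skip w) (skip w)))
    (fun p hp => ⟨(hS2 p hp).1, (hS2 p hp).2.1, by have := hS2 p hp; omega, (hS2 p hp).2.2.2.1⟩) L hp
    (fun p hp => by
      obtain ⟨h1, h2, h3, h4, h5, h6⟩ := hL p hp
      refine ⟨h1, by omega, h3, by omega, h5, fun q hq => ?_⟩
      have := hS2 q hq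
      unfold DistinctEdges
      omega)
  rw [Finset.card_image_of_injective _ (hsk.prodMap hsk)] at this
  omega

lemma exists_rep (h : Cfg n R) (a : ℤ) {v x : ℤ} (hR : R v x) :
    ∃ y, a ≤ y ∧ y < a + n ∧ R v y ∧ n ∣ y - x := by
  have hn := h.six_le
  have h1 := Int.emod_nonneg (x - a) (show n ≠ 0 by omega)
  have h2 := Int.emod_lt_of_pos (x - a) (show 0 < n by omega)
  have h3 : n ∣ a + (x - a) % n - x := by
    have := Int.emod_add_mul_ediv (x - a) n
    exact ⟨-((x - a) / n), by linarith⟩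
  exact ⟨a + (x - a) % n, by omega, by omega, h.per_dvd h3 hR, h3⟩

lemma nbr_window (h : Cfg n R) {v y : ℤ} (hR : R v y) (h1 : v ≤ y) (h2 : y < v + n) :
    v + 2 ≤ y ∧ y ≤ v + n - 2 := by
  have h3 : y ≠ v := fun e => h.irr v (e ▸ hR)
  have h4 : y ≠ v + 1 := fun e => h.adj v (e ▸ hR)
  have h5 : y ≠ v + n - 1 := fun e => h.adj (v - 1) (by
    have : R v (v - 1 + n) := by convert hR using 1; omega
    have := h.symm _ _ ((h.per _ _).1 this)
    simpa using this)
  omega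

/-- A neighbour of `v`, represented in the window starting at `v`. -/
lemma exists_window (h : Cfg n R) {v x : ℤ} (hR : R v x) :
    ∃ y, v + 2 ≤ y ∧ y ≤ v + n - 2 ∧ R v y ∧ n ∣ y - x := by
  obtain ⟨y, h1, h2, h3, h4⟩ := h.exists_rep v hR
  exact ⟨y, (h.nbr_window h3 h1 h2).1, (h.nbr_window h3 h1 h2).2, h3, h4⟩

lemma exists_nbr (h : Cfg n R) (v : ℤ) : ∃ y, R v y := by
  by_contra hno
  push Not at hno
  exact h.blk v (Tri.fan_left h.adj (by have := h.six_le; omega) fun k _ _ => hno k)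

lemma d1_or_two (h : Cfg n R) (v : ℤ) : (∃ x, D1 n R v x) ∨ Two n R v := by
  obtain ⟨x, hx⟩ := h.exists_nbr v
  by_cases hd : ∀ y, R v y → n ∣ y - x
  · exact .inl ⟨x, hx, hd⟩
  · push Not at hd
    obtain ⟨y, hy, hd⟩ := hd
    exact .inr ⟨x, y, hx, hy, hd⟩

lemma D1_rep (h : Cfg n R) {v x : ℤ} (hd : D1 n R v x) (a : ℤ) :
    ∃ y, a ≤ y ∧ y < a + n ∧ D1 n R v y := by
  obtain ⟨y, h1, h2, h3, h4⟩ := h.exists_rep a hd.1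
  exact ⟨y, h1, h2, h3, fun z hz => by have := (hd.2 z hz).sub h4; simpa using this⟩

lemma D1.not_two {v x : ℤ} (hd : D1 n R v x) : ¬ Two n R v := by
  rintro ⟨y, z, hy, hz, hyz⟩
  have := (hd.2 z hz).sub (hd.2 y hy)
  simp at this
  exact hyz this

lemma two_of_lt (h : Cfg n R) {v x y : ℤ} (hx : R v x) (hy : R v y) (h1 : x < y) (h2 : y < x + n) :
    Two n R v := ⟨x, y, hx, hy, fun hd => by
  have := h.six_le
  have := eq_of_dvd_of_small hd (by omega) (by omega)
  omega⟩

lemma Two.rep (h : Cfg n R) {v : ℤ} (ht : Two n R v) (a : ℤ) :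
    ∃ x y, a ≤ x ∧ x < y ∧ y < a + n ∧ R v x ∧ R v y := by
  obtain ⟨x, y, hx, hy, hxy⟩ := ht
  obtain ⟨x', h1, h2, h3, h4⟩ := h.exists_rep a hx
  obtain ⟨y', h5, h6, h7, h8⟩ := h.exists_rep a hy
  rcases lt_trichotomy x' y' with hlt | rfl | hlt
  · exact ⟨x', y', h1, hlt, h6, h3, h7⟩
  · exact absurd (by simpa using h4.sub h8) hxy
  · exact ⟨y', x', h5, hlt, h2, h7, h3⟩

lemma cov_per (h : Cfg n R) {v v' : ℤ} (hd : n ∣ v' - v) (hc : Cov R v) : Cov R v' :=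
  h.per_dvd (y := v + 1) (by simpa using hd) (h.per_dvd_left (x := v - 1) (by simpa using hd) hc)

/-- The unique neighbour of a vertex is covered. -/
lemma cov_of_D1 (h : Cfg n R) {v x : ℤ} (hd : D1 n R v x) : Cov R x := by
  have hn := h.six_le
  obtain ⟨y, h1, h2, hy, h3⟩ := h.exists_window hd.1
  have hd' : D1 n R v y := ⟨hy, fun z hz => by simpa using (hd.2 z hz).sub h3⟩
  refine h.cov_per (v := y) (by rw [← dvd_neg]; simpa using h3) ?_
  by_contra hc
  refine h.blk v (Tri.fanL (c := y + 1) h.adj ?_ (by omega) fun k _ _ => hd'.not (by omega))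
  exact Tri.node (c := y - 1) (by omega) (by omega) (hd'.not (by omega)) hc
    (Tri.fan_left h.adj (by omega) fun k _ _ => hd'.not (by omega)) (Tri.ear h.adj (by ring))

/-- An uncovered vertex has at most two neighbours. -/
lemma not_three (h : Cfg n R) {v a x y z : ℤ} (hc : ¬ Cov R v) (hx : R v x) (hy : R v y)
    (hz : R v z) (h1 : a ≤ x) (h2 : x < y) (h3 : y < z) (h4 : z < a + n) : False := by
  have hn := h.six_le
  -- move the three neighbours into the window `[v - n, v)`
  have key : ∀ x y z : ℤ, R v x → R v y → R v z → v - n ≤ x → x < v → v - n ≤ y → y < v →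
      v - n ≤ z → z < v → x ≠ y → x ≠ z → y ≠ z → False := by
    intro x y z hx hy hz _ _ _ _ _ _ _ _ _
    have hw : ∀ x, R v x → v - n ≤ x → x < v → v - n + 1 ≤ x := fun x hx h1 h2 => by
      have : x ≠ v - n := by
        rintro rfl
        have := (h.per _ _).2 hx
        rw [sub_add_cancel] at this
        exact h.irr _ this
      omega
    have := hw x hx ‹_› ‹_›
    have := hw y hy ‹_› ‹_›
    have := hw z hz ‹_› ‹_›
    have := h.length_le_of_cut (a := v - 1) (b := v + 1) (Tri.ear h.adj (by ring)) (by omega) hc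
      [(v, x), (v, y), (v, z)] (by simp [DistinctEdges]; omega) (by
        simp only [List.mem_cons, List.not_mem_nil, or_false]
        rintro p (rfl | rfl | rfl)
        · exact ⟨by dsimp only; omega, by dsimp only; omega, by dsimp only; omega,
            by dsimp only; omega, hx, by dsimp only; omega⟩
        · exact ⟨by dsimp only; omega, by dsimp only; omega, by dsimp only; omega,
            by dsimp only; omega, hy, by dsimp only; omega⟩
        · exact ⟨by dsimp only; omega, by dsimp only; omega, by dsimp only; omega,
            by dsimp only; omega, hz, by dsimp only; omega⟩)
    simp at this
  obtain ⟨x', a1, a2, a3, a4⟩ := h.exists_rep (v - n) hx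
  obtain ⟨y', b1, b2, b3, b4⟩ := h.exists_rep (v - n) hy
  obtain ⟨z', c1, c2, c3, c4⟩ := h.exists_rep (v - n) hz
  have hne : ∀ x y x' y' : ℤ, n ∣ x' - x → n ∣ y' - y → x < y → y < x + n → x' ≠ y' := by
    rintro x y x' _ hx hy hlt hlt' rfl
    have : n ∣ y - x := by simpa using hx.sub hy
    have := eq_of_dvd_of_small this (by omega) (by omega)
    omega
  exact key x' y' z' a3 b3 c3 a1 (by omega) b1 (by omega) c1 (by omega)
    (hne x y x' y' a4 b4 (by omega) (by omega)) (hne x z x' z' a4 c4 (by omega) (by omega))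
    (hne y z y' z' b4 c4 (by omega) (by omega))

lemma D2_of_two (h : Cfg n R) {v x y : ℤ} (hc : ¬ Cov R v) (hx : R v x) (hy : R v y) (h1 : x < y)
    (h2 : y < x + n) : D2 n R v x y := by
  refine ⟨h1, h2, hx, hy, fun z hz => ?_⟩
  obtain ⟨z', c1, c2, c3, c4⟩ := h.exists_rep x hz
  rcases eq_or_lt_of_le c1 with rfl | c1
  · left; rw [← dvd_neg]; simpa using c4
  rcases lt_trichotomy z' y with h3 | rfl | h3
  · exact (h.not_three hc hx c3 hy le_rfl c1 h3 h2).elim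
  · right; rw [← dvd_neg]; simpa using c4
  · exact (h.not_three hc hx hy c3 le_rfl h1 h3 c2).elim

/-- If `v` has exactly two neighbours and they are not adjacent, one of them is covered. -/
lemma cov_or_cov_of_D2 (h : Cfg n R) {v x y : ℤ} (hd : D2 n R v x y) (h1 : v < x)
    (hy : y < v + n) (hxy : x + 2 ≤ y) : Cov R x ∨ Cov R y := by
  by_contra! hc
  have hn := h.six_le
  have w1 := h.nbr_window hd.2.2.1 (by omega) (by omega)
  have w2 := h.nbr_window hd.2.2.2.1 (by omega) (by omega)
  have t1 : Tri R v (x + 1) := Tri.node (c := x - 1) (by omega) (by omega) (hd.not (by omega)) hc.1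
    (Tri.fan_left h.adj (by omega) fun k _ _ => hd.not (by omega)) (Tri.ear h.adj (by ring))
  have t2 : Tri R v (y + 1) := Tri.node (c := y - 1) (by omega) (by omega) (hd.not (by omega)) hc.2
    (Tri.fanL h.adj t1 (by omega) fun k _ _ => hd.not (by omega)) (Tri.ear h.adj (by ring))
  exact h.blk v (Tri.fanL h.adj t2 (by omega) fun k _ _ => hd.not (by omega))

/-- If `v` has exactly two neighbours `x` and `x + 1`, then either they are both covered or
`{x - 1, x + 2}` is an edge. -/
lemma edge_or_cov_of_D2 (h : Cfg n R) {v x : ℤ} (hd : D2 n R v x (x + 1)) (h1 : v < x)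
    (hy : x + 1 < v + n) : R (x - 1) (x + 2) ∨ (Cov R x ∧ Cov R (x + 1)) := by
  by_contra! hc
  have hn := h.six_le
  have w1 := h.nbr_window hd.2.2.1 (by omega) (by omega)
  have w2 := h.nbr_window hd.2.2.2.1 (by omega) (by omega)
  have t0 : Tri R (x - 1) (x + 2) := by
    by_cases hx : Cov R x
    · refine Tri.node (c := x) (by omega) (by omega) ?_ ?_ (Tri.leaf' (by ring))
        (Tri.ear h.adj (by ring))
      · have := h.adj (x - 1); rwa [sub_add_cancel] at this
      · have := hc.2 hx
        rwa [Cov, add_sub_cancel_right, add_assoc] at this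
    · refine Tri.node (c := x + 1) (by omega) (by omega) hx ?_ (Tri.ear h.adj (by ring))
        (Tri.leaf' (by ring))
      have := h.adj (x + 1); rwa [add_assoc] at this
  have t1 : Tri R v (x + 2) := Tri.node (c := x - 1) (by omega) (by omega) (hd.not (by omega)) hc.1
    (Tri.fan_left h.adj (by omega) fun k _ _ => hd.not (by omega)) t0
  exact h.blk v (Tri.fanL h.adj t1 (by omega) fun k _ _ => hd.not (by omega))

end Cfg

namespace Cfg

variable {n : ℤ} {R : ℤ → ℤ → Prop}

/-- Two non-adjacent uncovered vertices with at least two neighbours each are joined. -/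
lemma edge_of_two_two (h : Cfg n R) {i j : ℤ} (h1 : i + 2 ≤ j) (h2 : j ≤ i + n - 2)
    (hi : ¬ Cov R i) (hj : ¬ Cov R j) (ti : Two n R i) (tj : Two n R j) : R i j := by
  by_contra hR
  obtain ⟨x, y, x1, x2, x3, x4, x5⟩ := Two.rep h ti (i + 1 - n)
  obtain ⟨z, u, z1, z2, z3, z4, z5⟩ := Two.rep h tj (i + 1 - n)
  have hR' : ¬ R i (j - n) := fun h' => hR (by have := (h.per _ _).2 h'; rwa [sub_add_cancel] at this)
  have hd : n ∣ (j - n) - j := ⟨-1, by ring⟩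
  replace z4 := h.per_dvd_left hd z4
  replace z5 := h.per_dvd_left hd z5
  have e1 : x ≠ j - n := fun e => hR' (e ▸ x4)
  have e2 : y ≠ j - n := fun e => hR' (e ▸ x5)
  have := h.length_le_of_cut_ear (a := i - 1) (b := i + 1) (w := j - n) (Tri.ear h.adj (by ring)) hi
    (by omega) (by omega) (fun hc => hj (h.cov_per ⟨1, by ring⟩ hc))
    [(i, x), (i, y), (j - n, z), (j - n, u)] (by simp [DistinctEdges]; omega)
    (by simp [x4, x5, z4, z5]; omega)
  simp at this

/-- If two adjacent vertices, not both covered, have at least two neighbours each, then their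
outer neighbours on the boundary are joined. -/
lemma edge_of_two_succ (h : Cfg n R) {i : ℤ} (hc : ¬ Cov R i ∨ ¬ Cov R (i + 1)) (ti : Two n R i)
    (tj : Two n R (i + 1)) : R (i - 1) (i + 2) := by
  by_contra hR
  have hn := h.six_le
  obtain ⟨x, y, x1, x2, x3, x4, x5⟩ := Two.rep h ti (i + 2 - n)
  obtain ⟨z, u, z1, z2, z3, z4, z5⟩ := Two.rep h tj (i + 2 - n)
  have e1 : x ≠ i + 1 := fun e => h.adj i (e ▸ x4)
  have e2 : y ≠ i + 1 := fun e => h.adj i (e ▸ x5)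
  have t0 : Tri R (i - 1) (i + 2) := by
    rcases hc with hc | hc
    · refine Tri.node (c := i + 1) (by omega) (by omega) hc ?_ (Tri.ear h.adj (by ring))
        (Tri.leaf' (by ring))
      have := h.adj (i + 1); rwa [add_assoc] at this
    · refine Tri.node (c := i) (by omega) (by omega) ?_ ?_ (Tri.leaf' (by ring))
        (Tri.ear h.adj (by ring))
      · have := h.adj (i - 1); rwa [sub_add_cancel] at this
      · rwa [Cov, add_sub_cancel_right, add_assoc] at hc
  have := h.length_le_of_cut t0 (by omega) hR [(i, x), (i, y), (i + 1, z), (i + 1, u)]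
    (by simp [DistinctEdges]; omega) (by simp [x4, x5, z4, z5]; omega)
  simp at this

/-- Of two vertices with unique neighbours, one sends its edge to the far side. -/
lemma not_both_near (h : Cfg n R) {v w x y : ℤ} (hv : D1 n R v x) (hw : D1 n R w y)
    (h1 : v < w) (h2 : w < v + n) (hx : w < x) (hx' : x < v + n) (hy : v < y) (hy' : y < w) :
    False :=
  h.sep h1 h2 (hv.not (by omega)) (Tri.fan_left h.adj h1 fun k _ _ => hv.not (by omega))
    (Tri.fan_left h.adj h2 fun k _ _ => hw.not (by omega))

/-- Two unique edges from nearby vertices do not cross essentially. -/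
lemma le_add_one_of_D1 (h : Cfg n R) {v w x y : ℤ} (hv : D1 n R v x) (hw : D1 n R w y)
    (h1 : v < w) (hx : w < x) (hy' : y < v + n) : y ≤ x + 1 := by
  by_contra! hlt
  exact h.two (i := v) (j := w) (z := x + 1) (by omega) (by omega) (hv.not (by omega))
    (Tri.fan_left h.adj h1 fun k _ _ => hv.not (by omega)) (fun k _ _ => hw.not (by omega))
    (fun k _ _ => hv.not (by omega))

end Cfg

section Symmetry

variable {n : ℤ} {R : ℤ → ℤ → Prop}

lemma cov_shift (s v : ℤ) : Cov (fun x y => R (x + s) (y + s)) v ↔ Cov R (v + s) := by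
  unfold Cov
  beta_reduce
  rw [show v - 1 + s = v + s - 1 by ring, show v + 1 + s = v + s + 1 by ring]

lemma D1_shift (s v x : ℤ) :
    D1 n (fun x y => R (x + s) (y + s)) v x ↔ D1 n R (v + s) (x + s) := by
  unfold D1
  refine and_congr_right fun _ => ⟨fun h y hy => ?_, fun h y hy => ?_⟩
  · have := h (y - s) (by simpa using hy)
    rwa [show y - s - x = y - (x + s) by ring] at this
  · have := h _ hy
    rwa [add_sub_add_right_eq_sub] at this

lemma Two_shift (s v : ℤ) : Two n (fun x y => R (x + s) (y + s)) v ↔ Two n R (v + s) := by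
  unfold Two
  constructor
  · rintro ⟨x, y, hx, hy, hd⟩
    exact ⟨x + s, y + s, hx, hy, by rwa [add_sub_add_right_eq_sub]⟩
  · rintro ⟨x, y, hx, hy, hd⟩
    exact ⟨x - s, y - s, by simpa using hx, by simpa using hy, by simpa using hd⟩

lemma cov_reflect (hs : ∀ x y, R x y → R y x) (v : ℤ) :
    Cov (fun x y => R (-x) (-y)) v ↔ Cov R (-v) := by
  unfold Cov
  beta_reduce
  rw [show -(v - 1) = -v + 1 by ring, show -(v + 1) = -v - 1 by ring]
  exact ⟨hs _ _, hs _ _⟩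

lemma Two_reflect (v : ℤ) : Two n (fun x y => R (-x) (-y)) v ↔ Two n R (-v) := by
  unfold Two
  constructor
  · rintro ⟨x, y, hx, hy, hd⟩
    refine ⟨-x, -y, hx, hy, ?_⟩
    rwa [← dvd_neg, show -(-y - -x) = y - x by ring]
  · rintro ⟨x, y, hx, hy, hd⟩
    refine ⟨-x, -y, by simpa using hx, by simpa using hy, ?_⟩
    rwa [← dvd_neg, show -(-y - -x) = y - x by ring]

lemma Cfg.cov_iff (h : Cfg n R) (v : ℤ) : Cov R (v + n) ↔ Cov R v :=
  ⟨h.cov_per ⟨-1, by ring⟩, h.cov_per ⟨1, by ring⟩⟩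

lemma Cfg.two_iff (h : Cfg n R) (v : ℤ) : Two n R (v + n) ↔ Two n R v := by
  simp only [Two, h.per']

lemma Cfg.D1_iff (h : Cfg n R) (v x : ℤ) : D1 n R (v + n) x ↔ D1 n R v x := by
  simp only [D1, h.per']

lemma Cfg.D1_iff' (h : Cfg n R) (v x : ℤ) : D1 n R v (x + n) ↔ D1 n R v x := by
  simp only [D1, h.per]
  refine and_congr_right fun _ => forall₂_congr fun y _ => ?_
  rw [← sub_sub, dvd_sub_self_right]

end Symmetry

/-- The edges of a bouquet, lifted to `ℤ`. -/
def BouquetData (n : ℤ) (R : ℤ → ℤ → Prop) : Prop :=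
  ∃ (l m k q : ℤ) (x : ℤ → ℤ), 0 < l ∧ l < m + 2 ∧ m + 2 < k ∧ k + 2 ≤ q ∧ q < n ∧
    (∀ j, 1 ≤ j → j ≤ m + 1 → R (j - 1) (j + 1)) ∧
    R k (l - 1) ∧ R q (l + 1) ∧ R k q ∧
    (∀ w, m + 3 ≤ w → w < k → l ≤ x w ∧ x w ≤ m + 1 ∧ R w (x w)) ∧
    (∀ w, k < w → w < q → R w l) ∧
    (∀ w, q < w → w < n → 1 ≤ x w ∧ x w ≤ l ∧ R w (x w)) ∧
    ∀ w w', m + 3 ≤ w → w < w' → w' < n → (w < k ∨ q < w) → (w' < k ∨ q < w') → x w' ≤ x w + 1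

/-- Some rotation is a bouquet. -/
def HasBouquet (n : ℤ) (R : ℤ → ℤ → Prop) : Prop :=
  ∃ s, BouquetData n (fun x y => R (x + s) (y + s))

lemma HasBouquet.of_shift {n : ℤ} {R : ℤ → ℤ → Prop} (s : ℤ)
    (h : HasBouquet n (fun x y => R (x + s) (y + s))) : HasBouquet n R := by
  obtain ⟨t, ht⟩ := h
  exact ⟨t + s, by simpa only [add_assoc] using ht⟩

lemma HasBouquet.of_reflect {n : ℤ} {R : ℤ → ℤ → Prop} (hs : ∀ x y, R x y → R y x)
    (hp : ∀ x y, R x (y + n) ↔ R x y)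
    (h : HasBouquet n (fun x y => R (-x) (-y))) : HasBouquet n R := by
  obtain ⟨t, l, m, k, q, x, h1, h2, h3, h4, h5, h6, h7, h8, h9, h10, h11, h12, h13⟩ := h
  have hp' : ∀ x y, R (x + n) y ↔ R x y := fun x y =>
    ⟨fun h => hs _ _ ((hp _ _).1 (hs _ _ h)), fun h => hs _ _ ((hp _ _).2 (hs _ _ h))⟩
  beta_reduce at h6 h7 h8 h9 h10 h11 h12
  refine ⟨-(m + 2) - t, m + 2 - l, m, n + m + 2 - q, n + m + 2 - k,
    fun w => m + 2 - x (n + m + 2 - w), by omega, by omega, by omega, by omega, by omega,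
    fun j hj hj' => ?_, ?_, ?_, ?_, fun w hw hw' => ?_, fun w hw hw' => ?_, fun w hw hw' => ?_,
    fun w w' hw hw' hw'' h14 h15 => ?_⟩
  · have := hs _ _ (h6 (m + 2 - j) (by omega) (by omega))
    convert this using 1 <;> ring
  · rw [← hp'] at h8; convert h8 using 1 <;> ring
  · rw [← hp'] at h7; convert h7 using 1 <;> ring
  · rw [← hp, ← hp'] at h9; replace h9 := hs _ _ h9; convert h9 using 1 <;> ring
  · obtain ⟨h14, h15, h16⟩ := h12 (n + m + 2 - w) (by omega) (by omega)
    refine ⟨by dsimp only; omega, by dsimp only; omega, ?_⟩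
    rw [← hp'] at h16; convert h16 using 1 <;> ring
  · have := h11 (n + m + 2 - w) (by omega) (by omega)
    rw [← hp'] at this; convert this using 1 <;> ring
  · obtain ⟨h14, h15, h16⟩ := h10 (n + m + 2 - w) (by omega) (by omega)
    refine ⟨by dsimp only; omega, by dsimp only; omega, ?_⟩
    rw [← hp'] at h16; convert h16 using 1 <;> ring
  · have := h13 (n + m + 2 - w') (n + m + 2 - w) (by omega) (by omega) (by omega) (by omega)
      (by omega)
    dsimp only; omega

lemma exists_first {P : ℤ → Prop} {a b : ℤ} (hab : a ≤ b) (hb : P b) :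
    ∃ c, a ≤ c ∧ c ≤ b ∧ P c ∧ ∀ k, a ≤ k → k < c → ¬ P k := by
  classical
  obtain ⟨c, hc, hc'⟩ := Int.exists_least_of_bdd (P := fun c => a ≤ c ∧ P c)
    ⟨a, fun z hz => hz.1⟩ ⟨b, hab, hb⟩
  exact ⟨c, hc.1, hc' b ⟨hab, hb⟩, hc.2, fun k h1 h2 h3 => by have := hc' k ⟨h1, h3⟩; omega⟩

lemma exists_last {P : ℤ → Prop} {a b : ℤ} (hab : a ≤ b) (ha : P a) :
    ∃ c, a ≤ c ∧ c ≤ b ∧ P c ∧ ∀ k, c < k → k ≤ b → ¬ P k := by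
  classical
  obtain ⟨c, hc, hc'⟩ := Int.exists_greatest_of_bdd (P := fun c => c ≤ b ∧ P c)
    ⟨b, fun z hz => hz.1⟩ ⟨a, hab, ha⟩
  exact ⟨c, hc' a ⟨hab, ha⟩, hc.1, hc.2, fun k h1 h2 h3 => by have := hc' k ⟨h2, h3⟩; omega⟩

namespace Cfg

variable {n : ℤ} {R : ℤ → ℤ → Prop}

lemma D1_of_not_two {v x : ℤ} (hR : R v x) (ht : ¬ Two n R v) : D1 n R v x := by
  refine ⟨hR, fun y hy => ?_⟩
  by_contra hd
  exact ht ⟨x, y, hR, hy, hd⟩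

/-- Of two vertices with unique neighbours, one sends its edge to the near side. -/
lemma not_both_far (h : Cfg n R) {v w x y : ℤ} (hv : D1 n R v x) (hw : D1 n R w y)
    (h1 : v < w) (h2 : w < v + n) (hx : v < x) (hx' : x < w) (hy : w < y) (hy' : y < v + n) :
    False :=
  h.sep h1 h2 (hv.not (by omega))
    (Tri.fan_right h.adj h1 fun k _ _ hk => hw.not (by omega) (h.symm _ _ hk))
    (Tri.fan_right h.adj h2 fun k _ _ hk => hv.not (z := k) (by omega)
      (h.symm _ _ ((h.per _ _).1 hk)))

/-- The final configuration in which an uncovered vertex `w` with the uncovered neighbours `0`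
and `1` forces a bouquet. -/
lemma hasBouquet_of_D1_neg_one (h : Cfg n R) {w : ℤ} (hw : 4 ≤ w) (hw' : w ≤ n - 2)
    (cw : ¬ Cov R w) (c0 : ¬ Cov R 0) (c1 : ¬ Cov R 1) (dw : D2 n R w 0 1) (d0 : D2 n R 0 3 w)
    (d1 : D2 n R 1 3 w) (dn : D1 n R (-1) 2) : HasBouquet n R := by
  have hn := h.six_le
  have dn' : D1 n R (n - 1) 2 := by
    rw [← h.D1_iff] at dn
    rwa [show -1 + n = n - 1 by ring] at dn
  have c2 : Cov R 2 := h.cov_of_D1 dn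
  have cN : ¬ Cov R n := fun hc => c0 (by rw [← h.cov_iff]; simpa using hc)
  have cN1 : ¬ Cov R (n + 1) := fun hc => c1 (by rw [← h.cov_iff, add_comm]; exact hc)
  -- the vertices beyond `w` are joined to `2`
  have far : ∀ d : ℕ, ∀ u, n - 1 - d ≤ u → u ≤ n - 1 → w + 1 ≤ u →
      R u 2 ∧ (w + 2 ≤ u → D1 n R u 2) ∧ (u ≤ n - 2 → ¬ Cov R u) := by
    intro d
    induction d with
    | zero =>
      intro u h1 h2 h3
      obtain rfl : u = n - 1 := by simp at h1; omega
      exact ⟨dn'.1, fun _ => dn', fun h4 => by omega⟩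
    | succ d ih =>
      intro u h1 h2 h3
      rcases eq_or_lt_of_le h2 with rfl | h2
      · exact ⟨dn'.1, fun _ => dn', fun h4 => by omega⟩
      have hD : ∀ k, u < k → k ≤ n - 1 → D1 n R k 2 := fun k h4 h5 =>
        (ih k (by push_cast at h1; omega) h5 (by omega)).2.1 (by omega)
      have hcu : ¬ Cov R u := fun hc =>
        (hD (u + 1) (by omega) (by omega)).not (z := u - 1) (by omega) (h.symm _ _ hc)
      have hun : ∀ k, u < k → k ≤ n + 1 → ¬ R u k := by
        intro k h4 h5 h6
        have h7 := h.symm _ _ h6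
        by_cases h8 : k ≤ n - 1
        · exact (hD k h4 h8).not (by omega) h7
        obtain rfl | rfl : k = n ∨ k = n + 1 := by omega
        · have := (h.per' 0 u).1 (by simpa using h7)
          exact d0.not (by omega) this
        · have := (h.per' 1 u).1 (by rwa [add_comm])
          exact d1.not (by omega) this
      have hu2 : R u 2 := by
        by_contra hu2
        have hu2' : ¬ R u (n + 2) := fun h' => hu2 ((h.per _ _).1 (by rwa [add_comm]))
        have hwk : ∀ k, n + 2 ≤ k → k < w + n → ¬ R k (w + n) := fun k _ _ hk =>
          dw.not (z := k) (by omega) (h.symm _ _ ((h.per _ _).1 hk))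
        exact h.sep (i := w) (j := u) (by omega) (by omega) (dw.not (by omega))
          (Tri.fan_left h.adj (by omega) fun k _ _ => dw.not (by omega))
          (Tri.node (c := n + 2) (by omega) (by omega) hu2' (hwk _ le_rfl (by omega))
            (Tri.fan_left h.adj (by omega) fun k _ _ => hun k (by omega) (by omega))
            (Tri.fan_right h.adj (by omega) fun k _ _ => hwk k (by omega) (by omega)))
      refine ⟨hu2, fun h4 => D1_of_not_two hu2 fun ht => ?_, fun _ => hcu⟩
      exact dw.not (z := u) (by omega) (h.edge_of_two_two h4 (by omega) cw hcu
        (h.two_of_lt dw.2.2.1 dw.2.2.2.1 (by omega) (by omega)) ht)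
  replace far : ∀ u, w + 1 ≤ u → u ≤ n - 1 →
      R u 2 ∧ (w + 2 ≤ u → D1 n R u 2) ∧ (u ≤ n - 2 → ¬ Cov R u) := fun u h1 h2 =>
    far (n - 1 - u).toNat u (by omega) h2 h1
  -- the first uncovered vertex after `2`
  obtain ⟨f, hf1, hf2, cf, hf3⟩ := exists_first (P := fun v => ¬ Cov R v) (a := 3) (by omega) cw
  have hcov : ∀ j, 2 ≤ j → j < f → Cov R j := fun j h1 h2 => by
    rcases eq_or_lt_of_le h1 with rfl | h1
    · exact c2
    · exact not_not.1 (hf3 j (by omega) h2)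
  have hfw : f < w := by
    by_contra hfw
    obtain rfl : f = w := by omega
    have := hcov (f - 1) (by omega) (by omega)
    rw [Cov, sub_add_cancel] at this
    exact dw.not (z := f - 1 - 1) (by omega) (h.symm _ _ this)
  have tw : Two n R w := h.two_of_lt dw.2.2.1 dw.2.2.2.1 (by omega) (by omega)
  have hnt : ∀ v, f ≤ v → v ≤ w - 2 → ¬ Cov R v → ¬ Two n R v := fun v h1 h2 hc ht =>
    dw.not (z := v) (by omega) (h.symm _ _ (h.edge_of_two_two (i := v) (by omega) (by omega) hc cw
      ht tw))
  have hunc : ∀ v, f ≤ v → v ≤ w → ¬ Cov R v := by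
    intro v h1 h2 hc
    obtain ⟨u, hu1, hu2, cu, hu3⟩ := exists_first (P := Cov R) h1 hc
    have hu4 : u ≠ f := fun e => cf (e ▸ cu)
    have hu5 : u ≠ w := fun e => cw (e ▸ cu)
    have hd : D1 n R (u - 1) (u + 1) :=
      D1_of_not_two cu (hnt (u - 1) (by omega) (by omega) (hu3 (u - 1) (by omega) (by omega)))
    exact h.not_both_far dn hd (by omega) (by omega) (by omega) (by omega) (by omega) (by omega)
  have hD : ∀ v, f + 1 ≤ v → v < w → ∃ x, 2 ≤ x ∧ x < f ∧ D1 n R v x := by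
    intro v h1 h2
    have hnt' : ¬ Two n R v := by
      intro ht
      have hv : v = w - 1 := by
        by_contra hv
        exact hnt v (by omega) (by omega) (hunc v (by omega) (by omega)) ht
      subst hv
      have hR := h.edge_of_two_succ (i := w - 1) (.inl (hunc _ (by omega) (by omega))) ht
        (by rwa [sub_add_cancel])
      have hd := D1_of_not_two hR (hnt _ (by omega) (by omega) (hunc _ (by omega) (by omega)))
      rw [show w - 1 + 2 = w + 1 by ring] at hd
      by_cases hw1 : w + 1 ≤ n - 2
      · exact (far _ le_rfl (by omega)).2.2 hw1 (h.cov_of_D1 hd)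
      · obtain rfl : w = n - 2 := by omega
        rw [show n - 2 + 1 = n - 1 by ring] at hd
        exact dn'.not (z := n - 2 - 1 - 1) (by omega) (h.symm _ _ hd.1)
    obtain ⟨y, hy⟩ := (h.d1_or_two v).resolve_right hnt'
    obtain ⟨x, hx1, hx2, hx⟩ := h.D1_rep hy (f)
    have cx := h.cov_of_D1 hx
    have x1 : w < x := by
      by_contra hlt
      exact hunc x (by omega) (by omega) cx
    have x2 : n - 1 ≤ x := by
      by_contra hlt
      exact (far x (by omega) (by omega)).2.2 (by omega) cx
    have x3 : x ≠ n - 1 := by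
      rintro rfl
      exact dn'.not (z := v) (by omega) (h.symm _ _ hx.1)
    have x4 : x ≠ n := fun e => cN (e ▸ cx)
    have x5 : x ≠ n + 1 := fun e => cN1 (e ▸ cx)
    refine ⟨x - n, by omega, by omega, ?_⟩
    rw [← h.D1_iff']
    simpa using hx
  choose! X hX1 hX2 hX3 using hD
  refine ⟨1, 1, f - 3, w - 1, n - 1, fun v => X (v + 1) - 1, by omega, by omega, by omega, by omega,
    by omega, fun j hj hj' => ?_, ?_, ?_, ?_, fun v h1 h2 => ?_, fun v h1 h2 => ?_,
    fun v h1 h2 => by omega, fun v v' h1 h2 h3 h4 h5 => ?_⟩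
  · have := hcov (j + 1) (by omega) (by omega)
    rw [Cov] at this
    convert this using 1; ring
  · have := dw.2.2.2.1
    convert this using 1 <;> ring
  · have := d0.2.2.1
    rw [← h.per'] at this
    convert this using 1 <;> ring
  · have := dw.2.2.1
    rw [← h.per] at this
    convert this using 1 <;> ring
  · have e1 := hX1 (v + 1) (by omega) (by omega)
    have e2 := hX2 (v + 1) (by omega) (by omega)
    refine ⟨by dsimp only; omega, by dsimp only; omega, ?_⟩
    have := (hX3 (v + 1) (by omega) (by omega)).1
    dsimp only
    rwa [sub_add_cancel]
  · exact (far (v + 1) (by omega) (by omega)).1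
  · have e1 := hX1 (v + 1) (by omega) (by omega)
    have e2 := hX2 (v' + 1) (by omega) (by omega)
    have e3 := hX3 (v + 1) (by omega) (by omega)
    have e4 := hX3 (v' + 1) (by omega) (by omega)
    rw [← h.D1_iff'] at e3 e4
    have := h.le_add_one_of_D1 e3 e4 (by omega) (by omega) (by omega)
    dsimp only
    omega

end Cfg

namespace Cfg

variable {n : ℤ} {R : ℤ → ℤ → Prop}

/-- The reflection that exchanges the vertices `0` and `1`. -/
lemma reflect_one (h : Cfg n R) : Cfg n (fun x y => R (1 - x) (1 - y)) := by
  have e : ∀ x : ℤ, -(x + -1) = 1 - x := fun x => by ring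
  simpa only [e] using h.reflect.shift (-1)

lemma cov_reflect_one (h : Cfg n R) (v : ℤ) :
    Cov (fun x y => R (1 - x) (1 - y)) v ↔ Cov R (1 - v) := by
  unfold Cov
  beta_reduce
  rw [show 1 - (v - 1) = 1 - v + 1 by ring, show 1 - (v + 1) = 1 - v - 1 by ring]
  exact ⟨h.symm _ _, h.symm _ _⟩

lemma hasBouquet_of_reflect_one (h : Cfg n R)
    (hb : HasBouquet n (fun x y => R (1 - x) (1 - y))) : HasBouquet n R := by
  refine HasBouquet.of_reflect h.symm h.per (HasBouquet.of_shift (-1) ?_)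
  have e : ∀ x : ℤ, -(x + -1) = 1 - x := fun x => by ring
  simpa only [e] using hb

lemma two_of_edge_uncov (h : Cfg n R) {v w : ℤ} (hR : R v w) (hw : ¬ Cov R w) : Two n R v := by
  by_contra ht
  exact hw (h.cov_of_D1 (D1_of_not_two hR ht))

lemma edge_neg_one_two (h : Cfg n R) {w : ℤ} (hw : 3 ≤ w) (hw' : w ≤ n - 2)
    (c0 : ¬ Cov R 0) (dw : D2 n R w 0 1) : R (-1) 2 := by
  have hd : D2 n R w n (n + 1) := by
    obtain ⟨h1, h2, h3, h4, h5⟩ := dw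
    refine ⟨by omega, by omega, ?_, ?_, fun z hz => (h5 z hz).imp (fun hd => ?_) fun hd => ?_⟩
    · rwa [← h.per, zero_add] at h3
    · rwa [← h.per, add_comm] at h4
    · have := hd.sub (dvd_refl n); simpa using this
    · have := hd.sub (dvd_refl n); rwa [sub_sub, add_comm] at this
  rcases h.edge_or_cov_of_D2 hd (by omega) (by omega) with h1 | h1
  · rw [← h.per, ← h.per']
    convert h1 using 1 <;> ring
  · exact absurd ((h.cov_iff 0).1 (by simpa using h1.1)) c0

/-- The case in which the vertex `-1` is uncovered and has a unique neighbour. -/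
lemma hasBouquet_of_four_le (h : Cfg n R) {w : ℤ} (hw : 4 ≤ w) (hw' : w ≤ n - 2)
    (cw : ¬ Cov R w) (c0 : ¬ Cov R 0) (c1 : ¬ Cov R 1) (h0 : R w 0) (h1 : R w 1)
    (dn : D1 n R (-1) 2) : HasBouquet n R := by
  have hn := h.six_le
  have c2 := h.cov_of_D1 dn
  have h02 : ¬ R 0 2 := fun h' => c1 (by simpa [Cov] using h')
  have h03 : R 0 3 := by
    by_contra h03
    refine h.two (i := -1) (j := 0) (z := 3) (by omega) (by omega)
      (by have := h.adj (-1); simpa using this) (Tri.leaf' (by ring)) (fun k _ _ => ?_)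
      (fun k _ _ => dn.not (by omega))
    obtain rfl | rfl | rfl : k = 1 ∨ k = 2 ∨ k = 3 := by omega
    · simpa using h.adj 0
    · exact h02
    · exact h03
  have h13 : R 1 3 := by simpa [Cov] using c2
  exact h.hasBouquet_of_D1_neg_one hw hw' cw c0 c1
    (h.D2_of_two cw h0 h1 (by omega) (by omega))
    (h.D2_of_two c0 h03 (h.symm _ _ h0) (by omega) (by omega))
    (h.D2_of_two c1 h13 (h.symm _ _ h1) (by omega) (by omega)) dn

/-- The case in which the vertex `-1` is uncovered. -/
lemma hasBouquet_of_uncov_neg_one (h : Cfg n R) {w : ℤ} (hw : 3 ≤ w) (hw' : w ≤ n - 2)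
    (cw : ¬ Cov R w) (c0 : ¬ Cov R 0) (c1 : ¬ Cov R 1) (h0 : R w 0) (h1 : R w 1)
    (cn : ¬ Cov R (-1)) : HasBouquet n R := by
  have hn := h.six_le
  have dw := h.D2_of_two cw h0 h1 (by omega) (by omega)
  have hn2 := h.edge_neg_one_two hw hw' c0 dw
  have tw : Two n R w := h.two_of_lt h0 h1 (by omega) (by omega)
  have hwn : w ≠ n - 2 := by
    rintro rfl
    refine cn ?_
    rw [Cov, ← h.per']
    convert h0 using 1 <;> ring
  have dn : D1 n R (-1) 2 := D1_of_not_two hn2 fun ht =>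
    dw.not (z := -1) (by omega)
      (h.symm _ _ (h.edge_of_two_two (by omega) (by omega) cn cw ht tw))
  rcases eq_or_lt_of_le hw with rfl | hw
  swap
  · exact h.hasBouquet_of_four_le hw hw' cw c0 c1 h0 h1 dn
  have h02 : ¬ R 0 2 := fun h' => c1 (by simpa [Cov] using h')
  have h24 : ¬ R 2 4 := fun h' => cw (by simpa [Cov] using h')
  have h01 : ¬ R 0 1 := by simpa using h.adj 0
  have h12 : ¬ R 1 2 := by simpa using h.adj 1
  have hn0 : ¬ R (-1) 0 := by simpa using h.adj (-1)
  have hn4 : ∀ k, 4 ≤ k → k < -1 + n → ¬ R k (-1 + n) := fun k _ _ hk =>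
    dn.not (z := k) (by omega) (h.symm _ _ ((h.per _ _).1 hk))
  have h04 : R 0 4 := by
    by_contra h04
    exact h.sep (i := -1) (j := 0) (by omega) (by omega) hn0 (Tri.leaf' (by ring))
      (Tri.node (c := 4) (by omega) (by omega) h04 (hn4 4 le_rfl (by omega))
        (Tri.node (c := 2) (by omega) (by omega) h02 h24 (Tri.ear h.adj (by ring))
          (Tri.ear h.adj (by ring)))
        (Tri.fan_right h.adj (by omega) fun k _ _ => hn4 k (by omega) (by omega)))
  have h14 : R 1 4 := by
    by_contra h14
    exact h.sep (i := -1) (j := 1) (by omega) (by omega) (by simpa [Cov] using c0) (Tri.ear h.adj (by ring))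
      (Tri.node (c := 4) (by omega) (by omega) h14 (hn4 4 le_rfl (by omega))
        (Tri.node (c := 2) (by omega) (by omega) h12 h24 (Tri.leaf' (by ring))
          (Tri.ear h.adj (by ring)))
        (Tri.fan_right h.adj (by omega) fun k _ _ => hn4 k (by omega) (by omega)))
  refine h.hasBouquet_of_four_le le_rfl (by omega) (fun hc => ?_) c0 c1 (h.symm _ _ h04)
    (h.symm _ _ h14) dn
  exact dw.not (z := 5) (by omega) hc

/-- The case in which the vertices `-1` and `2` are covered. -/
lemma hasBouquet_of_cov_cov (h : Cfg n R) {w : ℤ} (hw : 4 ≤ w) (hw' : w ≤ n - 2)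
    (cw : ¬ Cov R w) (c0 : ¬ Cov R 0) (c1 : ¬ Cov R 1) (h0 : R w 0) (h1 : R w 1)
    (cn : Cov R (-1)) (c2 : Cov R 2) : HasBouquet n R := by
  have hn := h.six_le
  have dw := h.D2_of_two cw h0 h1 (by omega) (by omega)
  have hn2 := h.edge_neg_one_two (by omega) hw' c0 dw
  have h02 : ¬ R 0 2 := fun h' => c1 (by simpa [Cov] using h')
  have h13 : R 1 3 := by simpa [Cov] using c2
  have d1 : D2 n R 1 3 w := h.D2_of_two c1 h13 (h.symm _ _ h1) (by omega) (by omega)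
  have hw0 : R 0 w := h.symm _ _ h0
  have h03 : R 0 3 := by
    by_contra h03
    by_cases h6 : n = 6
    · obtain rfl : w = 4 := by omega
      obtain ⟨x, y, x1, x2, x3, x4, x5⟩ := Two.rep h (h.two_of_edge_uncov hw0 cw) 0
      have e1 := h.nbr_window x4 (by omega) (by omega)
      have e2 := h.nbr_window x5 (by omega) (by omega)
      obtain rfl | rfl : x = 2 ∨ x = 3 := by omega
      · exact h02 x4
      · exact h03 x4
    have hr : ∃ r, (r = 4 ∧ 5 ≤ w ∨ r = 5 ∧ w = 4) ∧ R 2 r := by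
      rcases eq_or_lt_of_le hw with rfl | hw5
      · refine ⟨5, by omega, ?_⟩
        exact (h.edge_or_cov_of_D2 d1 (by omega) (by omega)).resolve_right fun hc => cw hc.2
      · refine ⟨4, by omega, ?_⟩
        exact (h.cov_or_cov_of_D2 d1 (by omega) (by omega) (by omega)).resolve_right cw
    obtain ⟨r, hr, hR⟩ := hr
    have e1 : R 1 (3 - n) := by rw [← h.per]; simpa using h13
    have e2 : R 2 (r - n) := by rw [← h.per]; simpa using hR
    have e3 : R (w - n) 0 := by rw [← h.per']; simpa using h0
    have e4 : R (w - n) 1 := by rw [← h.per']; simpa using h1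
    have e5 := h.symm _ _ hn2
    have := h.length_le_of_cut_ear (a := 0) (b := 3) (w := w - n)
      (Tri.node (c := 2) (by omega) (by omega) h02 (by simpa using h.adj 2)
        (Tri.ear h.adj (by ring)) (Tri.leaf' (by ring)))
      h03 (by omega) (by omega) (fun hc => cw (by have := (h.cov_iff _).2 hc; rwa [sub_add_cancel] at this))
      [(w - n, 0), (w - n, 1), (1, 3 - n), (2, -1), (2, r - n)]
      (by simp [DistinctEdges]; omega)
      (by simp [e1, e2, e3, e4, e5]; omega)
    simp at this
  have hN : R 0 (n - 2) := by
    have := (h.per' _ _).2 cn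
    convert h.symm _ _ this using 1 <;> ring
  have hwn : w = n - 2 := by
    by_contra hwn
    exact h.not_three c0 h03 hw0 hN (a := 0) (by omega) (by omega) (by omega) (by omega)
  subst hwn
  have d0 : D2 n R 0 3 (n - 2) := h.D2_of_two c0 h03 hw0 (by omega) (by omega)
  refine h.hasBouquet_of_D1_neg_one hw hw' cw c0 c1 dw d0 d1 (D1_of_not_two hn2 fun ht => ?_)
  obtain ⟨x, y, x1, x2, x3, x4, x5⟩ := Two.rep h ht 0
  rw [← h.per', show -1 + n = n - 1 by ring] at x4 x5
  by_cases h6 : n = 6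
  · subst h6
    have e0 : ∀ z, 0 ≤ z → z < 6 → R (6 - 1) z → z = 2 := fun z z1 z2 hz => by
      have e1 : z ≠ 0 := by
        rintro rfl
        have := (h.per _ _).2 hz
        exact h.adj 5 (by simpa using this)
      have e2 : z ≠ 1 := by
        rintro rfl
        refine c0 ((h.per' _ _).1 ?_)
        simpa using hz
      have e3 : z ≠ 3 := by
        rintro rfl
        exact cw (h.symm _ _ hz)
      have e4 : z ≠ 4 := by
        rintro rfl
        exact h.adj 4 (h.symm _ _ hz)
      have e5 : z ≠ 5 := by
        rintro rfl
        exact h.irr 5 hz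
      omega
    have := e0 x x1 (by omega) x4
    have := e0 y (by omega) (by omega) x5
    omega
  · have := h.length_le_of_cut (a := n - 3) (b := n)
      (Tri.node (c := n - 1) (by omega) (by omega) (fun h' => cw (by
          rw [Cov]; convert h' using 1 <;> ring)) (fun h' => h.adj (n - 1) (by simpa using h'))
        (Tri.ear h.adj (by ring)) (Tri.leaf' (by ring))) (by omega)
      (fun h' => d0.not (z := n - 3) (by omega)
        (h.symm _ _ ((h.per _ _).1 (by simpa using h'))))
      [(n - 2, 0), (n - 2, 1), (n - 1, x), (n - 1, y)]
      (by simp [DistinctEdges]; omega) (by simp [h0, h1, x4, x5]; omega)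
    simp at this

/-- An uncovered vertex joined to the uncovered vertices `0` and `1` forces a bouquet. -/
lemma hasBouquet_of_uncov_zero_one (h : Cfg n R) {w : ℤ} (hw : 3 ≤ w) (hw' : w ≤ n - 2)
    (cw : ¬ Cov R w) (c0 : ¬ Cov R 0) (c1 : ¬ Cov R 1) (h0 : R w 0) (h1 : R w 1) :
    HasBouquet n R := by
  have hn := h.six_le
  by_cases cn : Cov R (-1)
  swap
  · exact h.hasBouquet_of_uncov_neg_one hw hw' cw c0 c1 h0 h1 cn
  have r0 : R (1 - (n + 1 - w)) (1 - 0) := by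
    rw [← h.per']; convert h1 using 1 <;> ring
  have r1 : R (1 - (n + 1 - w)) (1 - 1) := by
    rw [← h.per']; convert h0 using 1 <;> ring
  have cw' : ¬ Cov (fun x y => R (1 - x) (1 - y)) (n + 1 - w) := by
    rw [h.cov_reflect_one, ← h.cov_iff]; convert cw using 2; ring
  have c0' : ¬ Cov (fun x y => R (1 - x) (1 - y)) 0 := by
    rw [h.cov_reflect_one]; simpa using c1
  have c1' : ¬ Cov (fun x y => R (1 - x) (1 - y)) 1 := by
    rw [h.cov_reflect_one]; simpa using c0
  by_cases c2 : Cov R 2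
  swap
  · exact h.hasBouquet_of_reflect_one (h.reflect_one.hasBouquet_of_uncov_neg_one
      (w := n + 1 - w) (by omega) (by omega) cw' c0' c1' r0 r1
      (by rw [h.cov_reflect_one]; simpa using c2))
  rcases eq_or_lt_of_le hw with rfl | hw
  · exact h.hasBouquet_of_reflect_one (h.reflect_one.hasBouquet_of_cov_cov
      (by omega) (by omega) cw' c0' c1' r0 r1 (by rw [h.cov_reflect_one]; simpa using c2)
      (by rw [h.cov_reflect_one]; simpa using cn))
  · exact h.hasBouquet_of_cov_cov hw hw' cw c0 c1 h0 h1 cn c2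

/-- An uncovered vertex whose neighbours are two adjacent uncovered vertices forces a bouquet. -/
lemma hasBouquet_of_uncov_succ (h : Cfg n R) {w i : ℤ}
    (cw : ¬ Cov R w) (c0 : ¬ Cov R i) (c1 : ¬ Cov R (i + 1)) (h0 : R w i) (h1 : R w (i + 1)) :
    HasBouquet n R := by
  have hn := h.six_le
  obtain ⟨u, u1, u2, u3, u4⟩ := h.exists_window (h.symm _ _ h0)
  have cu : ¬ Cov R u := fun hc => cw (h.cov_per (by rw [← dvd_neg]; simpa using u4) hc)
  have u5 : R (i + 1) u := h.per_dvd u4 (h.symm _ _ h1)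
  have u6 := h.nbr_window u5 (by omega) (by omega)
  refine HasBouquet.of_shift i ((h.shift i).hasBouquet_of_uncov_zero_one (w := u - i) (by omega)
    (by omega) ?_ ?_ ?_ ?_ ?_)
  · rw [cov_shift]; simpa using cu
  · rw [cov_shift]; simpa using c0
  · rw [cov_shift]; simpa [add_comm] using c1
  · simpa using h.symm _ _ u3
  · simpa [add_comm] using h.symm _ _ u5

end Cfg

/-- A configuration without an uncovered vertex joined to two adjacent uncovered vertices. -/
structure NCfg (n : ℤ) (R : ℤ → ℤ → Prop) : Prop extends Cfg n R where
  noAdj : ∀ w i, ¬ Cov R w → ¬ Cov R i → ¬ Cov R (i + 1) → R w i → R w (i + 1) → False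

/-- The uncovered vertices with more than one neighbour. -/
def Exc (n : ℤ) (R : ℤ → ℤ → Prop) (v : ℤ) : Prop := ¬ Cov R v ∧ Two n R v

/-- The covered vertices that do not lie between two exceptional ones. -/
def Core (n : ℤ) (R : ℤ → ℤ → Prop) (v : ℤ) : Prop :=
  Cov R v ∧ ¬ (Exc n R (v - 1) ∧ Exc n R (v + 1))

section Symmetry

variable {n : ℤ} {R : ℤ → ℤ → Prop}

lemma Exc.not_core {v : ℤ} (he : Exc n R v) : ¬ Core n R v := fun hc => he.1 hc.1

lemma exc_shift (s v : ℤ) : Exc n (fun x y => R (x + s) (y + s)) v ↔ Exc n R (v + s) := by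
  simp only [Exc, cov_shift, Two_shift]

lemma core_shift (s v : ℤ) : Core n (fun x y => R (x + s) (y + s)) v ↔ Core n R (v + s) := by
  simp only [Core, cov_shift, exc_shift]
  rw [show v - 1 + s = v + s - 1 by ring, show v + 1 + s = v + s + 1 by ring]

lemma exc_reflect (hs : ∀ x y, R x y → R y x) (v : ℤ) :
    Exc n (fun x y => R (-x) (-y)) v ↔ Exc n R (-v) := by
  simp only [Exc, cov_reflect hs, Two_reflect]

lemma core_reflect (hs : ∀ x y, R x y → R y x) (v : ℤ) :
    Core n (fun x y => R (-x) (-y)) v ↔ Core n R (-v) := by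
  simp only [Core, cov_reflect hs, exc_reflect hs]
  rw [show -(v - 1) = -v + 1 by ring, show -(v + 1) = -v - 1 by ring, and_comm (a := Exc n R _)]

end Symmetry

namespace NCfg

variable {n : ℤ} {R : ℤ → ℤ → Prop}

lemma shift (h : NCfg n R) (s : ℤ) : NCfg n (fun x y => R (x + s) (y + s)) where
  toCfg := h.toCfg.shift s
  noAdj w i h1 h2 h3 h4 h5 := by
    rw [cov_shift] at h1 h2 h3
    rw [add_right_comm] at h3 h5
    exact h.noAdj _ _ h1 h2 h3 h4 h5

lemma reflect (h : NCfg n R) : NCfg n (fun x y => R (-x) (-y)) where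
  toCfg := h.toCfg.reflect
  noAdj w i h1 h2 h3 h4 h5 := by
    rw [cov_reflect h.symm] at h1 h2 h3
    have e : -i = -(i + 1) + 1 := by ring
    rw [e] at h2 h4
    exact h.noAdj _ _ h1 h3 h2 h5 h4

lemma exc_iff (h : NCfg n R) (v : ℤ) : Exc n R (v + n) ↔ Exc n R v := by
  simp only [Exc, h.cov_iff, h.two_iff]

lemma core_iff (h : NCfg n R) (v : ℤ) : Core n R (v + n) ↔ Core n R v := by
  simp only [Core, h.cov_iff]
  rw [show v + n - 1 = v - 1 + n by ring, show v + n + 1 = v + 1 + n by ring, h.exc_iff, h.exc_iff]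

lemma exc_per (h : NCfg n R) {v v' : ℤ} (hd : n ∣ v' - v) (he : Exc n R v) : Exc n R v' := by
  obtain ⟨x, y, hx, hy, hxy⟩ := he.2
  refine ⟨fun hc => he.1 (h.cov_per (by rw [← dvd_neg]; simpa using hd) hc), x, y,
    h.per_dvd_left hd hx, h.per_dvd_left hd hy, hxy⟩

lemma core_per (h : NCfg n R) {v v' : ℤ} (hd : n ∣ v' - v) (hc : Core n R v) : Core n R v' := by
  have hd' : n ∣ v - v' := by rw [← dvd_neg]; simpa using hd
  refine ⟨h.cov_per hd hc.1, fun he => hc.2 ⟨h.exc_per ?_ he.1, h.exc_per ?_ he.2⟩⟩ <;> simpa using hd'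

/-- An uncovered vertex does not have two uncovered neighbours. -/
lemma cov_of_uncov (h : NCfg n R) {i x y : ℤ} (hi : ¬ Cov R i) (hx : R i x) (hy : R i y)
    (hxy : x < y) (hxy' : y < x + n) (cx : ¬ Cov R x) : Cov R y := by
  by_contra cy
  have hn := h.six_le
  have key : ∀ x y, i + 2 ≤ x → x < y → y ≤ i + n - 2 → R i x → R i y → ¬ Cov R x → ¬ Cov R y →
      False := by
    intro x y h1 h2 h3 hx hy cx cy
    by_cases h4 : y = x + 1
    · subst h4
      exact h.noAdj i x hi cx cy hx hy
    · rcases h.cov_or_cov_of_D2 (h.D2_of_two hi hx hy h2 (by omega)) (by omega) (by omega)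
        (by omega) with h5 | h5
      · exact cx h5
      · exact cy h5
  obtain ⟨x', a1, a2, a3, a4⟩ := h.exists_window hx
  obtain ⟨y', b1, b2, b3, b4⟩ := h.exists_window hy
  have cx' : ¬ Cov R x' := fun hc => cx (h.cov_per (by rw [← dvd_neg]; simpa using a4) hc)
  have cy' : ¬ Cov R y' := fun hc => cy (h.cov_per (by rw [← dvd_neg]; simpa using b4) hc)
  rcases lt_trichotomy x' y' with h1 | rfl | h1
  · exact key x' y' a1 h1 b2 a3 b3 cx' cy'
  · have : n ∣ y - x := by simpa using a4.sub b4
    have := eq_of_dvd_of_small this (by omega) (by omega)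
    omega
  · exact key y' x' b1 h1 a2 b3 a3 cy' cx'

/-- There are at most two exceptional vertices. -/
lemma not_three_exc (h : NCfg n R) {i j k : ℤ} (hij : i < j) (hjk : j < k) (hki : k < i + n)
    (ei : Exc n R i) (ej : Exc n R j) (ek : Exc n R k) : False := by
  have hn := h.six_le
  have key : ∀ i k, i + 1 < k → k < i + n → Exc n R i → Exc n R (i + 1) → Exc n R k → False := by
    intro i k h1 h2 ei ej ek
    by_cases h3 : k = i + 2
    · subst h3
      refine ej.1 ?_
      rw [Cov, add_sub_cancel_right, add_assoc]
      exact h.edge_of_two_two (by omega) (by omega) ei.1 ek.1 ei.2 ek.2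
    have r2 := h.edge_of_two_two (i := i + 1) (j := k) (by omega) (by omega) ej.1 ek.1 ej.2 ek.2
    by_cases h4 : k = i + n - 1
    · subst h4
      refine ei.1 (h.symm _ _ ?_)
      rw [← h.per]
      convert r2 using 1; ring
    have r1 := h.edge_of_two_two (i := i) (j := k) (by omega) (by omega) ei.1 ek.1 ei.2 ek.2
    exact h.noAdj k i ek.1 ei.1 ej.1 (h.symm _ _ r1) (h.symm _ _ r2)
  have ei' := (h.exc_iff i).2 ei
  have ej' := (h.exc_iff j).2 ej
  by_cases h1 : j = i + 1
  · subst h1; exact key i k hjk hki ei ej ek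
  by_cases h2 : k = j + 1
  · subst h2; exact key j (i + n) hki (by omega) ej ek ei'
  by_cases h3 : i + n = k + 1
  · exact key k (j + n) (by omega) (by omega) ek (h3 ▸ ei') ej'
  have r1 := h.edge_of_two_two (i := i) (j := j) (by omega) (by omega) ei.1 ej.1 ei.2 ej.2
  have r2 := h.edge_of_two_two (i := i) (j := k) (by omega) (by omega) ei.1 ek.1 ei.2 ek.2
  exact ek.1 (h.cov_of_uncov ei.1 r1 r2 hjk (by omega) ej.1)

/-- A vertex between two exceptional vertices has a unique neighbour. -/
lemma not_two_of_between (h : NCfg n R) {v : ℤ} (e1 : Exc n R (v - 1)) (e2 : Exc n R (v + 1)) :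
    ¬ Two n R v := by
  intro ht
  have hn := h.six_le
  have r0 := h.edge_of_two_two (i := v - 1) (j := v + 1) (by omega) (by omega) e1.1 e2.1 e1.2 e2.2
  have r1 := h.edge_of_two_succ (i := v - 1) (.inl e1.1) e1.2 (by rwa [sub_add_cancel])
  have r2 := h.edge_of_two_succ (i := v) (.inr e2.1) ht e2.2
  rw [show v - 1 - 1 = v - 2 by ring, show v - 1 + 2 = v + 1 by ring] at r1
  have hc : Cov R (v - 2) := by
    by_contra hc
    exact e1.1 (h.cov_of_uncov e2.1 (h.symm _ _ r1) (h.symm _ _ r0) (by omega) (by omega) hc)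
  have r3 : R (v - 1) (v - 3 + n) := by
    rw [h.per]
    convert h.symm _ _ hc using 1 <;> ring
  exact h.not_three e1.1 r0 r2 r3 (a := v) (by omega) (by omega) (by omega) (by omega)

lemma D1_of_not_core (h : NCfg n R) {v : ℤ} (hk : ¬ Core n R v) (he : ¬ Exc n R v) :
    ∃ x, D1 n R v x := by
  refine (h.d1_or_two v).resolve_right fun ht => ?_
  by_cases hc : Cov R v
  · have : Exc n R (v - 1) ∧ Exc n R (v + 1) := by
      by_contra h1
      exact hk ⟨hc, h1⟩
    exact h.not_two_of_between this.1 this.2 ht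
  · exact he ⟨hc, ht⟩

lemma core_of_D1 (h : NCfg n R) {v x : ℤ} (hk : ¬ Core n R v) (hd : D1 n R v x) : Core n R x := by
  have hn := h.six_le
  have cx := h.cov_of_D1 hd
  refine ⟨cx, fun he => ?_⟩
  obtain ⟨v', v1, v2, v3, v4⟩ := h.exists_window (h.symm _ _ hd.1)
  have v4' : n ∣ v - v' := by rw [← dvd_neg]; simpa using v4
  have hk' : ¬ Core n R v' := fun hc => hk (h.core_per v4' hc)
  have cv' : Cov R v' := h.cov_of_D1 (Cfg.D1_of_not_two v3 (h.not_two_of_between he.1 he.2))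
  have he' : Exc n R (v' - 1) ∧ Exc n R (v' + 1) := by
    by_contra h1
    exact hk' ⟨cv', h1⟩
  have ex := (h.exc_iff (x - 1)).2 he.1
  by_cases h1 : v' = x + n - 2
  · exact h.not_three_exc (i := x + 1) (j := v' - 1) (by omega) (by omega) (by omega) he.2 he'.1 ex
  · exact h.not_three_exc (i := x + 1) (j := v' + 1) (by omega) (by omega) (by omega) he.2 he'.2 ex

/-- Every neighbour of an exceptional vertex is a core vertex or exceptional. -/
lemma core_or_exc (h : NCfg n R) {i x : ℤ} (hi : Exc n R i) (hx : R i x) :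
    Core n R x ∨ Exc n R x := by
  by_cases cx : Cov R x
  · refine .inl ⟨cx, fun he => hi.1 ?_⟩
    exact h.cov_of_D1 (Cfg.D1_of_not_two (h.symm _ _ hx) (h.not_two_of_between he.1 he.2))
  · exact .inr ⟨cx, h.two_of_edge_uncov (h.symm _ _ hx) hi.1⟩

lemma core_pred (h : NCfg n R) {v : ℤ} (hv : Core n R v) (hv' : ¬ Core n R (v + 1)) :
    Core n R (v - 1) := by
  by_contra hc
  by_cases he : Exc n R (v - 1)
  · exact hv.2 ⟨he, (h.core_or_exc he hv.1).resolve_left hv'⟩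
  · obtain ⟨x, hx⟩ := h.D1_of_not_core hc he
    exact hv' (h.core_per (hx.2 _ hv.1) (h.core_of_D1 hc hx))

lemma core_succ (h : NCfg n R) {v : ℤ} (hv : Core n R v) (hv' : ¬ Core n R (v - 1)) :
    Core n R (v + 1) := by
  by_contra hc
  by_cases he : Exc n R (v + 1)
  · exact hv.2 ⟨(h.core_or_exc he (h.symm _ _ hv.1)).resolve_left hv', he⟩
  · obtain ⟨x, hx⟩ := h.D1_of_not_core hc he
    exact hv' (h.core_per (hx.2 _ (h.symm _ _ hv.1)) (h.core_of_D1 hc hx))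

/-- The first vertex of a gap, if not exceptional, has the last vertex of the run but one as its
unique neighbour. -/
lemma D1_first (h : NCfg n R) {q : ℤ} (hq : Core n R q) (hq' : ¬ Core n R (q + 1))
    (he : ¬ Exc n R (q + 1)) : D1 n R (q + 1) (q - 1) := by
  obtain ⟨x, hx⟩ := h.D1_of_not_core hq' he
  exact Cfg.D1_of_not_two (h.symm _ _ hq.1) (Cfg.D1.not_two hx)

lemma D1_last (h : NCfg n R) {q : ℤ} (hq : Core n R q) (hq' : ¬ Core n R (q - 1))
    (he : ¬ Exc n R (q - 1)) : D1 n R (q - 1) (q + 1) := by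
  obtain ⟨x, hx⟩ := h.D1_of_not_core hq' he
  exact Cfg.D1_of_not_two hq.1 (Cfg.D1.not_two hx)

/-- At most one gap starts with a non-exceptional vertex. -/
lemma first_unique (h : NCfg n R) {q r : ℤ} (hq : Core n R q) (hq' : ¬ Core n R (q + 1))
    (eq : ¬ Exc n R (q + 1)) (hr : Core n R r) (hr' : ¬ Core n R (r + 1))
    (er : ¬ Exc n R (r + 1)) (hlt : q < r) (hlt' : r < q + n) : False := by
  have hn := h.six_le
  have kq := h.core_pred hq hq'
  have kr := h.core_pred hr hr'
  have r1 : r ≠ q + 1 := fun e => hq' (e ▸ hr)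
  have r2 : r - 1 ≠ q + 1 := fun e => hq' (e ▸ kr)
  have r3 : r + 1 ≠ q + n := fun e => hr' (by rw [e]; exact (h.core_iff q).2 hq)
  have r4 : r + 1 ≠ q - 1 + n := fun e => hr' (by rw [e]; exact (h.core_iff _).2 kq)
  have d1 := h.D1_first hq hq' eq
  rw [← h.D1_iff'] at d1
  exact h.not_both_near d1 (h.D1_first hr hr' er) (by omega) (by omega) (by omega) (by omega)
    (by omega) (by omega)

/-- The core is the interval `[p, r]`, modulo `n`. -/
def Run (n : ℤ) (R : ℤ → ℤ → Prop) (p r : ℤ) : Prop :=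
  p ≤ r ∧ r ≤ p + n - 2 ∧ (∀ v, p ≤ v → v ≤ r → Core n R v) ∧
    ∀ v, r < v → v < p + n → ¬ Core n R v

lemma exists_run (h : NCfg n R) (hE : ∀ v, Exc n R v → ¬ Core n R (v - 1)) {a b : ℤ}
    (ha : Core n R a) (hb : ¬ Core n R b) : ∃ p r, Run n R p r := by
  have hn := h.six_le
  have hE' : ∀ q, Core n R q → ¬ Exc n R (q + 1) := fun q hq he => hE _ he (by simpa using hq)
  -- a representative of `b` after `a`
  obtain ⟨b', hb1, hb2⟩ : ∃ b', a ≤ b' ∧ ¬ Core n R b' := by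
    refine ⟨b + n * |a - b|, ?_, fun hc => hb (h.core_per ⟨-|a - b|, by ring⟩ hc)⟩
    have := le_abs_self (a - b)
    nlinarith [abs_nonneg (a - b)]
  obtain ⟨f, hf1, hf2, hf3, hf4⟩ := exists_first (P := fun v => ¬ Core n R v) hb1 hb2
  have hfa : f ≠ a := fun e => hf3 (e ▸ ha)
  have hq : Core n R (f - 1) := not_not.1 (hf4 (f - 1) (by omega) (by omega))
  have hqn : Core n R (f - 1 + n) := (h.core_iff _).2 hq
  obtain ⟨p, hp1, hp2, hp3, hp4⟩ := exists_first (P := Core n R) (a := f) (by omega) hqn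
  have hpf : p ≠ f := fun e => hf3 (e ▸ hp3)
  refine ⟨p, f - 1 + n, hp2, by omega, fun v h1 h2 => ?_, fun v h1 h2 => ?_⟩
  · by_contra hv
    obtain ⟨g, hg1, hg2, hg3, hg4⟩ := exists_first (P := fun v => ¬ Core n R v) h1 hv
    have hgp : g ≠ p := fun e => hg3 (e ▸ hp3)
    have hr : Core n R (g - 1) := not_not.1 (hg4 (g - 1) (by omega) (by omega))
    have hgf : g - 1 ≠ f - 1 + n := by omega
    exact h.first_unique hq (by simpa using hf3) (hE' _ hq) hr (by simpa using hg3) (hE' _ hr)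
      (by omega) (by omega)
  · intro hc
    refine hp4 (v - n) (by omega) (by omega) ?_
    rw [← h.core_iff]
    simpa using hc

lemma Run.reflect (h : NCfg n R) {p r : ℤ} (hr : Run n (fun x y => R (-x) (-y)) p r) :
    Run n R (-r) (-p) := by
  obtain ⟨h1, h2, h3, h4⟩ := hr
  simp only [core_reflect h.symm] at h3 h4
  refine ⟨by omega, by omega, fun v h5 h6 => ?_, fun v h5 h6 h7 => ?_⟩
  · simpa using h3 (-v) (by omega) (by omega)
  · refine h4 (-v + n) (by omega) (by omega) ?_
    rw [← h.core_iff]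
    simpa using h7

lemma exists_run' (h : NCfg n R) (hE : ∀ v, Exc n R v → ¬ Core n R (v + 1)) {a b : ℤ}
    (ha : Core n R a) (hb : ¬ Core n R b) : ∃ p r, Run n R p r := by
  obtain ⟨p, r, hr⟩ := h.reflect.exists_run (a := -a) (b := -b) (fun v he => by
    rw [exc_reflect h.symm] at he
    rw [core_reflect h.symm, show -(v - 1) = -v + 1 by ring]
    exact hE _ he) (by rw [core_reflect h.symm]; simpa using ha)
    (by rw [core_reflect h.symm]; simpa using hb)
  exact ⟨_, _, Run.reflect h hr⟩

end NCfg

namespace Cfg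

variable {n : ℤ} {R : ℤ → ℤ → Prop}

lemma not_minStruct (h : Cfg n R) : ¬ MinStruct n R := by simpa using h.noMin 0

/-- Two consecutive vertices are not covered. -/
lemma not_cov_interval (h : Cfg n R) (p : ℤ) (hp : ∀ v, p ≤ v → v ≤ p + n - 3 → Cov R v) :
    False := by
  have hn := h.six_le
  refine h.noMin (p - 1) ⟨n - 3, id, by omega, by omega, fun j h1 h2 => ?_, fun w h1 h2 => by omega,
    fun w w' h1 h2 h3 => by omega⟩
  have := hp (j + p - 1) (by omega) (by omega)
  rw [Cov] at this
  convert this using 1 <;> ring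

/-- Unique edges into an interval do not cross essentially. -/
lemma D1_le_add_one (h : Cfg n R) {m w w' x x' : ℤ} (hw : D1 n R w x) (hw' : D1 n R w' x')
    (h1 : m + 2 ≤ w) (h2 : w < w') (h3 : w' ≤ n) (hx : 1 ≤ x) (hx' : x' ≤ m + 1) :
    x' ≤ x + 1 := by
  have := h.le_add_one_of_D1 ((h.D1_iff' _ _).2 hw) ((h.D1_iff' _ _).2 hw') h2 (by omega)
    (by omega)
  omega

/-- If the covered vertices form an interval, at least two further vertices are exceptional. -/
lemma run_false (h : Cfg n R) {m i : ℤ} (hm : 0 ≤ m) (hmn : m + 3 ≤ n)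
    (hc : ∀ j, 1 ≤ j → j ≤ m + 1 → Cov R j)
    (hX : ∀ w, m + 3 ≤ w → w < n → w ≠ i → ∃ x, 1 ≤ x ∧ x ≤ m + 1 ∧ D1 n R w x)
    (hi : m + 3 ≤ i → i < n → ∃ x y, 1 ≤ x ∧ y ≤ m + 1 ∧ D2 n R i x y) : False := by
  choose! X hX1 hX2 hX3 using hX
  have hXX : ∀ w w', m + 3 ≤ w → w < w' → w' < n → w ≠ i → w' ≠ i → X w' ≤ X w + 1 :=
    fun w w' h1 h2 h3 h4 h5 => h.D1_le_add_one (hX3 w h1 (by omega) h4)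
      (hX3 w' (by omega) h3 h5) (by omega) h2 h3.le (hX1 w h1 (by omega) h4)
      (hX2 w' (by omega) h3 h5)
  by_cases hi' : m + 3 ≤ i ∧ i < n
  swap
  · exact h.not_minStruct ⟨m, X, hm, hmn, hc,
      fun w h1 h2 => ⟨hX1 w h1 h2 (by omega), hX2 w h1 h2 (by omega), (hX3 w h1 h2 (by omega)).1⟩,
      fun w w' h1 h2 h3 => hXX w w' h1 h2 h3 (by omega) (by omega)⟩
  obtain ⟨hi1, hi2⟩ := hi'
  obtain ⟨x, y, hx, hy, hd⟩ := hi hi1 hi2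
  have hxy := hd.1
  have H1 : ∀ w, m + 3 ≤ w → w < i → x ≤ X w + 1 := by
    intro w h1 h2
    by_contra! h3
    have h4 := hX1 w h1 (by omega) (by omega)
    have h5 := hX2 w h1 (by omega) (by omega)
    have h6 := hX3 w h1 (by omega) (by omega)
    exact h.two (i := w) (j := i) (z := n + X w + 1) (by omega) (by omega) (h6.not (by omega))
      (Tri.fan_left h.adj h2 fun k _ _ => h6.not (by omega)) (fun k _ _ => hd.not (by omega))
      (fun k _ _ => h6.not (by omega))
  have H2 : ∀ w, i < w → w < n → X w ≤ y + 1 := by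
    intro w h1 h2
    by_contra! h3
    have h4 := hX1 w (by omega) (by omega) (by omega)
    have h5 := hX2 w (by omega) (by omega) (by omega)
    have h6 := hX3 w (by omega) (by omega) (by omega)
    exact h.two (i := i) (j := w) (z := n + y + 1) (by omega) (by omega) (hd.not (by omega))
      (Tri.fan_left h.adj h1 fun k _ _ => hd.not (by omega)) (fun k _ _ => h6.not (by omega))
      (fun k _ _ => hd.not (by omega))
  have key : ∀ z, 1 ≤ z → z ≤ m + 1 → R i z → (∀ w, m + 3 ≤ w → w < i → z ≤ X w + 1) →
      (∀ w, i < w → w < n → X w ≤ z + 1) → False := by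
    intro z h1 h2 h3 h4 h5
    refine h.not_minStruct ⟨m, fun w => if w = i then z else X w, hm, hmn, hc, fun w g1 g2 => ?_,
      fun w w' g1 g2 g3 => ?_⟩
    · dsimp only
      split_ifs with g3
      · exact ⟨h1, h2, g3 ▸ h3⟩
      · exact ⟨hX1 w g1 g2 g3, hX2 w g1 g2 g3, (hX3 w g1 g2 g3).1⟩
    · dsimp only
      split_ifs with g4 g5 g5
      · omega
      · exact h4 w g1 (by omega)
      · exact h5 w' (by omega) g3
      · exact hXX w w' g1 g2 g3 g5 g4
  by_cases H3 : ∀ w, i < w → w < n → X w ≤ x + 1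
  · exact key x hx (by omega) hd.2.2.1 H1 H3
  by_cases H4 : ∀ w, m + 3 ≤ w → w < i → y ≤ X w + 1
  · exact key y (by omega) hy hd.2.2.2.1 H4 H2
  push Not at H3 H4
  obtain ⟨v, v1, v2, v3⟩ := H3
  obtain ⟨w, w1, w2, w3⟩ := H4
  have a1 := hX1 w w1 (by omega) (by omega)
  have a2 := hX2 w w1 (by omega) (by omega)
  have a3 := hX3 w w1 (by omega) (by omega)
  have b1 := hX1 v (by omega) v2 (by omega)
  have b2 := hX2 v (by omega) v2 (by omega)
  have b3 := hX3 v (by omega) v2 (by omega)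
  have c := hXX w v w1 (by omega) v2 (by omega) (by omega)
  exact h.three (w := w) (i := i) (v := v) (a := n + X v - 1) (b := n + X w + 1) (by omega)
    (by omega) (by omega) (a3.not (by omega))
    (Tri.fan_left h.adj w2 fun k _ _ => a3.not (by omega)) (hd.not (by omega))
    (Tri.fan_left h.adj v1 fun k _ _ => hd.not (by omega)) (fun k _ _ => b3.not (by omega))
    (fun k _ _ => hd.not (by omega)) (fun k _ _ => a3.not (by omega))

end Cfg

namespace Cfg

variable {n : ℤ} {R : ℤ → ℤ → Prop}

/-- If the covered vertices form an interval and there are two further exceptional vertices, which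
are joined, then there is a bouquet. -/
lemma run_two (h : Cfg n R) {m i j x y : ℤ} (hm : 0 ≤ m) (hmn : m + 3 ≤ n)
    (hc : ∀ j, 1 ≤ j → j ≤ m + 1 → Cov R j) (hmi : m + 2 ≤ i) (hij : i + 2 ≤ j) (hjn : j ≤ n)
    (ci : ¬ Cov R i) (cj : ¬ Cov R j)
    (hX : ∀ w, m + 2 ≤ w → w ≤ n → w ≠ i → w ≠ j → ∃ x, 1 ≤ x ∧ x ≤ m + 1 ∧ D1 n R w x)
    (hx1 : 1 ≤ x) (hx2 : x ≤ m + 1) (hy1 : 1 ≤ y) (hy2 : y ≤ m + 1)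
    (di : D2 n R i j (n + x)) (dj : D2 n R j (n + y) (n + i)) : HasBouquet n R := by
  have hn := h.six_le
  choose! X hX1 hX2 hX3 using hX
  have hXX : ∀ w w', m + 2 ≤ w → w < w' → w' ≤ n → w ≠ i → w' ≠ i → w ≠ j → w' ≠ j →
      X w' ≤ X w + 1 :=
    fun w w' h1 h2 h3 h4 h5 h6 h7 => h.D1_le_add_one (hX3 w h1 (by omega) h4 h6)
      (hX3 w' (by omega) h3 h5 h7) (by omega) h2 h3 (hX1 w h1 (by omega) h4 h6)
      (hX2 w' (by omega) h3 h5 h7)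
  have A1 : ∀ w, i < w → w ≤ n → w ≠ j → X w ≤ x + 1 := by
    intro w h1 h2 h3
    by_contra! h4
    have h5 := hX1 w (by omega) (by omega) (by omega) h3
    have h6 := hX2 w (by omega) (by omega) (by omega) h3
    have h7 := hX3 w (by omega) (by omega) (by omega) h3
    exact h.two (i := i) (j := w) (z := n + x + 1) (by omega) (by omega) (di.not (by omega))
      (Tri.fan_right h.adj h1 fun k _ _ hR => h7.not (by omega) (h.symm _ _ hR))
      (fun k _ _ => h7.not (by omega)) (fun k _ _ => di.not (by omega))
  have A2 : ∀ w, m + 2 ≤ w → w < j → w ≠ i → y ≤ X w + 1 := by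
    intro w h1 h2 h3
    by_contra! h4
    have h5 := hX1 w (by omega) (by omega) (by omega) (by omega)
    have h6 := hX2 w (by omega) (by omega) (by omega) (by omega)
    have h7 := hX3 w (by omega) (by omega) (by omega) (by omega)
    exact h.two (i := w) (j := j) (z := n + X w + 1) (by omega) (by omega) (h7.not (by omega))
      (Tri.fan_left h.adj h2 fun k _ _ => h7.not (by omega))
      (fun k _ _ => dj.not (by omega)) (fun k _ _ => h7.not (by omega))
  have A3 : ∀ w, m + 2 ≤ w → w < i → x ≤ X w + 1 := by
    intro w h1 h2
    by_contra! h4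
    have h5 := hX1 w (by omega) (by omega) (by omega) (by omega)
    have h6 := hX2 w (by omega) (by omega) (by omega) (by omega)
    have h7 := hX3 w (by omega) (by omega) (by omega) (by omega)
    have g5 := hX1 (j - 1) (by omega) (by omega) (by omega) (by omega)
    have g6 := hX2 (j - 1) (by omega) (by omega) (by omega) (by omega)
    have g7 := hX3 (j - 1) (by omega) (by omega) (by omega) (by omega)
    have hh := hXX w (j - 1) h1 (by omega) (by omega) (by omega) (by omega) (by omega) (by omega)
    have hne : j < n + X (j - 1) - 1 := by
      by_contra! hle
      refine cj ?_
      have e : j + 1 = X (j - 1) + n := by omega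
      rw [Cov, e, h.per]
      exact g7.1
    exact h.three (w := w) (i := i) (v := j - 1) (a := n + X (j - 1) - 1) (b := n + X w + 1)
      (by omega) (by omega) (by omega) (h7.not (by omega))
      (Tri.fan_left h.adj h2 fun k _ _ => h7.not (by omega)) (di.not (by omega))
      (Tri.fan_left h.adj (by omega) fun k _ _ => di.not (by omega))
      (fun k _ _ => g7.not (by omega)) (fun k _ _ => di.not (by omega))
      (fun k _ _ => h7.not (by omega))
  have A4 : ∀ w, j < w → w ≤ n → X w ≤ y + 1 := by
    intro w h1 h2
    by_contra! h4
    have h5 := hX1 w (by omega) (by omega) (by omega) (by omega)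
    have h6 := hX2 w (by omega) (by omega) (by omega) (by omega)
    have h7 := hX3 w (by omega) (by omega) (by omega) (by omega)
    have g5 := hX1 (i + 1) (by omega) (by omega) (by omega) (by omega)
    have g6 := hX2 (i + 1) (by omega) (by omega) (by omega) (by omega)
    have g7 := hX3 (i + 1) (by omega) (by omega) (by omega) (by omega)
    have hh := hXX (i + 1) w (by omega) (by omega) h2 (by omega) (by omega) (by omega) (by omega)
    have hne : X (i + 1) + 1 < i := by
      by_contra! hle
      refine ci (h.symm _ _ ?_)
      have e : i - 1 = X (i + 1) := by omega
      rw [e]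
      exact g7.1
    exact h.three (w := i + 1) (i := j) (v := w) (a := n + X w - 1) (b := n + X (i + 1) + 1)
      (by omega) (by omega) (by omega) (g7.not (by omega))
      (Tri.fan_left h.adj (by omega) fun k _ _ => g7.not (by omega)) (dj.not (by omega))
      (Tri.fan_left h.adj h1 fun k _ _ => dj.not (by omega))
      (fun k _ _ => h7.not (by omega)) (fun k _ _ => dj.not (by omega))
      (fun k _ _ => g7.not (by omega))
  have rx : R i x := by
    have := di.2.2.2.1
    rwa [add_comm, h.per] at this
  have ry : R j y := by
    have := dj.2.2.1
    rwa [add_comm, h.per] at this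
  by_cases hcase : y ≤ x + 1 ∨ i = m + 2 ∨ j = n
  · refine (h.not_minStruct ⟨m, fun w => if w = i then x else if w = j then y else X w, hm, hmn, hc,
      fun w g1 g2 => ?_, fun w w' g1 g2 g3 => ?_⟩).elim
    · dsimp only
      split_ifs with g3 g4
      · exact ⟨hx1, hx2, g3 ▸ rx⟩
      · exact ⟨hy1, hy2, g4 ▸ ry⟩
      · exact ⟨hX1 w (by omega) (by omega) g3 g4, hX2 w (by omega) (by omega) g3 g4,
          (hX3 w (by omega) (by omega) g3 g4).1⟩
    · dsimp only
      split_ifs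
      · omega
      · omega
      · exact A3 w (by omega) (by omega)
      · omega
      · omega
      · exact A2 w (by omega) (by omega) (by omega)
      · exact A1 w' (by omega) (by omega) (by omega)
      · exact A4 w' (by omega) (by omega)
      · exact hXX w w' (by omega) g2 (by omega) (by omega) (by omega) (by omega) (by omega)
  · push Not at hcase
    obtain ⟨q1, q2, q3⟩ := hcase
    have hl : ∀ w, i < w → w < j → X w = x + 1 ∧ y = x + 2 := by
      intro w g1 g2
      have := A1 w g1 (by omega) (by omega)
      have := A2 w (by omega) g2 (by omega)
      omega
    have hy := (hl (i + 1) (by omega) (by omega)).2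
    refine ⟨0, x + 1, m, i, j, X, by omega, by omega, by omega, hij, by omega, ?_⟩
    simp only [add_zero]
    refine ⟨hc, by simpa using rx, by rwa [show x + 1 + 1 = y by omega], di.2.2.1, fun w g1 g2 => ?_,
      fun w g1 g2 => ?_, fun w g1 g2 => ?_, fun w w' g1 g2 g3 g4 g5 => ?_⟩
    · have := A2 w (by omega) (by omega) (by omega)
      exact ⟨by omega, hX2 w (by omega) (by omega) (by omega) (by omega),
        (hX3 w (by omega) (by omega) (by omega) (by omega)).1⟩
    · rw [← (hl w g1 g2).1]
      exact (hX3 w (by omega) (by omega) (by omega) (by omega)).1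
    · exact ⟨hX1 w (by omega) (by omega) (by omega) (by omega), A1 w (by omega) (by omega) (by omega),
        (hX3 w (by omega) (by omega) (by omega) (by omega)).1⟩
    · exact hXX w w' (by omega) g2 (by omega) (by omega) (by omega) (by omega) (by omega)

end Cfg

lemma exists_mod_rep {n : ℤ} (hn : 0 < n) (a v : ℤ) : ∃ w, a ≤ w ∧ w < a + n ∧ n ∣ w - v := by
  have h1 := Int.emod_nonneg (v - a) hn.ne'
  have h2 := Int.emod_lt_of_pos (v - a) hn
  have := Int.emod_add_mul_ediv (v - a) n
  exact ⟨a + (v - a) % n, by omega, by omega, -((v - a) / n), by linarith⟩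

namespace Cfg

variable {n : ℤ} {R : ℤ → ℤ → Prop}

lemma edge_left_of_exceptional (h : Cfg n R) {l f : ℤ} (hl : ¬ Cov R l) (tl : Two n R l)
    (hc : Cov R (l - 2)) (hf : D1 n R f (f - 2)) (h1 : l + 1 < f) (h2 : f < l - 3 + n) :
    R (l - 2) (l + 1) := by
  have e1 : l - 1 + 1 = l := by ring
  by_cases ht : Two n R (l - 1)
  · have := h.edge_of_two_succ (i := l - 1) (.inr (by rwa [e1])) ht (by rwa [e1])
    convert this using 1 <;> ring
  · have hR : R (l - 1) (l - 3 + n) := by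
      rw [h.per]
      convert h.symm _ _ hc using 1 <;> ring
    exact (h.not_both_near (D1_of_not_two hR ht) hf (by omega) (by omega) (by omega) (by omega)
      (by omega) (by omega)).elim

lemma edge_right_of_exceptional (h : Cfg n R) {l g : ℤ} (hl : ¬ Cov R l) (tl : Two n R l)
    (hc : Cov R (l + 2)) (hg : D1 n R g (g + 2)) (h1 : l + 3 < g) (h2 : g + 1 < l + n) :
    R (l - 1) (l + 2) := by
  by_cases ht : Two n R (l + 1)
  · exact h.edge_of_two_succ (.inl hl) tl ht
  · have hR : R (l + 1) (l + 3) := by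
      rw [Cov] at hc
      convert hc using 1 <;> ring
    exact (h.not_both_far (D1_of_not_two hR ht) hg (by omega) (by omega) (by omega) (by omega)
      (by omega) (by omega)).elim

end Cfg

namespace NCfg

variable {n : ℤ} {R : ℤ → ℤ → Prop}

lemma Run.shift {p r : ℤ} (hr : Run n R p r) (s : ℤ) :
    Run n (fun x y => R (x + s) (y + s)) (p - s) (r - s) := by
  obtain ⟨h1, h2, h3, h4⟩ := hr
  simp only [Run, core_shift]
  exact ⟨by omega, by omega, fun v h5 h6 => h3 _ (by omega) (by omega),
    fun v h5 h6 => h4 _ (by omega) (by omega)⟩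

lemma exists_core (h : NCfg n R) : ∃ v, Core n R v := by
  by_contra! hc
  by_cases he : Exc n R 0
  · obtain ⟨x, y, h1, h2, h3, h4, h5⟩ := Cfg.Two.rep h.toCfg he.2 0
    have ex := (h.core_or_exc he h4).resolve_left (hc x)
    have ey := (h.core_or_exc he h5).resolve_left (hc y)
    exact ey.1 (h.cov_of_uncov he.1 h4 h5 h2 (by omega) ex.1)
  · obtain ⟨x, hx⟩ := h.D1_of_not_core (hc 0) he
    exact hc x (h.core_of_D1 (hc 0) hx)

lemma exists_not_core (h : NCfg n R) : ∃ v, ¬ Core n R v := by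
  by_contra! hc
  exact h.not_cov_interval 0 fun v _ _ => (hc v).1

lemma Run.add_three_le (h : NCfg n R) {m : ℤ} (hr : Run n R 1 (m + 1)) : m + 3 ≤ n := by
  by_contra! hlt
  exact h.not_cov_interval 1 fun v h1 h2 => (hr.2.2.1 v h1 (by omega)).1

lemma Run.exists_D1 (h : NCfg n R) {m w : ℤ} (hr : Run n R 1 (m + 1)) (h1 : m + 2 ≤ w)
    (h2 : w ≤ n) (he : ¬ Exc n R w) : ∃ x, 1 ≤ x ∧ x ≤ m + 1 ∧ D1 n R w x := by
  have hw : ¬ Core n R w := hr.2.2.2 w (by omega) (by omega)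
  obtain ⟨x, hx⟩ := h.D1_of_not_core hw he
  obtain ⟨y, h3, h4, hy⟩ := h.D1_rep hx 1
  refine ⟨y, h3, ?_, hy⟩
  by_contra! hlt
  exact hr.2.2.2 y hlt h4 (h.core_of_D1 hw hy)

lemma Run.exists_D2 (h : NCfg n R) {m i : ℤ} (hr : Run n R 1 (m + 1)) (he : Exc n R i)
    (hi : ∀ x, R i x → ¬ Exc n R x) : ∃ x y, 1 ≤ x ∧ y ≤ m + 1 ∧ D2 n R i x y := by
  obtain ⟨x, y, h1, h2, h3, h4, h5⟩ := Cfg.Two.rep h.toCfg he.2 1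
  refine ⟨x, y, h1, ?_, h.D2_of_two he.1 h4 h5 h2 (by omega)⟩
  by_contra! hlt
  exact hr.2.2.2 y hlt h3 ((h.core_or_exc he h5).resolve_right (hi y h5))

lemma Run.false_of_exc_le_one (h : NCfg n R) {m i : ℤ} (hr : Run n R 1 (m + 1))
    (hE : ∀ w, m + 3 ≤ w → w < n → w ≠ i → ¬ Exc n R w)
    (hi : m + 3 ≤ i → i < n → Exc n R i ∧ ∀ x, R i x → ¬ Exc n R x) : False := by
  have h1 := hr.1
  exact h.run_false (m := m) (i := i) (by omega) (Run.add_three_le h hr)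
    (fun j h2 h3 => (hr.2.2.1 j h2 h3).1)
    (fun w h2 h3 h4 => Run.exists_D1 h hr (by omega) (by omega) (hE w h2 h3 h4))
    (fun h2 h3 => Run.exists_D2 h hr (hi h2 h3).1 (hi h2 h3).2)

/-- There is an exceptional vertex. -/
lemma exists_exc (h : NCfg n R) : ∃ v, Exc n R v := by
  by_contra! hE
  obtain ⟨a, ha⟩ := h.exists_core
  obtain ⟨b, hb⟩ := h.exists_not_core
  obtain ⟨p, r, hr⟩ := h.exists_run (fun v he => (hE v he).elim) ha hb
  have hr' := hr.shift (p - 1)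
  rw [show p - (p - 1) = 1 by ring, show r - (p - 1) = (r - p) + 1 by ring] at hr'
  have := hr'.1
  refine Run.false_of_exc_le_one (i := 0) (h.shift (p - 1)) hr' (fun w _ _ _ => ?_)
    (fun h1 h2 => by omega)
  rw [exc_shift]
  exact hE _

lemma run_single_false (h : NCfg n R) {i p r : ℤ} (hr : Run n R p r) (hi : Exc n R i)
    (hE : ∀ v, Exc n R v → n ∣ v - i) : False := by
  have hn := h.six_le
  have hr' := hr.shift (p - 1)
  rw [show p - (p - 1) = 1 by ring, show r - (p - 1) = (r - p) + 1 by ring] at hr'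
  obtain ⟨i', h1, h2, h3⟩ := exists_mod_rep (show 0 < n by omega) 1 (i - (p - 1))
  have hE' : ∀ v, Exc n (fun x y => R (x + (p - 1)) (y + (p - 1))) v → n ∣ v - i' := by
    intro v hv
    rw [exc_shift] at hv
    have := (hE _ hv).sub h3
    rwa [show v + (p - 1) - i - (i' - (i - (p - 1))) = v - i' by ring] at this
  have hp := hr'.1
  refine Run.false_of_exc_le_one (i := i') (h.shift (p - 1)) hr' (fun w _ _ hw he => hw ?_)
    (fun _ _ => ⟨?_, fun x hx he => ?_⟩)
  · have := eq_of_dvd_of_small (hE' w he) (by omega) (by omega)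
    omega
  · rw [exc_shift]
    exact h.exc_per (by rwa [show i' + (p - 1) - i = i' - (i - (p - 1)) by ring]) hi
  · have hd := hE' x he
    have := (h.shift (p - 1)).per_dvd (x := i') (y := x) (y' := i')
      (by rw [← dvd_neg]; simpa using hd) hx
    exact (h.shift (p - 1)).irr i' this

end NCfg

namespace NCfg

variable {n : ℤ} {R : ℤ → ℤ → Prop}

lemma exc_eq_or_eq (h : NCfg n R) {i j v : ℤ} (hi : Exc n R i) (hj : Exc n R j) (hij : i < j)
    (hji : j < i + n) (hv : Exc n R v) (h1 : i ≤ v) (h2 : v < i + n) : v = i ∨ v = j := by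
  by_contra! hne
  rcases lt_or_gt_of_ne hne.2 with h3 | h3
  · exact h.not_three_exc (by omega) h3 hji hi hv hj
  · exact h.not_three_exc hij h3 h2 hi hj hv

lemma exc_dvd_or_dvd (h : NCfg n R) {i j v : ℤ} (hi : Exc n R i) (hj : Exc n R j) (hij : i < j)
    (hji : j < i + n) (hv : Exc n R v) : n ∣ v - i ∨ n ∣ v - j := by
  have hn := h.six_le
  obtain ⟨w, h1, h2, h3⟩ := exists_mod_rep (show 0 < n by omega) i v
  have h3' : n ∣ v - w := by rw [← dvd_neg]; simpa using h3
  rcases h.exc_eq_or_eq hi hj hij hji (h.exc_per h3 hv) h1 h2 with rfl | rfl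
  · exact .inl h3'
  · exact .inr h3'

lemma run_adjacent_false (h : NCfg n R) {m i : ℤ} (hr : Run n R 1 (m + 1)) (h1 : 1 ≤ i)
    (h2 : i ≤ n) (hi : Exc n R i) (hi' : Exc n R (i + 1)) : False := by
  have hn := h.six_le
  have hm := hr.1
  have hmn := Run.add_three_le h hr
  have hmi : m + 2 ≤ i := by
    by_contra! hlt
    exact hi.not_core (hr.2.2.1 i h1 (by omega))
  have hin : i ≠ n := by
    rintro rfl
    refine hi'.not_core ?_
    rw [add_comm, h.core_iff]
    exact hr.2.2.1 1 le_rfl hm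
  have hE : ∀ w, 1 ≤ w → w ≤ n → w ≠ i → w ≠ i + 1 → ¬ Exc n R w := by
    intro w h3 h4 h5 h6 he
    rcases h.exc_dvd_or_dvd hi hi' (by omega) (by omega) he with hd | hd
    · have := eq_of_dvd_of_small hd (by omega) (by omega)
      omega
    · have := eq_of_dvd_of_small hd (by omega) (by omega)
      omega
  have hadj : ∀ x, R (i + 1) x → ¬ Exc n R x := by
    intro x hx he
    rcases h.exc_dvd_or_dvd hi hi' (by omega) (by omega) he with hd | hd
    · exact h.adj i (h.symm _ _ (h.per_dvd (by rw [← dvd_neg]; simpa using hd) hx))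
    · exact h.irr (i + 1) (h.per_dvd (by rw [← dvd_neg]; simpa using hd) hx)
  have hadj' : ∀ x, R i x → ¬ Exc n R x := by
    intro x hx he
    rcases h.exc_dvd_or_dvd hi hi' (by omega) (by omega) he with hd | hd
    · exact h.irr i (h.per_dvd (by rw [← dvd_neg]; simpa using hd) hx)
    · exact h.adj i (h.per_dvd (by rw [← dvd_neg]; simpa using hd) hx)
  by_cases c1 : i = m + 2
  · exact Run.false_of_exc_le_one (i := i + 1) h hr
      (fun w h3 h4 h5 => hE w (by omega) (by omega) (by omega) h5) (fun _ _ => ⟨hi', hadj⟩)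
  by_cases c2 : i + 1 = n
  · exact Run.false_of_exc_le_one (i := i) h hr
      (fun w h3 h4 h5 => hE w (by omega) (by omega) (by omega) (by omega))
      (fun _ _ => ⟨hi, hadj'⟩)
  have hR := h.edge_of_two_succ (.inl hi.1) hi.2 hi'.2
  obtain ⟨x, hx1, hx2, hx⟩ := Run.exists_D1 h hr (w := i - 1) (by omega) (by omega)
    (hE _ (by omega) (by omega) (by omega) (by omega))
  exact hx.not (by omega) hR

/-- An exceptional vertex joined to another one is not between two core vertices. -/
lemma not_core_both (h : NCfg n R) {a b : ℤ} (ha : Exc n R a) (hb : Exc n R b) (h1 : a + 2 ≤ b)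
    (h2 : b ≤ a + n - 2) (c1 : Core n R (a - 1)) (c2 : Core n R (a + 1)) : False := by
  have hn := h.six_le
  have hR := h.edge_of_two_two h1 h2 ha.1 hb.1 ha.2 hb.2
  have n1 : b ≠ a + 2 := fun e => c2.2 ⟨by simpa using ha, by
    rw [e] at hb; rwa [show a + 1 + 1 = a + 2 by ring]⟩
  have n2 : b ≠ a + n - 2 := fun e => c1.2 ⟨by
    rw [e, show a + n - 2 = a - 1 - 1 + n by ring, h.exc_iff] at hb
    exact hb, by simpa using ha⟩
  have r1 : R a (a + 2) := by
    have := c2.1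
    rw [Cov] at this
    convert this using 1 <;> ring
  have r2 : R a (a - 2 + n) := by
    have := c1.1
    rw [h.per]
    refine h.symm _ _ ?_
    rw [Cov] at this
    convert this using 1 <;> ring
  exact h.not_three ha.1 r1 hR r2 (a := a) (by omega) (by omega) (by omega) (by omega)

lemma exists_run_of_first_last (h : NCfg n R) {a b : ℤ} (ha : Exc n R a) (hb : Exc n R b)
    (h1 : a + 2 ≤ b) (h2 : b ≤ a + n - 2) (ca : Core n R (a - 1)) (cb : Core n R (b + 1)) :
    ∃ p r, Run n R p r := by
  have hn := h.six_le
  have hR := h.edge_of_two_two h1 h2 ha.1 hb.1 ha.2 hb.2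
  have r2 : R a (a - 2 + n) := by
    have := ca.1
    rw [h.per]
    refine h.symm _ _ ?_
    rw [Cov] at this
    convert this using 1 <;> ring
  have n2 : b ≠ a + n - 2 := fun e => ca.2 ⟨by
    rw [e, show a + n - 2 = a - 1 - 1 + n by ring, h.exc_iff] at hb
    exact hb, by simpa using ha⟩
  have hd : D2 n R a b (a - 2 + n) := h.D2_of_two ha.1 hR r2 (by omega) (by omega)
  have hE : ∀ v, a < v → v < a + n → v ≠ b → ¬ Exc n R v := by
    intro v h3 h4 h5 he
    rcases h.exc_eq_or_eq ha hb (by omega) (by omega) he (by omega) h4 with h6 | h6 <;> omega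
  have ca' : Core n R (a - 1 + n) := (h.core_iff _).2 ca
  have ha' : ¬ Core n R (a + n) := fun hc => ha.not_core ((h.core_iff _).1 hc)
  have hb' : ¬ Core n R b := hb.not_core
  by_cases hcore : ∃ c, a < c ∧ c < b ∧ Core n R c
  · obtain ⟨c, c1, c2, c3⟩ := hcore
    obtain ⟨q, q1, q2, q3, q4⟩ := exists_last (P := Core n R) (b := b - 1) (by omega) c3
    have qb : ¬ Core n R (q + 1) := by
      rcases eq_or_ne (q + 1) b with e | e
      · rwa [e]
      · exact q4 _ (by omega) (by omega)
    by_cases e : q + 1 = b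
    · exact (h.not_core_both (a := b) (b := a + n) hb ((h.exc_iff a).2 ha) (by omega) (by omega)
        (by rwa [show b - 1 = q by omega]) cb).elim
    have df := h.D1_first q3 qb (hE _ (by omega) (by omega) e)
    have cq := h.core_pred q3 qb
    have : q - 1 ≠ a := fun e => ha.not_core (e ▸ cq)
    exact (h.sep (i := a) (j := q + 1) (by omega) (by omega) (hd.not (by omega))
      (Tri.fan_left h.adj (by omega) fun k _ _ => hd.not (by omega))
      (Tri.fan_left h.adj (by omega) fun k _ _ => df.not (by omega))).elim
  push Not at hcore
  by_cases hall : ∀ v, b + 1 ≤ v → v ≤ a - 1 + n → Core n R v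
  · refine ⟨b + 1, a - 1 + n, by omega, by omega, hall, fun v h3 h4 hc => ?_⟩
    have hc' : Core n R (v - n) := by rw [← h.core_iff]; simpa using hc
    rcases eq_or_ne (v - n) a with e | e
    · exact ha.not_core (e ▸ hc')
    rcases eq_or_ne (v - n) b with e | e
    · exact hb' (e ▸ hc')
    exact hcore (v - n) (by omega) (by omega) hc'
  push Not at hall
  obtain ⟨u, u1, u2, u3⟩ := hall
  obtain ⟨f, f1, f2, f3, f4⟩ := exists_first (P := fun v => ¬ Core n R v) u1 u3
  obtain ⟨g, g1, g2, g3, g4⟩ := exists_last (P := fun v => ¬ Core n R v) u2 u3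
  have fb : f ≠ b + 1 := fun e => f3 (e ▸ cb)
  have ga : g ≠ a - 1 + n := fun e => g3 (e ▸ ca')
  have cf : Core n R (f - 1) := not_not.1 (f4 _ (by omega) (by omega))
  have cg : Core n R (g + 1) := not_not.1 (g4 _ (by omega) (by omega))
  have cf' := h.core_pred cf (by simpa using f3)
  have cg' := h.core_succ cg (by simpa using g3)
  have fb' : f - 1 - 1 ≠ b := fun e => hb' (e ▸ cf')
  have ga' : g + 1 + 1 ≠ a + n := fun e => ha' (e ▸ cg')
  have df := h.D1_first cf (by simpa using f3) (hE _ (by omega) (by omega) (by omega))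
  have dg := h.D1_last cg (by simpa using g3) (hE _ (by omega) (by omega) (by omega))
  have ca1 : ¬ Core n R (a + 1) := hcore _ (by omega) (by omega)
  obtain ⟨x, hx⟩ := h.D1_of_not_core ca1 (hE _ (by omega) (by omega) (by omega))
  obtain ⟨y, y1, y2, hy⟩ := h.D1_rep hx (a + 1)
  have cy := h.core_of_D1 ca1 hy
  have yf : y ≠ f := fun e => f3 (e ▸ cy)
  have ya : y ≠ a + n := fun e => ha' (e ▸ cy)
  have yb : b < y := by
    by_contra! hle
    rcases eq_or_ne y b with e | e
    · exact hb' (e ▸ cy)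
    exact hcore y (by omega) (by omega) cy
  rcases lt_or_gt_of_ne yf with hlt | hlt
  · exact (h.not_both_far hy dg (by omega) (by omega) (by omega) (by omega) (by omega)
      (by omega)).elim
  · exact (h.not_both_near hy df (by omega) (by omega) (by omega) (by omega) (by omega)
      (by omega)).elim

lemma exists_run_of_apart (h : NCfg n R) {i j : ℤ} (hi : Exc n R i) (hj : Exc n R j)
    (h1 : i + 2 ≤ j) (h2 : j ≤ i + n - 2) : ∃ p r, Run n R p r := by
  have hn := h.six_le
  obtain ⟨c, hc⟩ := h.exists_core
  by_cases hE : ∀ v, Exc n R v → ¬ Core n R (v - 1)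
  · exact h.exists_run hE hc hi.not_core
  by_cases hE' : ∀ v, Exc n R v → ¬ Core n R (v + 1)
  · exact h.exists_run' hE' hc hi.not_core
  push Not at hE hE'
  obtain ⟨a, ea, ca⟩ := hE
  obtain ⟨b, eb, cb⟩ := hE'
  obtain ⟨a', a1, a2, a3⟩ := exists_mod_rep (show 0 < n by omega) i a
  obtain ⟨b', b1, b2, b3⟩ := exists_mod_rep (show 0 < n by omega) a' b
  replace ca : Core n R (a' - 1) := h.core_per (by simpa using a3) ca
  replace cb : Core n R (b' + 1) := h.core_per (by simpa using b3) cb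
  replace ea := h.exc_per a3 ea
  replace eb := h.exc_per b3 eb
  have ein := (h.exc_iff i).2 hi
  rcases h.exc_eq_or_eq hi hj (by omega) (by omega) ea a1 a2 with rfl | rfl
  · rcases h.exc_eq_or_eq hi hj (by omega) (by omega) eb b1 b2 with rfl | rfl
    · exact (h.not_core_both hi hj h1 h2 ca cb).elim
    · exact h.exists_run_of_first_last ea eb h1 h2 ca cb
  · rcases h.exc_eq_or_eq hj ein (by omega) (by omega) eb b1 b2 with rfl | rfl
    · exact (h.not_core_both hj ein (by omega) (by omega) ca cb).elim
    · exact h.exists_run_of_first_last ea eb (by omega) (by omega) ca cb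

lemma Run.hasBouquet (h : NCfg n R) {m i j : ℤ} (hr : Run n R 1 (m + 1)) (hi : Exc n R i)
    (hj : Exc n R j) (h1 : m + 2 ≤ i) (h2 : i + 2 ≤ j) (h3 : j ≤ n) : HasBouquet n R := by
  have hn := h.six_le
  have hm := hr.1
  have hmn := Run.add_three_le h hr
  have hR := h.edge_of_two_two h2 (by omega) hi.1 hj.1 hi.2 hj.2
  have hE : ∀ w, Exc n R w → 1 ≤ w → w ≤ n → w = i ∨ w = j := by
    intro w he h4 h5
    rcases h.exc_dvd_or_dvd hi hj (by omega) (by omega) he with hd | hd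
    · have := eq_of_dvd_of_small hd (by omega) (by omega)
      omega
    · have := eq_of_dvd_of_small hd (by omega) (by omega)
      omega
  have nbr : ∀ v w, Exc n R v → (v = i ∧ w = j ∨ v = j ∧ w = i) → 
      ∃ x, 1 ≤ x ∧ x ≤ m + 1 ∧ R v x := by
    intro v w hv hvw
    obtain ⟨x, y, x1, x2, x3, x4, x5⟩ := Cfg.Two.rep h.toCfg hv.2 1
    have key : ∀ x, 1 ≤ x → x ≤ n → R v x → x ≠ w → x ≤ m + 1 := by
      intro x g1 g2 g3 g4
      by_contra! hlt
      have hx := (h.core_or_exc hv g3).resolve_left (hr.2.2.2 x hlt (by omega))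
      have := hE x hx g1 g2
      have hne : x = v := by omega
      exact h.irr v (hne ▸ g3)
    by_cases hx : x = w
    · exact ⟨y, by omega, key y (by omega) (by omega) x5 (by omega), x5⟩
    · exact ⟨x, x1, key x x1 (by omega) x4 hx, x4⟩
  obtain ⟨x, x1, x2, x3⟩ := nbr i j hi (.inl ⟨rfl, rfl⟩)
  obtain ⟨y, y1, y2, y3⟩ := nbr j i hj (.inr ⟨rfl, rfl⟩)
  refine h.run_two (m := m) (i := i) (j := j) (x := x) (y := y) (by omega) hmn
    (fun v g1 g2 => (hr.2.2.1 v g1 g2).1) h1 h2 h3 hi.1 hj.1 (fun w g1 g2 g3 g4 =>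
      Run.exists_D1 h hr g1 g2 fun he => ?_) x1 x2 y1 y2
    (h.D2_of_two hi.1 hR (by rwa [add_comm, h.per]) (by omega) (by omega))
    (h.D2_of_two hj.1 (by rwa [add_comm, h.per]) (by rw [add_comm, h.per]; exact h.symm _ _ hR)
      (by omega) (by omega))
  rcases hE w he (by omega) g2 with e | e <;> omega

lemma hasBouquet_of_apart (h : NCfg n R) {i j : ℤ} (hi : Exc n R i) (hj : Exc n R j)
    (h1 : i + 2 ≤ j) (h2 : j ≤ i + n - 2) : HasBouquet n R := by
  have hn := h.six_le
  obtain ⟨p, r, hr⟩ := h.exists_run_of_apart hi hj h1 h2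
  have hr' := hr.shift (p - 1)
  rw [show p - (p - 1) = 1 by ring, show r - (p - 1) = (r - p) + 1 by ring] at hr'
  obtain ⟨i', a1, a2, a3⟩ := exists_mod_rep (show 0 < n by omega) p i
  obtain ⟨j', b1, b2, b3⟩ := exists_mod_rep (show 0 < n by omega) p j
  have ei := h.exc_per a3 hi
  have ej := h.exc_per b3 hj
  have hi' : r < i' := by
    by_contra! hle
    exact ei.not_core (hr.2.2.1 i' a1 hle)
  have hj' : r < j' := by
    by_contra! hle
    exact ej.not_core (hr.2.2.1 j' b1 hle)
  have key : ∀ d, -1 ≤ d → d ≤ 1 → j' - i' ≠ d := by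
    intro d d1 d2 e
    have hd : n ∣ j - i - d := by
      have := a3.sub b3
      rwa [show i' - i - (j' - j) = j - i - d by rw [← e]; ring] at this
    have := eq_of_dvd_of_small hd (by omega) (by omega)
    omega
  have k0 := key 0 (by omega) (by omega)
  have k1 := key 1 (by omega) (by omega)
  have k2 := key (-1) (by omega) (by omega)
  apply HasBouquet.of_shift (p - 1)
  rcases lt_or_ge i' j' with hlt | hlt
  · refine Run.hasBouquet (i := i' - (p - 1)) (j := j' - (p - 1)) (h.shift (p - 1)) hr' ?_ ?_
      (by omega) (by omega) (by omega) <;> rw [exc_shift] <;> simpa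
  · refine Run.hasBouquet (i := j' - (p - 1)) (j := i' - (p - 1)) (h.shift (p - 1)) hr' ?_ ?_
      (by omega) (by omega) (by omega) <;> rw [exc_shift] <;> simpa

end NCfg

/-- The edges of a seagull, lifted to `ℤ`. -/
def SeagullData (n : ℤ) (R : ℤ → ℤ → Prop) : Prop :=
  ∃ (l m : ℤ) (x : ℤ → ℤ), 2 < l ∧ l < m ∧ m + 3 ≤ n ∧
    (∀ j, 1 ≤ j → j ≤ m + 1 → j ≠ l → R (j - 1) (j + 1)) ∧
    R (l - 2) (l + 1) ∧ R (l - 1) (l + 2) ∧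
    (∀ w, m + 3 ≤ w → w < n → 1 ≤ x w ∧ x w ≤ m + 1 ∧ x w ≠ l ∧ R w (x w)) ∧
    ∀ w w', m + 3 ≤ w → w < w' → w' < n → x w' ≤ x w + 1

/-- The edges of a butterfly, lifted to `ℤ`. -/
def ButterflyData (n : ℤ) (R : ℤ → ℤ → Prop) : Prop :=
  ∃ (l m : ℤ) (x : ℤ → ℤ), 2 < l ∧ l + 1 < m ∧ m + 3 ≤ n ∧
    (∀ j, 1 ≤ j → j ≤ m + 1 → j ≠ l → j ≠ l + 1 → R (j - 1) (j + 1)) ∧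
    R (l - 2) (l + 1) ∧ R (l - 1) (l + 2) ∧ R l (l + 3) ∧
    (∀ w, m + 3 ≤ w → w < n → 1 ≤ x w ∧ x w ≤ m + 1 ∧ x w ≠ l ∧ x w ≠ l + 1 ∧ R w (x w)) ∧
    ∀ w w', m + 3 ≤ w → w < w' → w' < n → x w' ≤ x w + 1

namespace NCfg

variable {n : ℤ} {R : ℤ → ℤ → Prop}

/-- If the exceptional vertices are surrounded by core vertices, then the core consists of two
intervals. -/
lemma exists_two_intervals (h : NCfg n R) {i i' : ℤ} (hii : i ≤ i') (hii' : i' ≤ i + 1)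
    (c1 : Core n R (i - 1)) (c2 : Core n R (i' + 1)) (hi : ¬ Core n R i) (hi' : ¬ Core n R i')
    (hE : ∀ v, i' < v → v < i + n → ¬ Exc n R v) :
    ∃ s m, 2 < i - s ∧ i' - s < m ∧ m + 3 ≤ n ∧
      (∀ v, 1 ≤ v → v ≤ m + 1 → (v < i - s ∨ i' - s < v) → Core n R (v + s)) ∧
      (∀ v, m + 2 ≤ v → v ≤ n → ¬ Core n R (v + s)) ∧
      D1 n R (m + 2 + s) (m + s) ∧ D1 n R (n + s) (n + 2 + s) := by
  have hn := h.six_le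
  obtain ⟨u, u1, u2, u3⟩ : ∃ u, i' + 1 ≤ u ∧ u ≤ i + n - 1 ∧ ¬ Core n R u := by
    by_contra! hc
    exact h.not_cov_interval (i' + 1) fun v g1 g2 => (hc v g1 (by omega)).1
  have hin : ¬ Core n R (i + n) := by rwa [h.core_iff]
  have c1' : Core n R (i + n - 1) := by
    rwa [show i + n - 1 = i - 1 + n by ring, h.core_iff]
  obtain ⟨f, f1, f2, f3, f4⟩ := exists_first (P := fun v => ¬ Core n R v) u1 u3
  obtain ⟨g, g1, g2, g3, g4⟩ := exists_last (P := fun v => ¬ Core n R v) u2 u3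
  have fi : f ≠ i' + 1 := fun e => f3 (e ▸ c2)
  have gi : g ≠ i + n - 1 := fun e => g3 (e ▸ c1')
  have cf : Core n R (f - 1) := not_not.1 (f4 _ (by omega) (by omega))
  have cg : Core n R (g + 1) := not_not.1 (g4 _ (by omega) (by omega))
  have cf' := h.core_pred cf (by simpa using f3)
  have cg' := h.core_succ cg (by simpa using g3)
  have fi' : f - 1 - 1 ≠ i' := fun e => hi' (e ▸ cf')
  have gi' : g + 1 + 1 ≠ i + n := fun e => hin (e ▸ cg')
  have ef : ¬ Exc n R (f - 1 + 1) := by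
    rw [sub_add_cancel]
    exact hE f (by omega) (by omega)
  have df := h.D1_first cf (by simpa using f3) ef
  have dg := h.D1_last cg (by simpa using g3) (hE _ (by omega) (by omega))
  have fg : f ≠ g := by
    rintro rfl
    refine df.not (z := f + 1 + 1) (by omega) ?_
    rw [sub_add_cancel]
    rw [add_sub_cancel_right] at dg
    exact dg.1
  have hmid : ∀ v, f ≤ v → v ≤ g → ¬ Core n R v := by
    intro v v1 v2 hv
    obtain ⟨c, d1, d2, d3, d4⟩ := exists_first (P := fun v => ¬ Core n R v) v2 g3
    have cv : c ≠ v := fun e => d3 (e ▸ hv)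
    have vf : v ≠ f := fun e => f3 (e ▸ hv)
    have cc : Core n R (c - 1) := not_not.1 (d4 _ (by omega) (by omega))
    exact h.first_unique cf (by simpa using f3) ef cc (by simpa using d3)
      (by rw [sub_add_cancel]; exact hE c (by omega) (by omega)) (by omega) (by omega)
  refine ⟨g - n, f - 2 - (g - n), by omega, by omega, by omega, fun v v1 v2 v3 => ?_,
    fun v v1 v2 => hmid _ (by omega) (by omega), ?_, ?_⟩
  · rcases v3 with v3 | v3
    · rw [← h.core_iff]
      exact not_not.1 (g4 _ (by omega) (by omega))
    · exact not_not.1 (f4 _ (by omega) (by omega))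
  · convert df using 1 <;> ring
  · convert dg using 1 <;> ring

lemma exists_edges_to_core (h : NCfg n R) {m : ℤ}
    (hc : ∀ v, m + 2 ≤ v → v ≤ n → ¬ Core n R v ∧ ¬ Exc n R v) :
    ∃ x : ℤ → ℤ, (∀ w, m + 3 ≤ w → w < n → 1 ≤ x w ∧ x w ≤ m + 1 ∧ Core n R (x w) ∧ R w (x w)) ∧
      ∀ w w', m + 3 ≤ w → w < w' → w' < n → x w' ≤ x w + 1 := by
  have key : ∀ w, m + 3 ≤ w → w < n → ∃ x, 1 ≤ x ∧ x ≤ m + 1 ∧ Core n R x ∧ D1 n R w x := by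
    intro w h1 h2
    have hw := hc w (by omega) (by omega)
    obtain ⟨x, hx⟩ := h.D1_of_not_core hw.1 hw.2
    obtain ⟨y, h3, h4, hy⟩ := h.D1_rep hx 1
    have cy := h.core_of_D1 hw.1 hy
    refine ⟨y, h3, ?_, cy, hy⟩
    by_contra! hlt
    exact (hc y (by omega) (by omega)).1 cy
  choose! x x1 x2 x3 x4 using key
  exact ⟨x, fun w h1 h2 => ⟨x1 w h1 h2, x2 w h1 h2, x3 w h1 h2, (x4 w h1 h2).1⟩,
    fun w w' h1 h2 h3 => h.D1_le_add_one (x4 w h1 (by omega)) (x4 w' (by omega) h3) (by omega) h2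
      h3.le (x1 w h1 (by omega)) (x2 w' (by omega) h3)⟩

lemma seagull_of_single (h : NCfg n R) {i : ℤ} (hi : Exc n R i)
    (hE : ∀ v, i < v → v < i + n → ¬ Exc n R v) :
    ∃ s, SeagullData n (fun x y => R (x + s) (y + s)) := by
  have hn := h.six_le
  have hE' : ∀ v, Exc n R v → n ∣ v - i := by
    intro v hv
    obtain ⟨w, h1, h2, h3⟩ := exists_mod_rep (show 0 < n by omega) i v
    have hw : w = i := by
      by_contra hne
      exact hE w (by omega) h2 (h.exc_per h3 hv)
    rw [← dvd_neg]
    simpa [hw] using h3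
  obtain ⟨c, hc⟩ := h.exists_core
  by_cases c1 : Core n R (i - 1)
  swap
  · obtain ⟨p, r, hr⟩ := h.exists_run (fun v hv hk => c1 (h.core_per (by
      rw [← dvd_neg]; simpa using hE' v hv) hk)) hc hi.not_core
    exact (h.run_single_false hr hi hE').elim
  by_cases c2 : Core n R (i + 1)
  swap
  · obtain ⟨p, r, hr⟩ := h.exists_run' (fun v hv hk => c2 (h.core_per (by
      rw [← dvd_neg]; simpa using hE' v hv) hk)) hc hi.not_core
    exact (h.run_single_false hr hi hE').elim
  obtain ⟨s, m, s1, s2, s3, s4, s5, s6, s7⟩ := h.exists_two_intervals le_rfl (by omega) c1 c2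
    hi.not_core hi.not_core hE
  have hs := h.shift s
  have el : Exc n (fun x y => R (x + s) (y + s)) (i - s) := by rw [exc_shift]; simpa
  obtain ⟨x, x1, x2⟩ := hs.exists_edges_to_core (m := m) fun v v1 v2 => by
    rw [core_shift, exc_shift]
    exact ⟨s5 v v1 v2, hE _ (by omega) (by omega)⟩
  simp only [← D1_shift s, ← core_shift s] at s4 s5 s6 s7
  refine ⟨s, i - s, m, x, s1, s2, s3, fun j j1 j2 j3 => (s4 j j1 j2 (by omega)).1, ?_, ?_,
    fun w w1 w2 => ?_, x2⟩
  · exact hs.edge_left_of_exceptional (f := m + 2) el.1 el.2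
      (s4 _ (by omega) (by omega) (by omega)).1 (by simpa using s6) (by omega) (by omega)
  · exact hs.edge_right_of_exceptional (g := n) el.1 el.2
      (s4 _ (by omega) (by omega) (by omega)).1 s7 (by omega) (by omega)
  · obtain ⟨x3, x4, x5, x6⟩ := x1 w w1 w2
    exact ⟨x3, x4, fun e => el.not_core (e ▸ x5), x6⟩

lemma butterfly_of_adjacent (h : NCfg n R) {i : ℤ} (hi : Exc n R i) (hi' : Exc n R (i + 1)) :
    ∃ s, ButterflyData n (fun x y => R (x + s) (y + s)) := by
  have hn := h.six_le
  have hE' : ∀ v, Exc n R v → n ∣ v - i ∨ n ∣ v - (i + 1) := fun v hv =>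
    h.exc_dvd_or_dvd hi hi' (by omega) (by omega) hv
  obtain ⟨c, hc⟩ := h.exists_core
  have norun : ∀ p r, ¬ Run n R p r := by
    intro p r hr
    have hr' := hr.shift (p - 1)
    rw [show p - (p - 1) = 1 by ring, show r - (p - 1) = (r - p) + 1 by ring] at hr'
    obtain ⟨j, a1, a2, a3⟩ := exists_mod_rep (show 0 < n by omega) p i
    refine (h.shift (p - 1)).run_adjacent_false (i := j - (p - 1)) hr' (by omega) (by omega) ?_ ?_
    · rw [exc_shift]
      exact h.exc_per (by simpa using a3) hi
    · rw [exc_shift]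
      exact h.exc_per (by
        rwa [show j - (p - 1) + 1 + (p - 1) - (i + 1) = j - i by ring]) hi'
  by_cases c1 : Core n R (i - 1)
  swap
  · obtain ⟨p, r, hr⟩ := h.exists_run (fun v hv hk => by
      rcases hE' v hv with hd | hd
      · exact c1 (h.core_per (by rw [← dvd_neg]; simpa using hd) hk)
      · exact hi.not_core (h.core_per (by
          rw [← dvd_neg, show -(i - (v - 1)) = v - (i + 1) by ring]; exact hd) hk)) hc hi.not_core
    exact (norun p r hr).elim
  by_cases c2 : Core n R (i + 1 + 1)
  swap
  · obtain ⟨p, r, hr⟩ := h.exists_run' (fun v hv hk => by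
      rcases hE' v hv with hd | hd
      · exact hi'.not_core (h.core_per (by rw [← dvd_neg]; simpa using hd) hk)
      · exact c2 (h.core_per (by rw [← dvd_neg]; simpa using hd) hk)) hc hi.not_core
    exact (norun p r hr).elim
  have hE : ∀ v, i + 1 < v → v < i + n → ¬ Exc n R v := by
    intro v v1 v2 hv
    rcases h.exc_eq_or_eq hi hi' (by omega) (by omega) hv (by omega) v2 with e | e <;> omega
  obtain ⟨s, m, s1, s2, s3, s4, s5, s6, s7⟩ := h.exists_two_intervals (by omega) le_rfl c1 c2
    hi.not_core hi'.not_core hE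
  have hs := h.shift s
  have el : Exc n (fun x y => R (x + s) (y + s)) (i - s) := by rw [exc_shift]; simpa
  have el' : Exc n (fun x y => R (x + s) (y + s)) (i - s + 1) := by
    rw [exc_shift, show i - s + 1 + s = i + 1 by ring]
    exact hi'
  obtain ⟨x, x1, x2⟩ := hs.exists_edges_to_core (m := m) fun v v1 v2 => by
    rw [core_shift, exc_shift]
    exact ⟨s5 v v1 v2, hE _ (by omega) (by omega)⟩
  simp only [← D1_shift s, ← core_shift s] at s4 s5 s6 s7
  refine ⟨s, i - s, m, x, s1, by omega, s3, fun j j1 j2 j3 j4 => (s4 j j1 j2 (by omega)).1, ?_, ?_,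
    ?_, fun w w1 w2 => ?_, x2⟩
  · exact hs.edge_left_of_exceptional (f := m + 2) el.1 el.2
      (s4 _ (by omega) (by omega) (by omega)).1 (by simpa using s6) (by omega) (by omega)
  · exact hs.edge_of_two_succ (.inl el.1) el.2 el'.2
  · have := hs.edge_right_of_exceptional (l := i - s + 1) (g := n) el'.1 el'.2
      (s4 _ (by omega) (by omega) (by omega)).1 s7 (by omega) (by omega)
    convert this using 1 <;> ring
  · obtain ⟨x3, x4, x5, x6⟩ := x1 w w1 w2
    exact ⟨x3, x4, fun e => el.not_core (e ▸ x5), fun e => el'.not_core (e ▸ x5), x6⟩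

end NCfg

theorem Cfg.classification {n : ℤ} {R : ℤ → ℤ → Prop} (h : Cfg n R) :
    (∃ s, SeagullData n (fun x y => R (x + s) (y + s))) ∨
    (∃ s, ButterflyData n (fun x y => R (x + s) (y + s))) ∨ HasBouquet n R := by
  have hn := h.six_le
  by_cases hb : HasBouquet n R
  · exact .inr (.inr hb)
  have hN : NCfg n R := ⟨h, fun w i h1 h2 h3 h4 h5 => hb (h.hasBouquet_of_uncov_succ h1 h2 h3 h4 h5)⟩
  obtain ⟨i, hi⟩ := hN.exists_exc
  by_cases hE : ∀ v, i < v → v < i + n → ¬ Exc n R v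
  · exact .inl (hN.seagull_of_single hi hE)
  push Not at hE
  obtain ⟨j, j1, j2, hj⟩ := hE
  by_cases e : j = i + 1
  · exact .inr (.inl (hN.butterfly_of_adjacent hi (e ▸ hj)))
  by_cases e' : j = i + n - 1
  · refine .inr (.inl (hN.butterfly_of_adjacent hj ?_))
    rw [e', sub_add_cancel, hN.exc_iff]
    exact hi
  · exact (hb (hN.hasBouquet_of_apart hi hj (by omega) (by omega))).elim

lemma val_intCast_sub {n : ℕ} (hn : 0 < n) {a c : ℤ} (h1 : c < a + n) (h2 : a < c + n) :
    (a ≤ c ∧ (((c : ZMod n) - (a : ZMod n)).val : ℤ) = c - a) ∨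
      (c < a ∧ (((c : ZMod n) - (a : ZMod n)).val : ℤ) = c - a + n) := by
  have : NeZero n := ⟨hn.ne'⟩
  rw [← Int.cast_sub, ZMod.val_intCast]
  rcases le_or_gt a c with h | h
  · exact .inl ⟨h, Int.emod_eq_of_lt (by omega) (by omega)⟩
  · refine .inr ⟨h, ?_⟩
    rw [← Int.add_emod_right]
    exact Int.emod_eq_of_lt (by omega) (by omega)

lemma intCast_inj {n : ℕ} {a x y : ℤ} (h1 : a ≤ x) (h2 : x < a + n) (h3 : a ≤ y) (h4 : y < a + n)
    (h : (x : ZMod n) = y) : x = y := by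
  rw [ZMod.intCast_eq_intCast_iff_dvd_sub] at h
  have := eq_of_dvd_of_small h (by omega) (by omega)
  omega

lemma sym2_intCast_inj {n : ℕ} {a x y x' y' : ℤ} (h1 : a ≤ x) (h2 : x < a + n) (h3 : a ≤ y)
    (h4 : y < a + n) (h1' : a ≤ x') (h2' : x' < a + n) (h3' : a ≤ y') (h4' : y' < a + n)
    (h : s((x : ZMod n), (y : ZMod n)) = s((x' : ZMod n), (y' : ZMod n))) :
    x = x' ∧ y = y' ∨ x = y' ∧ y = x' := by
  rcases Sym2.eq_iff.1 h with ⟨e1, e2⟩ | ⟨e1, e2⟩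
  · exact .inl ⟨intCast_inj h1 h2 h1' h2' e1, intCast_inj h3 h4 h3' h4' e2⟩
  · exact .inr ⟨intCast_inj h1 h2 h3' h4' e1, intCast_inj h3 h4 h1' h2' e2⟩

lemma exists_intCast {n : ℕ} (hn : 0 < n) (a : ℤ) (z : ZMod n) :
    ∃ x : ℤ, a ≤ x ∧ x < a + n ∧ (x : ZMod n) = z := by
  have : NeZero n := ⟨hn.ne'⟩
  obtain ⟨w, h1, h2, h3⟩ := exists_mod_rep (show 0 < (n : ℤ) by omega) a z.val
  refine ⟨w, h1, h2, ?_⟩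
  have : ((z.val : ℤ) : ZMod n) = w := by rwa [ZMod.intCast_eq_intCast_iff_dvd_sub]
  rw [← this]
  simp

lemma cross_iff {n : ℕ} (hn : 0 < n) {a x y x' y' : ℤ} (h1 : a ≤ x) (h2 : x < y) (h3 : y < a + n)
    (h1' : a ≤ x') (h2' : x' < y') (h3' : y' < a + n) :
    Cross n s((x : ZMod n), (y : ZMod n)) s((x' : ZMod n), (y' : ZMod n)) ↔
      (x < x' ∧ x' < y ∧ y < y') ∨ (x' < x ∧ x < y' ∧ y' < y) := by
  constructor
  · rintro ⟨A, B, C, D, e1, e2, g1, g2, g3⟩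
    have v1 := val_intCast_sub hn (a := x) (c := y) (by omega) (by omega)
    have v2 := val_intCast_sub hn (a := x) (c := x') (by omega) (by omega)
    have v3 := val_intCast_sub hn (a := x) (c := y') (by omega) (by omega)
    have v4 := val_intCast_sub hn (a := y) (c := x) (by omega) (by omega)
    have v5 := val_intCast_sub hn (a := y) (c := x') (by omega) (by omega)
    have v6 := val_intCast_sub hn (a := y) (c := y') (by omega) (by omega)
    rcases Sym2.eq_iff.1 e1 with ⟨rfl, rfl⟩ | ⟨rfl, rfl⟩ <;>
      rcases Sym2.eq_iff.1 e2 with ⟨rfl, rfl⟩ | ⟨rfl, rfl⟩ <;> omega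
  · rintro (h | h)
    · refine ⟨x, y, x', y', rfl, rfl, ?_⟩
      have v1 := val_intCast_sub hn (a := x) (c := y) (by omega) (by omega)
      have v2 := val_intCast_sub hn (a := x) (c := x') (by omega) (by omega)
      have v3 := val_intCast_sub hn (a := x) (c := y') (by omega) (by omega)
      omega
    · refine ⟨y, x, x', y', Sym2.eq_swap, rfl, ?_⟩
      have v1 := val_intCast_sub hn (a := y) (c := x) (by omega) (by omega)
      have v2 := val_intCast_sub hn (a := y) (c := x') (by omega) (by omega)
      have v3 := val_intCast_sub hn (a := y) (c := y') (by omega) (by omega)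
      omega

lemma isDiagonal_intCast {n : ℕ} (hn : 0 < n) {x y : ℤ} (h2 : x + 2 ≤ y)
    (h4 : y ≤ x + n - 2) : IsDiagonal n s((x : ZMod n), (y : ZMod n)) := by
  have v1 := val_intCast_sub hn (a := x) (c := y) (by omega) (by omega)
  have v2 := val_intCast_sub hn (a := x) (c := x + 1) (by omega) (by omega)
  have v3 := val_intCast_sub hn (a := y) (c := x) (by omega) (by omega)
  have v4 := val_intCast_sub hn (a := y) (c := y + 1) (by omega) (by omega)
  refine ⟨x, y, rfl, fun e => ?_, ⟨((x + 1 : ℤ) : ZMod n), ?_⟩, ⟨((y + 1 : ℤ) : ZMod n), ?_⟩⟩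
  · have := intCast_inj (n := n) (a := x) (by omega) (by omega) (by omega) (by omega) e
    omega
  · rw [Btw]; omega
  · rw [Btw]; omega

lemma IsDiagonal.exists_intCast {n : ℕ} (hn : 0 < n) (a : ℤ) {e : Sym2 (ZMod n)}
    (he : IsDiagonal n e) : ∃ x y : ℤ, a ≤ x ∧ x + 2 ≤ y ∧ y < a + n ∧ y ≤ x + n - 2 ∧
      e = s((x : ZMod n), (y : ZMod n)) := by
  obtain ⟨A, B, rfl, hne, ⟨c, c1, c2⟩, d, d1, d2⟩ := he
  obtain ⟨x, x1, x2, rfl⟩ := ConvexBlocker.exists_intCast hn a A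
  obtain ⟨y, y1, y2, rfl⟩ := ConvexBlocker.exists_intCast hn a B
  have v1 := val_intCast_sub hn (a := x) (c := y) (by omega) (by omega)
  have v3 := val_intCast_sub hn (a := y) (c := x) (by omega) (by omega)
  have hxy : x ≠ y := fun e => hne (by rw [e])
  rcases lt_or_gt_of_ne hxy with h | h
  · exact ⟨x, y, x1, by omega, y2, by omega, rfl⟩
  · exact ⟨y, x, y1, by omega, x2, by omega, Sym2.eq_swap⟩

lemma not_isDiagonal_self {n : ℕ} (z : ZMod n) : ¬ IsDiagonal n s(z, z) := by
  rintro ⟨a, b, e, hne, -⟩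
  rcases Sym2.eq_iff.1 e with ⟨rfl, rfl⟩ | ⟨rfl, rfl⟩ <;> exact hne rfl

lemma not_isDiagonal_succ {n : ℕ} (hn : 2 < n) (x : ℤ) :
    ¬ IsDiagonal n s((x : ZMod n), ((x + 1 : ℤ) : ZMod n)) := by
  intro h
  obtain ⟨p, q, h1, h2, h3, h4, e⟩ := h.exists_intCast (by omega) x
  rcases sym2_intCast_inj (a := x) (by omega) (by omega) (by omega) (by omega) (by omega) (by omega)
    (by omega) (by omega) e with h | h <;> omega

namespace Tri

variable {R : ℤ → ℤ → Prop}

/-- A triangulation of a full turn starting at `a` can be rearranged so that its outermost edge is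
`(a, a + n - 1)`. -/
lemma sub_one_of_left {n a c e : ℤ} (hR : ∀ x y, R x y → R y (x + n)) (h2 : Tri R c e) :
    e = a + n → Tri R a c → ¬ R a c → Tri R a (a + n - 1) := by
  induction h2 with
  | leaf c =>
    rintro he h1 -
    obtain rfl : c = a + n - 1 := by omega
    exact h1
  | @node c d b hcd hdb ncd ndb _ _ _ ih =>
    rintro rfl h1 hac
    exact ih rfl (node h1.lt hcd hac ncd h1 ‹_›) fun h => ndb (hR _ _ h)

lemma sub_one {n a : ℤ} (hn : 1 < n) (hR : ∀ x y, R x y → R y (x + n)) (h : Tri R a (a + n)) :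
    Tri R a (a + n - 1) := by
  generalize he : a + n = e at h
  cases h with
  | leaf => omega
  | node _ _ nac _ h1 h2 => subst he; exact sub_one_of_left hR h2 rfl h1 nac

lemma exists_finset {a b : ℤ} (h : Tri R a b) : ∃ S : Finset (ℤ × ℤ),
    (∀ p ∈ S, a ≤ p.1 ∧ p.1 + 2 ≤ p.2 ∧ p.2 ≤ b ∧ p.2 - p.1 < b - a ∧ ¬ R p.1 p.2) ∧
    (∀ p ∈ S, ∀ q ∈ S, ¬ (p.1 < q.1 ∧ q.1 < p.2 ∧ p.2 < q.2)) ∧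
    (∀ x y, a ≤ x → x + 2 ≤ y → y ≤ b → y - x < b - a → (x, y) ∉ S → ∃ q ∈ S,
      (x < q.1 ∧ q.1 < y ∧ y < q.2) ∨ (q.1 < x ∧ x < q.2 ∧ q.2 < y)) := by
  induction h with
  | leaf a => exact ⟨∅, by simp, by simp, fun x y => by omega⟩
  | @node a c b hac hcb nac ncb h1 h2 ih1 ih2 =>
    obtain ⟨S, s1, s2, s3⟩ := ih1
    obtain ⟨U, u1, u2, u3⟩ := ih2
    classical
    have key : ∀ p, p ∈ S ∪ U ∪ ({(a, c), (c, b)} : Finset (ℤ × ℤ)).filter (fun p => p.1 + 2 ≤ p.2) ↔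
        p ∈ S ∨ p ∈ U ∨ (p.1 = a ∧ p.2 = c ∧ a + 2 ≤ c) ∨ (p.1 = c ∧ p.2 = b ∧ c + 2 ≤ b) := by
      rintro ⟨p, q⟩
      simp only [mem_union, mem_filter, mem_insert, mem_singleton, Prod.mk.injEq]
      constructor
      · rintro ((h | h) | ⟨⟨rfl, rfl⟩ | ⟨rfl, rfl⟩, h⟩)
        · exact .inl h
        · exact .inr (.inl h)
        · exact .inr (.inr (.inl ⟨rfl, rfl, h⟩))
        · exact .inr (.inr (.inr ⟨rfl, rfl, h⟩))
      · rintro (h | h | ⟨rfl, rfl, h⟩ | ⟨rfl, rfl, h⟩)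
        · exact .inl (.inl h)
        · exact .inl (.inr h)
        · exact .inr ⟨.inl ⟨rfl, rfl⟩, h⟩
        · exact .inr ⟨.inr ⟨rfl, rfl⟩, h⟩
    refine ⟨S ∪ U ∪ ({(a, c), (c, b)} : Finset (ℤ × ℤ)).filter (fun p => p.1 + 2 ≤ p.2),
      fun p hp => ?_, fun p hp q hq => ?_, fun x y e1 e2 e3 e4 e5 => ?_⟩
    · rcases (key p).1 hp with h | h | ⟨e1, e2, h⟩ | ⟨e1, e2, h⟩
      · have := s1 p h; refine ⟨?_, ?_, ?_, ?_, this.2.2.2.2⟩ <;> omega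
      · have := u1 p h; refine ⟨?_, ?_, ?_, ?_, this.2.2.2.2⟩ <;> omega
      · rw [e1, e2]; refine ⟨?_, ?_, ?_, ?_, nac⟩ <;> omega
      · rw [e1, e2]; refine ⟨?_, ?_, ?_, ?_, ncb⟩ <;> omega
    · have hS : ∀ p ∈ S, a ≤ p.1 ∧ p.1 + 2 ≤ p.2 ∧ p.2 ≤ c := fun p h =>
        ⟨(s1 p h).1, (s1 p h).2.1, (s1 p h).2.2.1⟩
      have hU : ∀ p ∈ U, c ≤ p.1 ∧ p.1 + 2 ≤ p.2 ∧ p.2 ≤ b := fun p h =>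
        ⟨(u1 p h).1, (u1 p h).2.1, (u1 p h).2.2.1⟩
      rcases (key p).1 hp with h | h | h | h <;> rcases (key q).1 hq with h' | h' | h' | h' <;>
        first
        | exact s2 p h q h'
        | exact u2 p h q h'
        | (first | have a1 := hS p h | have a1 := hU p h | have a1 := h
           first | have a2 := hS q h' | have a2 := hU q h' | have a2 := h'
           omega)
    · have k := key (x, y)
      have hne : ¬ ((x = a ∧ y = c ∧ a + 2 ≤ c) ∨ (x = c ∧ y = b ∧ c + 2 ≤ b)) := fun h =>
        e5 (k.2 (.inr (.inr h)))
      rcases le_or_gt y c with hy | hy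
      · obtain ⟨q, hq, hc⟩ := s3 x y e1 e2 hy (by omega) fun h => e5 (k.2 (.inl h))
        exact ⟨q, (key q).2 (.inl hq), hc⟩
      rcases le_or_gt c x with hx | hx
      · obtain ⟨q, hq, hc⟩ := u3 x y hx e2 e3 (by omega) fun h => e5 (k.2 (.inr (.inl h)))
        exact ⟨q, (key q).2 (.inr (.inl hq)), hc⟩
      by_cases hxa : x = a
      · exact ⟨(c, b), (key (c, b)).2 (.inr (.inr (.inr ⟨rfl, rfl, by omega⟩))), by simp; omega⟩
      · exact ⟨(a, c), (key (a, c)).2 (.inr (.inr (.inl ⟨rfl, rfl, by omega⟩))), by simp; omega⟩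

end Tri

/-- The relation on integers induced by a set of edges of the `n`-gon. -/
def rel (n : ℕ) (B : Finset (Sym2 (ZMod n))) (x y : ℤ) : Prop :=
  s((x : ZMod n), (y : ZMod n)) ∈ B

lemma rel_symm {n : ℕ} {B : Finset (Sym2 (ZMod n))} {x y : ℤ} (h : rel n B x y) : rel n B y x := by
  rw [rel, Sym2.eq_swap]; exact h

lemma rel_add {n : ℕ} {B : Finset (Sym2 (ZMod n))} {x y : ℤ} :
    rel n B x (y + n) ↔ rel n B x y := by simp [rel]

lemma IsBlocker.not_tri {n : ℕ} (hn : 3 ≤ n) {B : Finset (Sym2 (ZMod n))} (hB : IsBlocker n B)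
    (a : ℤ) : ¬ Tri (rel n B) a (a + n) := by
  intro h
  obtain ⟨S, s1, s2, s3⟩ := (h.sub_one (by omega) fun x y h => rel_add.2 (rel_symm h)).exists_finset
  classical
  suffices hT : IsTriangulation n (S.image fun p => s((p.1 : ZMod n), (p.2 : ZMod n))) by
    obtain ⟨e, he⟩ := hB.2 _ hT
    obtain ⟨h1, h2⟩ := mem_inter.1 he
    obtain ⟨p, hp, rfl⟩ := mem_image.1 h2
    exact (s1 p hp).2.2.2.2 h1
  refine ⟨fun e he => ?_, fun e he f hf => ?_, fun e he he' => ?_⟩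
  · obtain ⟨p, hp, rfl⟩ := mem_image.1 he
    have := s1 p hp
    exact isDiagonal_intCast (by omega) (by omega) (by omega)
  · obtain ⟨p, hp, rfl⟩ := mem_image.1 he
    obtain ⟨q, hq, rfl⟩ := mem_image.1 hf
    have h1 := s1 p hp
    have h2 := s1 q hq
    rw [cross_iff (a := a) (by omega) (by omega) (by omega) (by omega) (by omega) (by omega)
      (by omega)]
    exact not_or.2 ⟨s2 p hp q hq, s2 q hq p hp⟩
  · obtain ⟨x, y, h1, h2, h3, h4, rfl⟩ := he.exists_intCast (by omega) a
    obtain ⟨q, hq, hc⟩ := s3 x y h1 h2 (by omega) (by omega) fun h =>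
      he' (mem_image_of_mem (fun p : ℤ × ℤ => s((p.1 : ZMod n), (p.2 : ZMod n))) h)
    have h2 := s1 q hq
    refine ⟨_, mem_image_of_mem _ hq, ?_⟩
    rw [cross_iff (a := a) (by omega) (by omega) (by omega) (by omega) (by omega) (by omega)
      (by omega)]
    exact hc

/-- A triangulation avoiding the relation `R` yields a hierarchical triangulation. -/
lemma IsTriangulation.tri {n : ℕ} (hn : 3 ≤ n) {T : Finset (Sym2 (ZMod n))}
    (hT : IsTriangulation n T) {R : ℤ → ℤ → Prop} (hadj : ∀ x, ¬ R x (x + 1))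
    (hR : ∀ x y : ℤ, s((x : ZMod n), (y : ZMod n)) ∈ T → ¬ R x y) (a : ℤ) : Tri R a (a + n - 1) := by
  suffices H : ∀ k : ℕ, ∀ x y : ℤ, a ≤ x → x < y → y < a + n → y - x ≤ k →
      (y = x + 1 ∨ s((x : ZMod n), (y : ZMod n)) ∈ T ∨ (x = a ∧ y = a + n - 1)) → Tri R x y from
    H n _ _ (by omega) (by omega) (by omega) (by omega) (.inr (.inr ⟨rfl, rfl⟩))
  intro k
  induction k with
  | zero => intros; omega
  | succ k ih =>
    intro x y h1 h2 h3 h4 h5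
    by_cases hxy : y = x + 1
    · subst hxy; exact Tri.leaf x
    -- the largest `c` strictly between `x` and `y` joined to `x`
    obtain ⟨c, ⟨hxc, hcy, hc⟩, hmax⟩ := Int.exists_greatest_of_bdd
      (P := fun c => x < c ∧ c < y ∧ (c = x + 1 ∨ s((x : ZMod n), (c : ZMod n)) ∈ T))
      ⟨y, fun z hz => by omega⟩ ⟨x + 1, by omega, by omega, .inl rfl⟩
    have hcr : ∀ p q r t : ℤ, a ≤ p → p < q → q < a + n → a ≤ r → r < t → t < a + n →
        s((p : ZMod n), (q : ZMod n)) ∈ T → s((r : ZMod n), (t : ZMod n)) ∈ T →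
        ¬ ((p < r ∧ r < q ∧ q < t) ∨ (r < p ∧ p < t ∧ t < q)) := by
      intro p q r t e1 e2 e3 e4 e5 e6 e7 e8
      rw [← cross_iff (a := a) (by omega) e1 e2 e3 e4 e5 e6]
      exact hT.2.1 _ e7 _ e8
    have hcov : ∀ p q : ℤ, a ≤ p → p + 2 ≤ q → q < a + n → q ≤ p + n - 2 →
        s((p : ZMod n), (q : ZMod n)) ∉ T → ∃ r t : ℤ, a ≤ r ∧ r + 2 ≤ t ∧ t < a + n ∧
        s((r : ZMod n), (t : ZMod n)) ∈ T ∧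
        ((p < r ∧ r < q ∧ q < t) ∨ (r < p ∧ p < t ∧ t < q)) := by
      intro p q e1 e2 e3 e4 e5
      obtain ⟨f, hf, hc⟩ := hT.2.2 _ (isDiagonal_intCast (by omega) e2 e4) e5
      obtain ⟨r, t, h1, h2, h3, h4, rfl⟩ := (hT.1 f hf).exists_intCast (by omega) a
      rw [cross_iff (a := a) (by omega) (by omega) (by omega) (by omega) (by omega) (by omega)
        (by omega)] at hc
      exact ⟨r, t, h1, h2, h3, hf, hc⟩
    have hcy' : y = c + 1 ∨ s((c : ZMod n), (y : ZMod n)) ∈ T := by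
      by_contra! hcon
      obtain ⟨r, t, e1, e2, e3, e4, e5⟩ := hcov c y (by omega) (by omega) h3 (by omega) hcon.2
      have hxyT : ¬ (x = a ∧ y = a + n - 1) → s((x : ZMod n), (y : ZMod n)) ∈ T := fun h =>
        (h5.resolve_left hxy).resolve_right h
      rcases e5 with e5 | e5
      · exact hcr x y r t h1 h2 h3 e1 (by omega) e3 (hxyT (by omega)) e4 (by omega)
      · rcases lt_trichotomy r x with hr | rfl | hr
        · exact hcr x y r t h1 h2 h3 e1 (by omega) e3 (hxyT (by omega)) e4 (by omega)
        · have := hmax t ⟨by omega, by omega, .inr e4⟩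
          omega
        · exact hcr x c r t h1 hxc (by omega) e1 (by omega) e3 (hc.resolve_left (by omega)) e4
            (by omega)
    refine Tri.node hxc hcy ?_ ?_ (ih x c h1 hxc (by omega) (by omega) ?_)
      (ih c y (by omega) hcy h3 (by omega) ?_)
    · rcases hc with rfl | hc
      · exact hadj x
      · exact hR _ _ hc
    · rcases hcy' with rfl | hc
      · exact hadj c
      · exact hR _ _ hc
    · exact hc.imp_right .inl
    · exact hcy'.imp_right .inl

section MinStruct

variable {n m : ℤ} {R : ℤ → ℤ → Prop} {x : ℤ → ℤ}

lemma Tri.eq_add_one_of_covers {a b : ℤ}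
    (hc : ∀ v, n + 1 ≤ v → v ≤ n + m + 1 → R (v - 1) (v + 1))
    (h : Tri R a b) : n ≤ a → b ≤ n + m + 2 → ¬ R a b → b = a + 1 := by
  induction h with
  | leaf a => intros; rfl
  | @node a c b h1 h2 h3 h4 _ _ ih1 ih2 =>
    intro ha hb hR
    have e1 := ih1 ha (by omega) h3
    have e2 := ih2 (by omega) hb h4
    obtain rfl : a = c - 1 := by omega
    subst e2
    exact absurd (hc c (by omega) (by omega)) hR

lemma Tri.lt_of_covers {w z : ℤ} (hc : ∀ v, n + 1 ≤ v → v ≤ n + m + 1 → R (v - 1) (v + 1))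
    (hx : ∀ w, m + 3 ≤ w → w < n → 1 ≤ x w ∧ R w (x w + n))
    (hnc : ∀ w w', m + 3 ≤ w → w < w' → w' < n → x w' ≤ x w + 1) (h : Tri R w z) :
    m + 3 ≤ w → w < n → n + 1 ≤ z → z ≤ n + m + 2 → ¬ R w z → z < x w + n := by
  induction h with
  | leaf a => intros; omega
  | @node w c z h1 h2 h3 h4 _ t2 ih1 ih2 =>
    intro hw hw' hz hz' hR
    have hne : z ≠ x w + n := by rintro rfl; exact hR (hx w hw hw').2
    have := (hx w hw hw').1
    rcases lt_trichotomy c n with h | rfl | h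
    · have := ih2 (by omega) h hz hz' h4
      have := hnc w c hw h1 h
      omega
    · have := t2.eq_add_one_of_covers hc le_rfl hz' h4
      omega
    · have := t2.eq_add_one_of_covers hc (by omega) hz' h4
      have := ih1 hw hw' (by omega) (by omega) h3
      omega

lemma Tri.false_of_covers (hm : 0 ≤ m) (hn : m + 3 ≤ n)
    (hc : ∀ v, n + 1 ≤ v → v ≤ n + m + 1 → R (v - 1) (v + 1)) (hlast : R (m + 2) (m + n))
    (hx : ∀ w, m + 3 ≤ w → w < n → 1 ≤ x w ∧ x w ≤ m + 1 ∧ R w (x w + n))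
    (hnc : ∀ w w', m + 3 ≤ w → w < w' → w' < n → x w' ≤ x w + 1)
    (h : Tri R (m + 2) (m + 2 + n - 1)) : False := by
  generalize ha : m + 2 = a at h
  generalize hb : a + n - 1 = b at h
  cases h with
  | leaf => omega
  | @node _ c _ h1 h2 h3 h4 t1 t2 =>
    rcases lt_or_ge c n with h | h
    · have := t2.lt_of_covers hc (fun w h1 h2 => ⟨(hx w h1 h2).1, (hx w h1 h2).2.2⟩) hnc (by omega) h
        (by omega) (by omega) h4
      have := hx c (by omega) h
      omega
    · have := t2.eq_add_one_of_covers hc h (by omega) h4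
      obtain rfl : c = m + n := by omega
      subst ha
      exact h3 hlast

end MinStruct

variable {n : ℕ} {B : Finset (Sym2 (ZMod n))}

lemma IsSaturatedBlocker.isDiagonal (hB : IsSaturatedBlocker n B) {e : Sym2 (ZMod n)} (he : e ∈ B) :
    IsDiagonal n e := by
  by_contra hd
  refine hB.2 e he ⟨fun f hf => hB.1.1 f (mem_of_mem_erase hf), fun T hT => ?_⟩
  obtain ⟨f, hf⟩ := hB.1.2 T hT
  obtain ⟨h1, h2⟩ := mem_inter.1 hf
  refine ⟨f, mem_inter.2 ⟨mem_erase.2 ⟨?_, h1⟩, h2⟩⟩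
  rintro rfl
  exact hd (hT.1 _ h2)

lemma IsSaturatedBlocker.not_minStruct (hn : 3 ≤ n) (hB : IsSaturatedBlocker n B)
    (hcard : B.card = n - 1) (s : ℤ) : ¬ MinStruct n (fun x y => rel n B (x + s) (y + s)) := by
  rintro ⟨m, x, hm, hmn, hc, hx, hnc⟩
  classical
  let F : Finset (Sym2 (ZMod n)) :=
    (Icc 1 (m + 1)).image (fun j : ℤ => s(((j - 1 + s : ℤ) : ZMod n), ((j + 1 + s : ℤ) : ZMod n))) ∪
    (Ico (m + 3) (n : ℤ)).image (fun w : ℤ => s(((w + s : ℤ) : ZMod n), ((x w + s : ℤ) : ZMod n)))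
  have hF1 : ∀ j, 1 ≤ j → j ≤ m + 1 → rel n F (j - 1 + s) (j + 1 + s) := fun j h1 h2 =>
    mem_union_left _ (mem_image.2 ⟨j, mem_Icc.2 ⟨h1, h2⟩, rfl⟩)
  have hF2 : ∀ w, m + 3 ≤ w → w < n → rel n F (w + s) (x w + s) := fun w h1 h2 =>
    mem_union_right _ (mem_image.2 ⟨w, mem_Ico.2 ⟨h1, h2⟩, rfl⟩)
  have hFB : F ⊆ B := by
    intro e he
    rcases mem_union.1 he with he | he <;> obtain ⟨j, hj, rfl⟩ := mem_image.1 he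
    · exact hc j (mem_Icc.1 hj).1 (mem_Icc.1 hj).2
    · exact (hx j (mem_Ico.1 hj).1 (mem_Ico.1 hj).2).2.2
  have hFc : F.card < B.card := by
    have h1 : F.card ≤ (Icc 1 (m + 1)).card + (Ico (m + 3) (n : ℤ)).card :=
      (card_union_le _ _).trans (add_le_add card_image_le card_image_le)
    rw [Int.card_Icc, Int.card_Ico] at h1
    omega
  obtain ⟨e, he, heF⟩ := exists_mem_notMem_of_card_lt_card hFc
  refine hB.2 e he ⟨fun f hf => hB.1.1 f (mem_of_mem_erase hf), fun T hT => ?_⟩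
  by_contra hemp
  have hdisj : ∀ f ∈ T, f ∉ F := fun f hf hfF => hemp
    ⟨f, mem_inter.2 ⟨mem_erase.2 ⟨fun h => heF (h ▸ hfF), hFB hfF⟩, hf⟩⟩
  have ht := (hT.tri hn (R := rel n F) (fun y h => not_isDiagonal_succ (by omega) y
    (hB.isDiagonal (hFB h))) (fun y z h => hdisj _ h) (m + 2 + s)).shift s
  rw [show m + 2 + s - s = m + 2 by ring, show m + 2 + s + n - 1 - s = m + 2 + n - 1 by ring] at ht
  have per : ∀ y z : ℤ, rel n F y z → rel n F y (z + n) := fun y z h => rel_add.2 h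
  refine ht.false_of_covers (x := x) hm hmn (fun v h1 h2 => ?_) ?_ (fun w h1 h2 => ?_) hnc
  · have := per _ _ (rel_symm (per _ _ (hF1 (v - n) (by omega) (by omega))))
    convert rel_symm this using 1 <;> ring
  · have := per _ _ (rel_symm (hF1 (m + 1) (by omega) le_rfl))
    convert this using 1 <;> ring
  · have := per _ _ (hF2 w h1 h2)
    refine ⟨(hx w h1 h2).1, (hx w h1 h2).2.1, ?_⟩
    convert this using 1; ring

lemma IsSaturatedBlocker.cfg (hn : 5 < n) (hB : IsSaturatedBlocker n B)
    (hcard : B.card = n - 1) : Cfg n (rel n B) where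
  six_le := by omega
  symm _ _ := rel_symm
  per _ _ := rel_add
  irr _ h := not_isDiagonal_self _ (hB.isDiagonal h)
  adj x h := not_isDiagonal_succ (by omega) x (hB.isDiagonal h)
  blk := hB.1.not_tri (by omega)
  card_le a S hS := by
    have := card_le_card_of_injOn (s := S) (t := B)
      (fun p => s((p.1 : ZMod n), (p.2 : ZMod n))) (fun p hp => (hS p hp).2.2.2) ?_
    · omega
    · intro p hp q hq e
      have h1 := hS p hp
      have h2 := hS q hq
      have := sym2_intCast_inj (a := a) (by omega) (by omega) (by omega) (by omega) (by omega)
        (by omega) (by omega) (by omega) e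
      exact Prod.ext (by omega) (by omega)
  noMin := hB.not_minStruct (by omega) hcard

lemma mem_of_rel {X Y : ℤ} (h : rel n B X Y) {a b : ℕ} (ha : (a : ℤ) = X) (hb : (b : ℤ) = Y) :
    s((a : ZMod n), (b : ZMod n)) ∈ B := by
  subst ha hb; simpa [rel] using h

/-- A set of at most `n - 1` edges equals any subset containing `n - 1` distinct edges. -/
lemma eq_of_injective_edges {F : Finset (Sym2 (ZMod n))} (hFB : F ⊆ B) (hB : B.card ≤ n - 1)
    (g : ℕ → ℕ × ℕ) (hlt : ∀ t < n - 1, (g t).1 < n ∧ (g t).2 < n)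
    (hg : ∀ t < n - 1, s(((g t).1 : ZMod n), ((g t).2 : ZMod n)) ∈ F)
    (hinj : ∀ t < n - 1, ∀ u < n - 1, (g t).1 = (g u).1 ∧ (g t).2 = (g u).2 ∨
      (g t).1 = (g u).2 ∧ (g t).2 = (g u).1 → t = u) : B = F := by
  refine (eq_of_subset_of_card_le hFB (hB.trans ?_)).symm
  rw [← card_range (n - 1)]
  refine card_le_card_of_injOn (fun t => s(((g t).1 : ZMod n), ((g t).2 : ZMod n)))
    (fun t ht => hg t (by simpa using ht)) fun t ht u hu e => ?_
  have ht : t < n - 1 := by simpa using ht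
  have hu : u < n - 1 := by simpa using hu
  have h1 := hlt t ht
  have h2 := hlt u hu
  have := sym2_intCast_inj (n := n) (a := 0) (x := (g t).1) (y := (g t).2) (x' := (g u).1)
    (y' := (g u).2) (by omega) (by omega) (by omega) (by omega) (by omega) (by omega) (by omega)
    (by omega) (by simpa using e)
  exact hinj t ht u hu (by omega)

lemma not_cross_of_le_add_one {v w i j : ℕ} (hv : v < n) (hw : w < n) (hiv : i < v) (hjw : j < w)
    (hvw : v < w → j ≤ i + 1) (hwv : w < v → i ≤ j + 1) (hij : i + 2 ≤ j ∨ j + 2 ≤ i) :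
    ¬ Cross n s((v : ZMod n), (i : ZMod n)) s((w : ZMod n), (j : ZMod n)) := by
  have := cross_iff (n := n) (a := 0) (x := i) (y := v) (x' := j) (y' := w) (by omega) (by omega)
    (by omega) (by omega) (by omega) (by omega) (by omega)
  rw [Sym2.eq_swap, Sym2.eq_swap (a := (w : ZMod n))]
  simp only [Int.cast_natCast] at this
  rw [this]
  omega

lemma SeagullData.seagullType (hB : B.card ≤ n - 1) (h : SeagullData n (rel n B)) :
    SeagullType n B := by
  obtain ⟨l, m, x, hl, hlm, hmn, hc, h1, h2, hx, hnc⟩ := h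
  lift l to ℕ using by omega
  lift m to ℕ using by omega
  obtain ⟨idx, hidx⟩ : ∃ idx : ℕ → ℕ, ∀ j ∈ Finset.Icc 1 (n - 3 - m), (idx j : ℤ) = x (m + 2 + j) ∧
      1 ≤ idx j ∧ idx j ≤ m + 1 ∧ idx j ≠ l ∧ rel n B (m + 2 + j) (x (m + 2 + j)) := by
    refine ⟨fun j => (x (m + 2 + j)).toNat, fun j hj => ?_⟩
    rw [mem_Icc] at hj
    dsimp only
    have := hx (m + 2 + j) (by omega) (by omega)
    refine ⟨?_, ?_, ?_, ?_, this.2.2.2⟩ <;> omega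
  refine ⟨l, m, by omega, by omega, by omega, by omega, idx,
    fun j hj => ?_, ?_, fun j₁ hj₁ j₂ hj₂ hne => ?_⟩
  · have := hidx j hj; omega
  · refine eq_of_injective_edges (fun e he => ?_) hB
      (fun t => if t = l - 1 then (l - 2, l + 1) else if t ≤ m then (t, t + 2) else
        if t = m + 1 then (l - 1, l + 2) else (t + 1, idx (t - m - 1)))
      (fun t ht => ?_) (fun t ht => ?_) (fun t ht u hu e => ?_)
    · simp only [mem_union, mem_insert, mem_singleton, mem_image, mem_range] at he
      rcases he with (((rfl | rfl | rfl | rfl) | ⟨j, hj, rfl⟩) | ⟨j, hj, rfl⟩) | ⟨j, hj, rfl⟩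
      · exact mem_of_rel (hc (l - 1) (by omega) (by omega) (by omega)) (by omega) (by omega)
      · exact mem_of_rel h1 (by omega) (by omega)
      · exact mem_of_rel h2 (by omega) (by omega)
      · exact mem_of_rel (hc (l + 1) (by omega) (by omega) (by omega)) (by omega) (by omega)
      · exact mem_of_rel (hc (j + 1) (by omega) (by omega) (by omega)) (by omega) (by omega)
      · rw [mem_Icc] at hj
        exact mem_of_rel (hc (j + 1) (by omega) (by omega) (by omega)) (by omega) (by omega)
      · have := hidx j hj
        exact mem_of_rel this.2.2.2.2 (by omega) (by omega)
    · have ht' := hidx (t - m - 1)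
      rw [mem_Icc] at ht'
      split_ifs <;> dsimp only <;> omega
    · simp only [mem_union, mem_insert, mem_singleton, mem_image, mem_range]
      split_ifs with c1 c2 c3
      · exact .inl (.inl (.inl (.inr (.inl rfl))))
      · rcases lt_trichotomy t (l - 2) with h | rfl | h
        · exact .inl (.inl (.inr ⟨t, h, rfl⟩))
        · rw [show l - 2 + 2 = l by omega]
          exact .inl (.inl (.inl (.inl rfl)))
        · rcases eq_or_ne t l with rfl | h'
          · exact .inl (.inl (.inl (.inr (.inr (.inr rfl)))))
          · exact .inl (.inr ⟨t, by rw [mem_Icc]; omega, rfl⟩)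
      · exact .inl (.inl (.inl (.inr (.inr (.inl rfl)))))
      · refine .inr ⟨t - m - 1, by rw [mem_Icc]; omega, ?_⟩
        rw [show m + 2 + (t - m - 1) = t + 1 by omega]
    · have ht' := hidx (t - m - 1)
      have hu' := hidx (u - m - 1)
      rw [mem_Icc] at ht' hu'
      split_ifs at e <;> dsimp only at e <;> omega
  · have k1 := hidx j₁ hj₁
    have k2 := hidx j₂ hj₂
    rw [mem_Icc] at hj₁ hj₂
    refine not_cross_of_le_add_one (by omega) (by omega) (by omega) (by omega) (fun h => ?_)
      (fun h => ?_) hne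
    · have := hnc (m + 2 + j₁) (m + 2 + j₂) (by omega) (by omega) (by omega)
      omega
    · have := hnc (m + 2 + j₂) (m + 2 + j₁) (by omega) (by omega) (by omega)
      omega

lemma ButterflyData.butterflyType (hB : B.card ≤ n - 1) (h : ButterflyData n (rel n B)) :
    ButterflyType n B := by
  obtain ⟨l, m, x, hl, hlm, hmn, hc, h1, h2, h3, hx, hnc⟩ := h
  lift l to ℕ using by omega
  lift m to ℕ using by omega
  obtain ⟨idx, hidx⟩ : ∃ idx : ℕ → ℕ, ∀ j ∈ Finset.Icc 1 (n - 3 - m), (idx j : ℤ) = x (m + 2 + j) ∧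
      1 ≤ idx j ∧ idx j ≤ m + 1 ∧ idx j ≠ l ∧ idx j ≠ l + 1 ∧
      rel n B (m + 2 + j) (x (m + 2 + j)) := by
    refine ⟨fun j => (x (m + 2 + j)).toNat, fun j hj => ?_⟩
    rw [mem_Icc] at hj
    dsimp only
    have := hx (m + 2 + j) (by omega) (by omega)
    refine ⟨?_, ?_, ?_, ?_, ?_, this.2.2.2.2⟩ <;> omega
  refine ⟨l, m, by omega, by omega, by omega, by omega, idx,
    fun j hj => ?_, ?_, fun j₁ hj₁ j₂ hj₂ hne => ?_⟩
  · have := hidx j hj; omega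
  · refine eq_of_injective_edges (fun e he => ?_) hB
      (fun t => if t = l - 1 then (l - 2, l + 1) else if t = l then (l, l + 3) else
        if t ≤ m then (t, t + 2) else if t = m + 1 then (l - 1, l + 2) else (t + 1, idx (t - m - 1)))
      (fun t ht => ?_) (fun t ht => ?_) (fun t ht u hu e => ?_)
    · simp only [mem_union, mem_insert, mem_singleton, mem_image, mem_range] at he
      rcases he with (((rfl | rfl | rfl | rfl | rfl) | ⟨j, hj, rfl⟩) | ⟨j, hj, rfl⟩) | ⟨j, hj, rfl⟩
      · exact mem_of_rel (hc (l - 1) (by omega) (by omega) (by omega) (by omega)) (by omega)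
          (by omega)
      · exact mem_of_rel h1 (by omega) (by omega)
      · exact mem_of_rel h2 (by omega) (by omega)
      · exact mem_of_rel h3 (by omega) (by omega)
      · exact mem_of_rel (hc (l + 2) (by omega) (by omega) (by omega) (by omega)) (by omega)
          (by omega)
      · exact mem_of_rel (hc (j + 1) (by omega) (by omega) (by omega) (by omega)) (by omega)
          (by omega)
      · rw [mem_Icc] at hj
        exact mem_of_rel (hc (j + 1) (by omega) (by omega) (by omega) (by omega)) (by omega)
          (by omega)
      · have := hidx j hj
        exact mem_of_rel this.2.2.2.2.2 (by omega) (by omega)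
    · have ht' := hidx (t - m - 1)
      rw [mem_Icc] at ht'
      split_ifs <;> dsimp only <;> omega
    · simp only [mem_union, mem_insert, mem_singleton, mem_image, mem_range]
      split_ifs with c1 c2 c3 c4
      · exact .inl (.inl (.inl (.inr (.inl rfl))))
      · exact .inl (.inl (.inl (.inr (.inr (.inr (.inl rfl))))))
      · rcases lt_trichotomy t (l - 2) with h | rfl | h
        · exact .inl (.inl (.inr ⟨t, h, rfl⟩))
        · rw [show l - 2 + 2 = l by omega]
          exact .inl (.inl (.inl (.inl rfl)))
        · rcases eq_or_ne t (l + 1) with rfl | h'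
          · exact .inl (.inl (.inl (.inr (.inr (.inr (.inr rfl))))))
          · exact .inl (.inr ⟨t, by rw [mem_Icc]; omega, rfl⟩)
      · exact .inl (.inl (.inl (.inr (.inr (.inl rfl)))))
      · refine .inr ⟨t - m - 1, by rw [mem_Icc]; omega, ?_⟩
        rw [show m + 2 + (t - m - 1) = t + 1 by omega]
    · have ht' := hidx (t - m - 1)
      have hu' := hidx (u - m - 1)
      rw [mem_Icc] at ht' hu'
      split_ifs at e <;> dsimp only at e <;> omega
  · have k1 := hidx j₁ hj₁
    have k2 := hidx j₂ hj₂
    rw [mem_Icc] at hj₁ hj₂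
    refine not_cross_of_le_add_one (by omega) (by omega) (by omega) (by omega) (fun h => ?_)
      (fun h => ?_) hne
    · have := hnc (m + 2 + j₁) (m + 2 + j₂) (by omega) (by omega) (by omega)
      omega
    · have := hnc (m + 2 + j₂) (m + 2 + j₁) (by omega) (by omega) (by omega)
      omega

lemma BouquetData.bouquetType (hB : B.card ≤ n - 1) (h : BouquetData n (rel n B)) :
    BouquetType n B := by
  obtain ⟨l, m, k, q, x, hl, hlm, hmk, hkq, hqn, hc, h1, h2, h3, hx1, hx2, hx3, hnc⟩ := h
  lift l to ℕ using by omega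
  lift m to ℕ using by omega
  lift k to ℕ using by omega
  obtain ⟨t, rfl⟩ : ∃ t : ℕ, q = k + t := ⟨(q - k).toNat, by omega⟩
  obtain ⟨idx, hidx⟩ : ∃ idx : ℕ → ℕ, ∀ j : ℕ, 1 ≤ x (m + 2 + j) → (idx j : ℤ) = x (m + 2 + j) :=
    ⟨fun j => (x (m + 2 + j)).toNat, fun j hj => by dsimp only; omega⟩
  have hL : ∀ j ∈ Finset.Icc 1 (k - m - 3), (idx j : ℤ) = x (m + 2 + j) ∧
      l ≤ idx j ∧ idx j ≤ m + 1 ∧ rel n B (m + 2 + j) (x (m + 2 + j)) := by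
    intro j hj
    rw [mem_Icc] at hj
    have := hx1 (m + 2 + j) (by omega) (by omega)
    have := hidx j (by omega)
    refine ⟨?_, ?_, ?_, (hx1 (m + 2 + j) (by omega) (by omega)).2.2⟩ <;> omega
  have hR : ∀ j ∈ Finset.Icc (k + t - m - 1) (n - 3 - m), (idx j : ℤ) = x (m + 2 + j) ∧
      1 ≤ idx j ∧ idx j ≤ l ∧ rel n B (m + 2 + j) (x (m + 2 + j)) := by
    intro j hj
    rw [mem_Icc] at hj
    have := hx3 (m + 2 + j) (by omega) (by omega)
    have := hidx j (by omega)
    refine ⟨?_, ?_, ?_, (hx3 (m + 2 + j) (by omega) (by omega)).2.2⟩ <;> omega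
  refine ⟨l, m, k, t, by omega, by omega, by omega, by omega, by omega, idx,
    fun j hj => ⟨(hL j hj).2.1, (hL j hj).2.2.1⟩, fun j hj => ⟨(hR j hj).2.1, (hR j hj).2.2.1⟩, ?_,
    fun j₁ hj₁ j₂ hj₂ hne => ?_⟩
  · refine eq_of_injective_edges (fun e he => ?_) hB
      (fun u => if u ≤ m then (u, u + 2) else if u = m + 1 then (k, k + t) else
        if u + 1 = k then (k, l - 1) else if u + 1 = k + t then (k + t, l + 1) else
        if k < u + 1 ∧ u + 1 < k + t then (u + 1, l) else (u + 1, idx (u - m - 1)))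
      (fun u hu => ?_) (fun u hu => ?_) (fun u hu v hv e => ?_)
    · simp only [mem_union, mem_insert, mem_singleton, mem_image, mem_range] at he
      rcases he with (((((rfl | rfl | rfl | rfl) | ⟨j, hj, rfl⟩) | ⟨j, hj, rfl⟩) | ⟨j, hj, rfl⟩) |
        ⟨j, hj, rfl⟩) | ⟨j, hj, rfl⟩
      · exact mem_of_rel (hc l (by omega) (by omega)) (by omega) (by omega)
      · exact mem_of_rel h1 (by omega) (by omega)
      · exact mem_of_rel h2 (by omega) (by omega)
      · exact mem_of_rel h3 (by omega) (by omega)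
      · rw [mem_Icc] at hj
        exact mem_of_rel (hx2 (k + j) (by omega) (by omega)) (by omega) (by omega)
      · rw [mem_Icc] at hj
        exact mem_of_rel (hc (j + 1) (by omega) (by omega)) (by omega) (by omega)
      · exact mem_of_rel (hc (j + 1) (by omega) (by omega)) (by omega) (by omega)
      · have := hL j hj
        exact mem_of_rel this.2.2.2 (by omega) (by omega)
      · have := hR j hj
        exact mem_of_rel this.2.2.2 (by omega) (by omega)
    · have hu₁ := hL (u - m - 1)
      have hu₂ := hR (u - m - 1)
      rw [mem_Icc] at hu₁ hu₂
      split_ifs <;> dsimp only <;> omega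
    · simp only [mem_union, mem_insert, mem_singleton, mem_image, mem_range]
      split_ifs with c1 c2 c3 c4 c5
      · rcases lt_trichotomy u (l - 1) with h | rfl | h
        · exact .inl (.inl (.inr ⟨u, h, rfl⟩))
        · rw [show l - 1 + 2 = l + 1 by omega]
          exact .inl (.inl (.inl (.inl (.inl (.inl rfl)))))
        · exact .inl (.inl (.inl (.inr ⟨u, by rw [mem_Icc]; omega, rfl⟩)))
      · exact .inl (.inl (.inl (.inl (.inl (.inr (.inr (.inr rfl)))))))
      · exact .inl (.inl (.inl (.inl (.inl (.inr (.inl rfl))))))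
      · exact .inl (.inl (.inl (.inl (.inl (.inr (.inr (.inl rfl)))))))
      · refine .inl (.inl (.inl (.inl (.inr ⟨u + 1 - k, by rw [mem_Icc]; omega, ?_⟩))))
        rw [show k + (u + 1 - k) = u + 1 by omega]
      · have he : m + 2 + (u - m - 1) = u + 1 := by omega
        rcases lt_or_ge u k with h | h
        · exact .inl (.inr ⟨u - m - 1, by rw [mem_Icc]; omega, by rw [he]⟩)
        · exact .inr ⟨u - m - 1, by rw [mem_Icc]; omega, by rw [he]⟩
    · have hu₁ := hL (u - m - 1)
      have hu₂ := hR (u - m - 1)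
      have hv₁ := hL (v - m - 1)
      have hv₂ := hR (v - m - 1)
      rw [mem_Icc] at hu₁ hu₂ hv₁ hv₂
      split_ifs at e <;> dsimp only at e <;> omega
  · have key : ∀ j ∈ Finset.Icc 1 (k - m - 3) ∪ Finset.Icc (k + t - m - 1) (n - 3 - m),
        (idx j : ℤ) = x (m + 2 + j) ∧ idx j ≤ m + 1 ∧ 1 ≤ j ∧ m + 2 + j < n ∧
        (m + 2 + j < k ∨ k + t < m + 2 + j) := by
      intro j hj
      rcases mem_union.1 hj with hj | hj
      · have := hL j hj
        rw [mem_Icc] at hj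
        omega
      · have := hR j hj
        rw [mem_Icc] at hj
        omega
    have k1 := key j₁ hj₁
    have k2 := key j₂ hj₂
    refine not_cross_of_le_add_one (by omega) (by omega) (by omega) (by omega) (fun h => ?_)
      (fun h => ?_) hne
    · have := hnc (m + 2 + j₁) (m + 2 + j₂) (by omega) (by omega) (by omega) (by omega) (by omega)
      omega
    · have := hnc (m + 2 + j₂) (m + 2 + j₁) (by omega) (by omega) (by omega) (by omega) (by omega)
      omega

lemma rel_image_add (s : ℤ) {x y : ℤ} (h : rel n B (x + s) (y + s)) :
    rel n (B.image (Sym2.map (fun z => z + -(s : ZMod n)))) x y :=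
  mem_image.2 ⟨_, h, by simp⟩

lemma SeagullData.mono {n : ℤ} {R Q : ℤ → ℤ → Prop} (h : SeagullData n R)
    (hRQ : ∀ x y, R x y → Q x y) : SeagullData n Q := by
  obtain ⟨l, m, x, hl, hlm, hmn, hc, h1, h2, hx, hnc⟩ := h
  exact ⟨l, m, x, hl, hlm, hmn, fun j a b c => hRQ _ _ (hc j a b c), hRQ _ _ h1, hRQ _ _ h2,
    fun w a b => ⟨(hx w a b).1, (hx w a b).2.1, (hx w a b).2.2.1, hRQ _ _ (hx w a b).2.2.2⟩, hnc⟩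

lemma ButterflyData.mono {n : ℤ} {R Q : ℤ → ℤ → Prop} (h : ButterflyData n R)
    (hRQ : ∀ x y, R x y → Q x y) : ButterflyData n Q := by
  obtain ⟨l, m, x, hl, hlm, hmn, hc, h1, h2, h3, hx, hnc⟩ := h
  exact ⟨l, m, x, hl, hlm, hmn, fun j a b c d => hRQ _ _ (hc j a b c d), hRQ _ _ h1, hRQ _ _ h2,
    hRQ _ _ h3, fun w a b => ⟨(hx w a b).1, (hx w a b).2.1, (hx w a b).2.2.1, (hx w a b).2.2.2.1,
      hRQ _ _ (hx w a b).2.2.2.2⟩, hnc⟩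

lemma BouquetData.mono {n : ℤ} {R Q : ℤ → ℤ → Prop} (h : BouquetData n R)
    (hRQ : ∀ x y, R x y → Q x y) : BouquetData n Q := by
  obtain ⟨l, m, k, q, x, hl, hlm, hmk, hkq, hqn, hc, h1, h2, h3, hx1, hx2, hx3, hnc⟩ := h
  exact ⟨l, m, k, q, x, hl, hlm, hmk, hkq, hqn, fun j a b => hRQ _ _ (hc j a b), hRQ _ _ h1,
    hRQ _ _ h2, hRQ _ _ h3,
    fun w a b => ⟨(hx1 w a b).1, (hx1 w a b).2.1, hRQ _ _ (hx1 w a b).2.2⟩,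
    fun w a b => hRQ _ _ (hx2 w a b),
    fun w a b => ⟨(hx3 w a b).1, (hx3 w a b).2.1, hRQ _ _ (hx3 w a b).2.2⟩, hnc⟩

end ConvexBlocker

open ConvexBlocker in
/-- for `n > 5`, every saturated blocker of size `n-1` of the convex `n`-gon is,
up to a cyclic rotation of the vertex labels, of one of the three types: seagull, butterfly
or bouquet. -/
theorem characterization_of_saturated_blockers_of_size_n_sub_one
    (n : ℕ) (hn : 5 < n) (B : Finset (Sym2 (ZMod n)))
    (hB : IsSaturatedBlocker n B) (hcard : B.card = n - 1) :
    ∃ r : ZMod n,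
      SeagullType n (B.image (Sym2.map (fun x => x + r))) ∨
      ButterflyType n (B.image (Sym2.map (fun x => x + r))) ∨
      BouquetType n (B.image (Sym2.map (fun x => x + r))) := by
  have hle : ∀ r : ZMod n, (B.image (Sym2.map (fun x => x + r))).card ≤ n - 1 := fun r =>
    hcard ▸ card_image_le
  rcases (hB.cfg hn hcard).classification with ⟨s, h⟩ | ⟨s, h⟩ | ⟨s, h⟩
  · exact ⟨_, .inl ((h.mono fun _ _ => rel_image_add s).seagullType (hle _))⟩
  · exact ⟨_, .inr (.inl ((h.mono fun _ _ => rel_image_add s).butterflyType (hle _)))⟩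
  · exact ⟨_, .inr (.inr ((h.mono fun _ _ => rel_image_add s).bouquetType (hle _)))⟩
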